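/- Let M_1,…,M_k be compact connected oriented n-dimensional manifolds, n ≥ 2, such that the fundamental group of every boundary component of every M_j is amenable, and let M be the (connected, oriented) manifold obtained by gluing M_1,…,M_k along some of their boundary components via orientation-reversing homeomorphisms. Then ‖M,∂M‖ ≤ ‖M_1,∂M_1‖ + … + ‖M_k,∂M_k‖. -/

import Mathlib

noncomputable section

namespace BddCoh

/-! ### Singular chains and homology -/

/-- The standard `n`-simplex. -/
abbrev Δ (n : ℕ) : Set (Fin (n + 1) → ℝ) := stdSimplex ℝ (Fin (n + 1))

/-- Singular `n`-simplices in `X`. -/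
abbrev SSimplex (X : Type) [TopologicalSpace X] (n : ℕ) := C(Δ n, X)

/-- Singular `n`-chains in `X` with coefficients in `R`. -/
def SChain (R : Type) [Ring R] (X : Type) [TopologicalSpace X] (n : ℕ) : Type :=
  SSimplex X n →₀ R

instance (R : Type) [Ring R] (X : Type) [TopologicalSpace X] (n : ℕ) :
    AddCommGroup (SChain R X n) := Finsupp.instAddCommGroup

instance (R : Type) [Ring R] (X : Type) [TopologicalSpace X] (n : ℕ) :
    Module R (SChain R X n) := Finsupp.module (SSimplex X n) R

/-- Chains are finitely supported functions on simplices. -/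
def chainEquiv (R : Type) [Ring R] (X : Type) [TopologicalSpace X] (n : ℕ) :
    (SSimplex X n →₀ R) ≃ₗ[R] SChain R X n := LinearEquiv.refl R (SChain R X n)

/-- The `i`-th face inclusion of standard simplices. -/
def face {n : ℕ} (i : Fin (n + 2)) : C(Δ n, Δ (n + 1)) where
  toFun x := ⟨i.insertNth 0 x.1, by
    refine ⟨fun j => ?_, ?_⟩
    · refine Fin.succAboveCases i ?_ (fun j => ?_) j
      · simp
      · simp [x.2.1 j]
    · rw [Fin.sum_univ_succAbove _ i]
      simp [x.2.2]⟩
  continuous_toFun := by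
    refine Continuous.subtype_mk ?_ _
    exact Continuous.finInsertNth i continuous_const continuous_subtype_val

variable {X : Type} [TopologicalSpace X] {R : Type} [Ring R]

/-- The `i`-th face of a singular `(n+1)`-simplex. -/
def faceOf {n : ℕ} (σ : SSimplex X (n + 1)) (i : Fin (n + 2)) : SSimplex X n :=
  σ.comp (face i)

/-- The boundary of a singular `(n+1)`-simplex, as a chain. -/
def bdryChain (R : Type) [Ring R] {n : ℕ} (σ : SSimplex X (n + 1)) : SChain R X n :=
  chainEquiv R X n (∑ i : Fin (n + 2), Finsupp.single (faceOf σ i) ((-1 : R) ^ (i : ℕ)))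

/-- The singular boundary operator. -/
def bdry (R : Type) [Ring R] (X : Type) [TopologicalSpace X] (n : ℕ) :
    SChain R X (n + 1) →ₗ[R] SChain R X n :=
  (Finsupp.linearCombination R (bdryChain R)).comp (chainEquiv R X (n + 1)).symm.toLinearMap

/-- The ℓ¹-norm of a real singular chain. -/
def l1 {n : ℕ} (c : SChain ℝ X n) : ℝ :=
  ((chainEquiv ℝ X n).symm c).sum fun _ r => |r|

/-- The submodule of chains supported on simplices with image contained in `Y`. -/
def chainsIn (R : Type) [Ring R] (X : Type) [TopologicalSpace X] (Y : Set X) (n : ℕ) :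
    Submodule R (SChain R X n) :=
  (Finsupp.supported R R {σ : SSimplex X n | Set.range σ ⊆ Y}).map (chainEquiv R X n).toLinearMap

/-- Relative `(n+1)`-cycles of the pair `(X, Y)`. -/
def relCycles (R : Type) [Ring R] (X : Type) [TopologicalSpace X] (Y : Set X) (n : ℕ) :
    Submodule R (SChain R X (n + 1)) :=
  (chainsIn R X Y n).comap (bdry R X n)

/-- Relative `(n+1)`-boundaries of the pair `(X, Y)`. -/
def relBdries (R : Type) [Ring R] (X : Type) [TopologicalSpace X] (Y : Set X) (n : ℕ) :
    Submodule R (SChain R X (n + 1)) :=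
  LinearMap.range (bdry R X (n + 1)) ⊔ chainsIn R X Y (n + 1)

/-- Relative singular homology `H_{n+1}(X, Y; R)`. -/
def relHomology (R : Type) [Ring R] (X : Type) [TopologicalSpace X] (Y : Set X) (n : ℕ) :=
  relCycles R X Y n ⧸ ((relBdries R X Y n).comap (relCycles R X Y n).subtype)

instance (Y : Set X) (n : ℕ) : AddCommGroup (relHomology R X Y n) :=
  Submodule.Quotient.addCommGroup _

instance (Y : Set X) (n : ℕ) : Module R (relHomology R X Y n) :=
  Submodule.Quotient.module _

/-- The class of a relative cycle in relative homology. -/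
def relHomClass {Y : Set X} {n : ℕ} (c : relCycles R X Y n) : relHomology R X Y n :=
  Submodule.Quotient.mk c

/-- The ℓ¹-seminorm on relative singular homology. -/
def l1HomNorm {Y : Set X} {n : ℕ} (α : relHomology ℝ X Y n) : ℝ :=
  sInf {r : ℝ | ∃ c : relCycles ℝ X Y n, relHomClass c = α ∧ r = l1 c.1}


/-! ### Amenability and countable CW pairs -/

/-- A group is amenable if it admits a left-invariant finitely additive
probability measure defined on all subsets. -/
def IsAmenable (G : Type*) [Group G] : Prop :=
  ∃ m : Set G → ℝ, (∀ A, 0 ≤ m A) ∧ m Set.univ = 1 ∧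
    (∀ A B, Disjoint A B → m (A ∪ B) = m A + m B) ∧
    (∀ (g : G) (A : Set G), m ((g * ·) '' A) = m A)

universe u

open CategoryTheory in
/-- A type witnessing that `X'` is obtained from `X` by attaching generalized cells `f : S ⟶ D`
(as in Mathlib of December 2024). -/
structure RelativeCWComplex.AttachGeneralizedCells {S D : TopCat.{u}} (f : S ⟶ D)
    (X X' : TopCat.{u}) where
  /-- The index type over the generalized cells -/
  cells : Type u
  /-- An attaching map for each generalized cell -/
  attachMaps : cells → (S ⟶ X)
  /-- `X'` is the pushout of `∐ S ⟶ X` and `∐ S ⟶ ∐ D`. -/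
  iso_pushout : X' ≅ Limits.pushout (Limits.Sigma.desc attachMaps)
    (Limits.Sigma.map fun (_ : cells) ↦ f)

/-- A type witnessing that `X'` is obtained from `X` by attaching `n`-disks
(as in Mathlib of December 2024). -/
def RelativeCWComplex.AttachCells (n : ℕ) :=
  RelativeCWComplex.AttachGeneralizedCells (TopCat.diskBoundaryInclusion.{u} n)

/-- A relative CW-complex (as in Mathlib of December 2024): `sk 0` (the `(-1)`-skeleton) is an
arbitrary topological space, and each `sk (n + 1)` (the `n`-skeleton) is obtained from `sk n`
by attaching `n`-disks. -/
structure RelativeCWComplex where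
  /-- The skeletons. Note: `sk i` is usually called the `(i - 1)`-skeleton. -/
  sk : ℕ → TopCat.{u}
  /-- Each `sk (n + 1)` is obtained from `sk n` by attaching `n`-disks. -/
  attachCells (n : ℕ) : RelativeCWComplex.AttachCells n (sk n) (sk (n + 1))

/-- A CW-complex is a relative CW-complex whose `sk 0` is empty (as in Mathlib of
December 2024). -/
structure CWComplex extends RelativeCWComplex.{u} where
  /-- `sk 0` (i.e., the `(-1)`-skeleton) is empty. -/
  isEmpty_sk_zero : IsEmpty (sk 0)

open CategoryTheory in
/-- The inclusion map from `X` to `X'`, when `X'` is obtained from `X` by attaching generalized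
cells `f : S ⟶ D` (as in Mathlib of December 2024). -/
def RelativeCWComplex.AttachGeneralizedCells.inclusion {S D : TopCat.{u}} {f : S ⟶ D}
    {X X' : TopCat.{u}} (att : RelativeCWComplex.AttachGeneralizedCells f X X') : X ⟶ X' :=
  Limits.pushout.inl _ _ ≫ att.iso_pushout.inv

open CategoryTheory in
/-- The inclusion map from `sk n` to `sk (n + 1)` of a relative CW-complex (as in Mathlib of
December 2024). -/
def RelativeCWComplex.skInclusion (X : RelativeCWComplex.{u}) (n : ℕ) : X.sk n ⟶ X.sk (n + 1) :=
  RelativeCWComplex.AttachGeneralizedCells.inclusion (X.attachCells n)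

open CategoryTheory in
/-- The topology on a relative CW-complex (as in Mathlib of December 2024). -/
def RelativeCWComplex.toTopCat (X : RelativeCWComplex.{u}) : TopCat.{u} :=
  Limits.colimit (Functor.ofSequence X.skInclusion)

open CategoryTheory in
/-- `X` carries the structure of a countable CW-complex. -/
def IsCountableCW (X : Type) [TopologicalSpace X] : Prop :=
  ∃ C : CWComplex.{0}, (∀ n, Countable ((C.attachCells n).cells)) ∧
    Nonempty ((RelativeCWComplex.toTopCat C.toRelativeCWComplex : TopCat) ≅ TopCat.of X)

open CategoryTheory in
/-- `(X, Y)` is a pair of countable CW-complexes, i.e. `X` is a countable CW-complex and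
`Y` is a subcomplex of `X` (realized as the `(-1)`-skeleton of a relative CW-structure on `X`),
which is itself a countable CW-complex. -/
def IsCountableCWPair (X : Type) [TopologicalSpace X] (Y : Set X) : Prop :=
  IsCountableCW X ∧ IsCountableCW Y ∧
  ∃ (C : RelativeCWComplex.{0}) (φ : (RelativeCWComplex.toTopCat C : TopCat) ≅ TopCat.of X),
    (∀ n, Countable ((C.attachCells n).cells)) ∧
    Set.range (fun y => φ.hom ((Limits.colimit.ι (Functor.ofSequence C.skInclusion) 0) y)) = Y

/-- Every connected component of `Y` has amenable fundamental group. -/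
def AmenableComponents (Y : Type) [TopologicalSpace Y] : Prop :=
  ∀ y : Y, IsAmenable (FundamentalGroup (connectedComponent y) ⟨y, mem_connectedComponent⟩)


/-- The inclusion of a subspace, as a continuous map. -/
def subIncl {X : Type} [TopologicalSpace X] (Y : Set X) : C(↥Y, X) :=
  ⟨Subtype.val, continuous_subtype_val⟩

open CategoryTheory in
/-- The map induced by a continuous map on fundamental groups. -/
def pi1Map {X Y : Type} [TopologicalSpace X] [TopologicalSpace Y] (f : C(X, Y)) (x : X) :
    FundamentalGroup X x →* FundamentalGroup Y (f x) :=
  (FundamentalGroupoid.fundamentalGroupoidFunctor.map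
    (show TopCat.of X ⟶ TopCat.of Y from TopCat.ofHom f)).mapEnd ⟨x⟩

/-! ### Topological manifolds with boundary and fundamental classes -/

/-- The closed upper half space `ℍⁿ = {x : ℝⁿ | x₀ ≥ 0}`. -/
def halfSpace (n : ℕ) : Set (Fin n → ℝ) := {x | ∀ j : Fin n, (j : ℕ) = 0 → 0 ≤ x j}

/-- `M` is a topological `n`-manifold with boundary `B`: every point has an open
neighbourhood homeomorphic to an open subset of the closed half space `ℍⁿ`, with points of
`B` (and only those) corresponding to points of the boundary hyperplane. -/
def IsTopMfdWithBdry (n : ℕ) (M : Type) [TopologicalSpace M] (B : Set M) : Prop :=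
  T2Space M ∧
  ∀ x : M, ∃ (U : Set M) (V : Set ↥(halfSpace n)) (e : ↥U ≃ₜ ↥V),
    IsOpen U ∧ IsOpen V ∧ x ∈ U ∧
    ∀ y : ↥U, ((∀ j : Fin n, (j : ℕ) = 0 → ((e y : ↥(halfSpace n)) : Fin n → ℝ) j = 0) ↔
      (y : M) ∈ B)

/-- Extension of coefficients from `ℤ` to `ℝ` on singular chains. -/
def intChain {M : Type} [TopologicalSpace M] {m : ℕ} (z : SChain ℤ M m) : SChain ℝ M m :=
  chainEquiv ℝ M m
    (Finsupp.mapRange (Int.cast : ℤ → ℝ) (by simp) ((chainEquiv ℤ M m).symm z))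

/-- `μ ∈ H_{n+1}(M, B; ℝ)` is a fundamental class (with regular set `reg`): it is the
image of an integral relative homology class which induces a generator of the local
homology group `H_{n+1}(M, M ∖ {x}; ℤ)` at every point `x ∈ reg`. For a compact connected
oriented `(n+1)`-manifold `M` with boundary `B` one takes `reg = Bᶜ` (the interior), and
for the pseudomanifolds arising from generalized Dehn fillings one takes `reg` to be the
image of the interior of the filled manifold. -/
def IsFundClassOn (M : Type) [TopologicalSpace M] (B : Set M) (reg : Set M) (n : ℕ)
    (μ : relHomology ℝ M B n) : Prop :=
  ∃ (z : SChain ℤ M (n + 1)) (hz : z ∈ relCycles ℤ M B n),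
    (∃ hzr : intChain z ∈ relCycles ℝ M B n, relHomClass ⟨intChain z, hzr⟩ = μ) ∧
    ∀ x ∈ reg,
      ∃ hloc : z ∈ relCycles ℤ M ({x}ᶜ) n,
        ∀ β : relHomology ℤ M ({x}ᶜ) n, ∃ k : ℤ, β = k • relHomClass ⟨z, hloc⟩

/-- The fundamental class of a compact connected oriented manifold with boundary:
its regular points are all the interior points. -/
def IsFundClass (M : Type) [TopologicalSpace M] (B : Set M) (n : ℕ)
    (μ : relHomology ℝ M B n) : Prop :=
  IsFundClassOn M B Bᶜ n μ

/-! ### Gluings of manifolds along boundary components -/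

/-- The data of a gluing of the manifolds-with-boundary `(piece j, bdry j)`, `j < k`,
along (some of) their boundary components: a finite set `E` of gluings, each of which
identifies a boundary component `S₁ e` of the piece `j₁ e` with a boundary component
`S₂ e` of the piece `j₂ e` via a homeomorphism `glue e`; each boundary component is used
at most once. -/
structure GluingData (k : ℕ) where
  piece : Fin k → Type
  top : ∀ j, TopologicalSpace (piece j)
  bdry : ∀ j, Set (piece j)
  E : Type
  finE : Finite E
  j₁ : E → Fin k
  j₂ : E → Fin k
  S₁ : (e : E) → Set (piece (j₁ e))
  S₂ : (e : E) → Set (piece (j₂ e))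
  comp₁ : ∀ e, ∃ y ∈ bdry (j₁ e), S₁ e = connectedComponentIn (bdry (j₁ e)) y
  comp₂ : ∀ e, ∃ y ∈ bdry (j₂ e), S₂ e = connectedComponentIn (bdry (j₂ e)) y
  sub₁ : ∀ e, S₁ e ⊆ bdry (j₁ e)
  sub₂ : ∀ e, S₂ e ⊆ bdry (j₂ e)
  glue : (e : E) → ↥(S₁ e) ≃ₜ ↥(S₂ e)
  used_inj : Function.Injective (fun x : E ⊕ E =>
    match x with
    | Sum.inl e => (⟨j₁ e, S₁ e⟩ : Σ j : Fin k, Set (piece j))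
    | Sum.inr e => ⟨j₂ e, S₂ e⟩)

attribute [instance] GluingData.top

namespace GluingData

variable {k : ℕ} (D : GluingData k)

/-- The identifications performed by the gluing. -/
def rel : (Σ j, D.piece j) → (Σ j, D.piece j) → Prop := fun a b =>
  ∃ (e : D.E) (s : ↥(D.S₁ e)), a = ⟨D.j₁ e, (s : D.piece (D.j₁ e))⟩ ∧
    b = ⟨D.j₂ e, (D.glue e s : D.piece (D.j₂ e))⟩

/-- The glued space: the quotient of the disjoint union of the pieces by the
identifications given by the gluing homeomorphisms. -/
def Glued : Type := Quot D.rel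

instance : TopologicalSpace D.Glued := by unfold Glued; infer_instance

/-- The canonical map from a piece to the glued space. -/
def emb (j : Fin k) : C(D.piece j, D.Glued) :=
  ⟨fun x => Quot.mk D.rel ⟨j, x⟩, by exact continuous_quot_mk.comp continuous_sigmaMk⟩

/-- The union `𝒮` of the glued hypersurfaces inside the glued space. -/
def gluedSet : Set D.Glued := ⋃ e : D.E, (D.emb (D.j₁ e)) '' (D.S₁ e)

/-- The boundary of the glued space: what remains of the boundaries of the pieces after
removing the glued hypersurfaces. -/
def gluedBdry : Set D.Glued := (⋃ j, (D.emb j) '' (D.bdry j)) \ D.gluedSet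

lemma emb_mapsTo_bdry (j : Fin k) :
    Set.MapsTo (D.emb j) (D.bdry j) (D.gluedBdry ∪ D.gluedSet) := by
  intro y hy
  by_cases hx : D.emb j y ∈ D.gluedSet
  · exact Or.inr hx
  · exact Or.inl ⟨Set.mem_iUnion.2 ⟨j, ⟨y, hy, rfl⟩⟩, hx⟩

/-- A gluing is compatible if every gluing homeomorphism `f : S₁ → S₂` satisfies
`f_*(K₁) = K₂`, where `K_i` is the kernel of the map induced on fundamental groups by the
inclusion `S_i → M_{j_i}`. -/
def Compatible : Prop :=
  ∀ (e : D.E) (s : ↥(D.S₁ e)),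
    Subgroup.map (pi1Map ((D.glue e) : C(↥(D.S₁ e), ↥(D.S₂ e))) s)
      (MonoidHom.ker (pi1Map (subIncl (D.S₁ e)) s)) =
    MonoidHom.ker (pi1Map (subIncl (D.S₂ e)) ((D.glue e) s))

end GluingData

section F1
variable {K : Type} [CommRing K] {Y Z : Type} [TopologicalSpace Y] [TopologicalSpace Z]
open Finsupp (single)

lemma alt_sq {V : Type*} [AddCommGroup V] [Module K V] {n : ℕ} (F : Fin (n+3) → Fin (n+2) → V)
    (h : ∀ i j : Fin (n+2), i ≤ j → F i.castSucc j = F j.succ i) :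
    ∑ i : Fin (n+3), ∑ j : Fin (n+2), ((-1:K)^(i:ℕ) * (-1)^(j:ℕ)) • F i j = 0 := by
  rw [Finset.sum_comm]
  have key : ∀ (j : Fin (n+2)) (f : Fin (n+3) → V), ∑ i, f i =
      (∑ i' : Fin (n+2), if i' ≤ j then f i'.castSucc else 0) + ∑ i' : Fin (n+2), if j ≤ i' then f i'.succ else 0 := by
    intro j f
    rw [Fin.sum_univ_succAbove f j.castSucc, ← Finset.sum_add_distrib,
      ← Finset.add_sum_erase _ _ (Finset.mem_univ j),
      ← Finset.add_sum_erase (Finset.univ) (fun i' => (if i' ≤ j then f i'.castSucc else 0) + _) (Finset.mem_univ j)]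
    simp only [le_refl, if_true, Fin.succAbove_castSucc_self]
    rw [← add_assoc]; congr 1
    apply Finset.sum_congr rfl
    intro i hi
    have hne : i ≠ j := Finset.ne_of_mem_erase hi
    rcases lt_or_gt_of_ne hne with h1 | h1
    · rw [Fin.succAbove_of_castSucc_lt _ _ (by simpa using h1), if_pos h1.le, if_neg (not_le.2 h1), add_zero]
    · rw [Fin.succAbove_of_le_castSucc _ _ (by simpa using h1.le), if_neg (not_le.2 h1), if_pos h1.le, zero_add]
  rw [Finset.sum_congr rfl fun j _ => key j _, Finset.sum_add_distrib]
  rw [Finset.sum_comm (f := fun j i' => if j ≤ i' then _ else (0:V)), ← Finset.sum_add_distrib]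
  apply Finset.sum_eq_zero
  intro j _
  rw [← Finset.sum_add_distrib]
  apply Finset.sum_eq_zero
  intro i _
  split_ifs with hij
  · rw [h i j hij, ← add_smul]
    simp [pow_succ, mul_comm]
  · simp

def bdF {A B : Type*} {m : ℕ} (f : Fin m → A → B) : (A →₀ K) →ₗ[K] (B →₀ K) :=
  ∑ i : Fin m, ((-1:K)^(i:ℕ)) • Finsupp.lmapDomain K K (f i)

lemma bdF_apply {A B : Type*} {m : ℕ} (f : Fin m → A → B) (x : A →₀ K) :
    bdF f x = ∑ i : Fin m, ((-1:K)^(i:ℕ)) • Finsupp.mapDomain (f i) x := by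
  simp [bdF, LinearMap.sum_apply]

lemma bdF_nat {A B A' B' : Type*} {m : ℕ} (f : Fin m → A → B) (f' : Fin m → A' → B') (g : A → A') (g' : B → B')
    (h : ∀ i a, g' (f i a) = f' i (g a)) (x : A →₀ K) :
    bdF f' (Finsupp.mapDomain g x) = Finsupp.mapDomain g' (bdF f x) := by
  simp_rw [bdF_apply, Finsupp.mapDomain_finsetSum, Finsupp.mapDomain_smul, ← Finsupp.mapDomain_comp]
  congr! 4 with i
  funext a; exact (h i a).symm

lemma bdF_sq {A B C : Type*} {n : ℕ} (f : Fin (n+3) → A → B) (g : Fin (n+2) → B → C)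
    (h : ∀ i j : Fin (n+2), i ≤ j → ∀ a, g j (f i.castSucc a) = g i (f j.succ a)) (x : A →₀ K) :
    bdF g (bdF f x) = 0 := by
  rw [bdF_apply f]
  simp_rw [map_sum, map_smul, bdF_apply g, Finset.smul_sum, smul_smul, ← Finsupp.mapDomain_comp]
  refine alt_sq (fun i j => Finsupp.mapDomain (g j ∘ f i) x) ?_
  intro i j hij; congr 1; funext a; exact h i j hij a

lemma bdF_sq' {A B C : Type*} {n : ℕ} (f : Fin (n+2) → A → B) (g : Fin (n+3) → B → C)
    (h : ∀ i j : Fin (n+2), i ≤ j → ∀ a, g i.castSucc (f j a) = g j.succ (f i a)) (x : A →₀ K) :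
    bdF g (bdF f x) = 0 := by
  rw [bdF_apply g]
  simp_rw [bdF_apply f, Finsupp.mapDomain_finsetSum, Finsupp.mapDomain_smul, Finset.smul_sum, smul_smul, ← Finsupp.mapDomain_comp]
  refine alt_sq (fun i j => Finsupp.mapDomain (g i ∘ f j) x) ?_
  intro i j hij; congr 1; funext a; exact h i j hij a

lemma bdF_sq0 {A B C : Type*} (f : Fin 2 → A → B) (c : C) (x : A →₀ K) :
    Finsupp.mapDomain (fun _ => c) (bdF f x) = 0 := by
  rw [bdF_apply, Fin.sum_univ_two]
  rw [Finsupp.mapDomain_add, Finsupp.mapDomain_smul, Finsupp.mapDomain_smul, ← Finsupp.mapDomain_comp, ← Finsupp.mapDomain_comp]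
  rw [show (fun _ => c) ∘ f 0 = fun _ => c from rfl, show (fun _ => c) ∘ f 1 = fun _ => c from rfl]
  simp

abbrev Ch (K : Type) [CommRing K] (X : Type) [TopologicalSpace X] (n : ℕ) := SSimplex X n →₀ K

def dd {n : ℕ} : Ch K X (n+1) →ₗ[K] Ch K X n := bdF (fun i σ => faceOf σ i)

lemma dd_eq_bdry {n : ℕ} (c : Ch K X (n+1)) : (dd c : Ch K X n) = bdry K X n c := by
  change _ = Finsupp.linearCombination K (bdryChain K) c
  induction c using Finsupp.induction_linear with
  | zero => rw [map_zero, map_zero]; rfl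
  | add f g hf hg => rw [map_add, map_add, hf, hg]; rfl
  | single σ r =>
    rw [Finsupp.linearCombination_single]
    change _ = r • ∑ i : Fin (n+2), single (faceOf σ i) ((-1 : K) ^ (i : ℕ))
    rw [dd, bdF_apply, Finset.smul_sum]
    simp [Finsupp.mapDomain_single, mul_comm]

lemma face_succAbove {n : ℕ} (i : Fin (n+2)) (x : Δ n) (j : Fin (n+1)) : (face i x).1 (i.succAbove j) = x.1 j := by
  simp [face]
lemma face_self {n : ℕ} (i : Fin (n+2)) (x : Δ n) : (face i x).1 i = 0 := by
  simp [face]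

lemma succAbove_comm {n : ℕ} (i j : Fin (n+2)) (h : i ≤ j) (k : Fin (n+1)) :
    i.castSucc.succAbove (j.succAbove k) = j.succ.succAbove (i.succAbove k) := by
  ext
  simp only [Fin.succAbove, Fin.lt_def, Fin.le_def] at *
  split_ifs <;> simp_all <;> omega

lemma face_face {n : ℕ} (i j : Fin (n+2)) (h : i ≤ j) (x : Δ n) :
    face i.castSucc (face j x) = face j.succ (face i x) := by
  apply Subtype.ext
  funext k
  refine Fin.succAboveCases i.castSucc ?_ (fun k => ?_) k
  · rw [face_self]
    have : i.castSucc = j.succ.succAbove i := by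
      rw [Fin.succAbove_of_castSucc_lt]; exact Nat.lt_succ_of_le h
    rw [this, face_succAbove, face_self]
  · rw [face_succAbove]
    refine Fin.succAboveCases j ?_ (fun k => ?_) k
    · rw [face_self]
      have : i.castSucc.succAbove j = j.succ := by
        rw [Fin.succAbove_of_le_castSucc]; simpa using h
      rw [this, face_self]
    · rw [face_succAbove, succAbove_comm i j h, face_succAbove, face_succAbove]

lemma dd_dd {n : ℕ} (c : Ch K X (n+2)) : (dd (dd c : Ch K X (n+1)) : Ch K X n) = 0 := by
  refine bdF_sq _ _ ?_ c
  intro i j h σ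
  ext x
  change σ (face i.castSucc (face j x)) = σ (face j.succ (face i x))
  rw [face_face i j h]

def psh (f : C(X, Y)) {n : ℕ} : Ch K X n →ₗ[K] Ch K Y n := Finsupp.lmapDomain K K (fun σ => f.comp σ)

lemma psh_single (f : C(X, Y)) {n : ℕ} (σ : SSimplex X n) (r : K) : psh f (single σ r) = single (f.comp σ) r := by
  simp [psh]

lemma psh_apply (f : C(X, Y)) {n : ℕ} (c : Ch K X n) : psh f c = Finsupp.mapDomain (fun σ => f.comp σ) c := rfl

lemma psh_psh (g : C(Y, Z)) (f : C(X, Y)) {n : ℕ} (c : Ch K X n) : psh g (psh f c) = psh (g.comp f) c := by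
  simp_rw [psh_apply, ← Finsupp.mapDomain_comp]; rfl

lemma psh_id {n : ℕ} (c : Ch K X n) : psh (ContinuousMap.id X) c = c := by
  rw [psh_apply]; exact Finsupp.mapDomain_id

lemma dd_psh (f : C(X, Y)) {n : ℕ} (c : Ch K X (n+1)) : dd (psh f c) = psh f (dd c) :=
  bdF_nat (fun i σ => faceOf σ i) (fun i σ => faceOf σ i) (fun σ => f.comp σ) (fun σ => f.comp σ) (fun _ _ => rfl) c

def supp (K : Type) [CommRing K] (F : Set (Set X)) (n : ℕ) : Submodule K (Ch K X n) :=
  Finsupp.supported K K {σ | ∃ A ∈ F, Set.range σ ⊆ A}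

lemma single_mem_supp {F : Set (Set X)} {n : ℕ} {σ : SSimplex X n} {A : Set X} (hA : A ∈ F) (h : Set.range σ ⊆ A) (r : K) :
    single σ r ∈ supp K F n := Finsupp.single_mem_supported K r ⟨A, hA, h⟩

lemma supp_le {F : Set (Set X)} {n : ℕ} {P : Submodule K (Ch K X n)}
    (h : ∀ σ : SSimplex X n, (∃ A ∈ F, Set.range σ ⊆ A) → single σ 1 ∈ P) : supp K F n ≤ P := by
  rw [supp, Finsupp.supported_eq_span_single, Submodule.span_le]
  rintro _ ⟨σ, hσ, rfl⟩; exact h σ hσ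

lemma supp_mono {F G : Set (Set X)} (h : ∀ A ∈ F, ∃ B ∈ G, A ⊆ B) (n : ℕ) : supp K F n ≤ supp K G n :=
  supp_le fun _ ⟨A, hA, hs⟩ => let ⟨_, hB, hAB⟩ := h A hA; single_mem_supp hB (hs.trans hAB) 1

lemma mapDomain_mem_supp {ι : Type*} {G : Set (Set Y)} {m : ℕ} (T : ι →₀ K) (f : ι → SSimplex Y m)
    (h : ∀ i ∈ T.support, ∃ B ∈ G, Set.range (f i) ⊆ B) : Finsupp.mapDomain f T ∈ supp K G m := by
  refine Submodule.sum_mem _ fun i hi => ?_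
  obtain ⟨B, hB, hr⟩ := h i hi
  exact single_mem_supp hB hr _

lemma faceOf_range {n : ℕ} (σ : SSimplex X (n+1)) (i : Fin (n+2)) : Set.range (faceOf σ i) ⊆ Set.range σ := by
  rintro _ ⟨x, rfl⟩; exact ⟨face i x, rfl⟩

lemma dd_mem_supp {F : Set (Set X)} {n : ℕ} {c : Ch K X (n+1)} (hc : c ∈ supp K F (n+1)) : dd c ∈ supp K F n := by
  refine supp_le (P := (supp K F n).comap dd) (fun σ ⟨A, hA, hs⟩ => ?_) hc
  rw [Submodule.mem_comap, dd, bdF_apply]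
  refine Submodule.sum_mem _ fun i _ => Submodule.smul_mem _ _ ?_
  rw [Finsupp.mapDomain_single]
  exact single_mem_supp hA ((faceOf_range σ i).trans hs) _

lemma psh_mem_supp {F : Set (Set X)} {G : Set (Set Y)} (f : C(X,Y)) (h : ∀ A ∈ F, ∃ B ∈ G, Set.MapsTo f A B) {n : ℕ}
    {c : Ch K X n} (hc : c ∈ supp K F n) : psh f c ∈ supp K G n := by
  refine supp_le (P := (supp K G n).comap (psh f)) (fun σ ⟨A, hA, hs⟩ => ?_) hc
  rw [Submodule.mem_comap, psh_single]
  obtain ⟨B, hB, hAB⟩ := h A hA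
  refine single_mem_supp hB ?_ 1
  rintro _ ⟨x, rfl⟩; exact hAB (hs ⟨x, rfl⟩)

lemma supp_union (F G : Set (Set X)) (n : ℕ) : supp K (F ∪ G) n = supp K F n ⊔ supp K G n := by
  apply le_antisymm
  · refine supp_le fun σ ⟨A, hA, hs⟩ => ?_
    rcases hA with hA | hA
    · exact Submodule.mem_sup_left (single_mem_supp hA hs 1)
    · exact Submodule.mem_sup_right (single_mem_supp hA hs 1)
  · exact sup_le (supp_mono (fun A hA => ⟨A, Or.inl hA, le_rfl⟩) n) (supp_mono (fun A hA => ⟨A, Or.inr hA, le_rfl⟩) n)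

lemma supp_inf {F G H : Set (Set X)} (h : ∀ A ∈ F, ∀ B ∈ G, ∃ C ∈ H, A ∩ B ⊆ C) {n : ℕ} {c : Ch K X n}
    (h1 : c ∈ supp K F n) (h2 : c ∈ supp K G n) : c ∈ supp K H n := by
  rw [supp, Finsupp.mem_supported] at *
  intro σ hσ
  obtain ⟨A, hA, h3⟩ := h1 hσ
  obtain ⟨B, hB, h4⟩ := h2 hσ
  obtain ⟨C, hC, h5⟩ := h A hA B hB
  exact ⟨C, hC, (Set.subset_inter h3 h4).trans h5⟩

lemma supp_univ (n : ℕ) (c : Ch K X n) : c ∈ supp K {Set.univ} n := by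
  rw [supp, Finsupp.mem_supported]; intro σ _; exact ⟨_, rfl, Set.subset_univ _⟩

abbrev PP (n : ℕ) := Δ n × ℝ
abbrev Tup (K : Type) [CommRing K] (m n : ℕ) := (Fin (m+1) → PP n) →₀ K

def dL {m n : ℕ} : Tup K (m+1) n →ₗ[K] Tup K m n := bdF (fun i w => w ∘ i.succAbove)
def cyc : ∀ {m n : ℕ}, Tup K m n → Prop
  | 0, _, z => Finsupp.mapDomain (fun _ => ()) z = 0
  | _+1, _, z => dL z = 0

lemma cyc_dL {m n : ℕ} (z : Tup K (m+1) n) : cyc (dL z) := by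
  cases m with
  | zero => exact bdF_sq0 _ _ z
  | succ m =>
    refine bdF_sq _ _ ?_ z
    intro i j h w
    funext k
    exact congrArg w (succAbove_comm i j h k)

def cone {m n : ℕ} (p : PP n) : Tup K m n →ₗ[K] Tup K (m+1) n := Finsupp.lmapDomain K K (fun w => (Fin.cons p w : Fin (m+2) → PP n))

lemma dL_cone {m n : ℕ} (p : PP n) (z : Tup K m n) (hz : cyc z) : dL (cone p z) = z := by
  have h : ∀ m (z : Tup K (m+1) n), dL (cone p z) = z - cone p (dL z) := by
    intro m z
    simp only [dL, cone, Finsupp.lmapDomain_apply]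
    rw [bdF_apply, Fin.sum_univ_succ, bdF_apply, Finsupp.mapDomain_finsetSum, sub_eq_add_neg, ← Finset.sum_neg_distrib]
    congr 1
    · rw [← Finsupp.mapDomain_comp]
      simp only [Fin.val_zero, pow_zero, one_smul]
      convert Finsupp.mapDomain_id
      funext w k; simp
    · refine Finset.sum_congr rfl fun i _ => ?_
      rw [← Finsupp.mapDomain_comp, Finsupp.mapDomain_smul, ← Finsupp.mapDomain_comp]
      simp only [Fin.val_succ, pow_succ, mul_neg, mul_one, neg_smul]
      congr! 3
      funext w k
      refine Fin.cases ?_ (fun k => ?_) k <;> simp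
  cases m with
  | zero =>
    simp only [dL, cone, Finsupp.lmapDomain_apply]
    rw [bdF_apply, Fin.sum_univ_two, ← Finsupp.mapDomain_comp, ← Finsupp.mapDomain_comp]
    have h2 : ((fun w : Fin 2 → PP n => w ∘ Fin.succAbove 1) ∘ fun w : Fin 1 → PP n => (Fin.cons p w : Fin 2 → PP n))
        = (fun _ : Unit => (fun _ => p : Fin 1 → PP n)) ∘ fun _ => () := by
      funext w k; fin_cases k; rfl
    have h3 : ((fun w : Fin 2 → PP n => w ∘ Fin.succAbove 0) ∘ fun w : Fin 1 → PP n => (Fin.cons p w : Fin 2 → PP n)) = id := by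
      funext w k; fin_cases k; rfl
    rw [h2, h3, Finsupp.mapDomain_id, Finsupp.mapDomain_comp]
    rw [show Finsupp.mapDomain (fun _ => ()) z = 0 from hz]
    simp
  | succ m => rw [h, show dL z = 0 from hz]; simp

def fc {n : ℕ} (i : Fin (n+2)) (p : PP n) : PP (n+1) := (face i p.1, p.2)
def fL {m n : ℕ} : Tup K m n →ₗ[K] Tup K m (n+1) := bdF (fun (i : Fin (n+2)) w => fc i ∘ w)

lemma dL_fL {m n : ℕ} (z : Tup K (m+1) n) : dL (fL z) = fL (dL z) := by
  have h : ∀ i : Fin (n+2), dL (Finsupp.mapDomain (fun w : Fin (m+2) → PP n => fc i ∘ w) z) = Finsupp.mapDomain (fun w : Fin (m+1) → PP n => fc i ∘ w) (dL z) :=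
    fun i => bdF_nat (K := K) (fun (i : Fin (m+2)) (w : Fin (m+2) → PP n) => w ∘ i.succAbove) (fun (i : Fin (m+2)) w => w ∘ i.succAbove) _ _ (fun _ _ => rfl) z
  rw [fL, fL, bdF_apply, map_sum, bdF_apply]
  refine Finset.sum_congr rfl fun i _ => ?_
  rw [map_smul, h]

lemma fL_fL {m n : ℕ} (z : Tup K m n) : fL (fL z) = 0 := by
  refine bdF_sq' _ _ ?_ z
  intro i j h w; funext k
  simp [fc, face_face i j h]

def NatCh (a : ∀ n, Tup K n n) : Prop := ∀ n, dL (a (n+1)) = fL (a n)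

def apx (n : ℕ) : PP n := (⟨fun _ => ((n:ℝ)+1)⁻¹, fun _ => by positivity, by simp; field_simp⟩, 0)

def TT (a b : ∀ n, Tup K n n) : ∀ n, Tup K (n+1) n
  | 0 => cone (apx 0) (b 0 - a 0)
  | n+1 => cone (apx (n+1)) (b (n+1) - a (n+1) - fL (TT a b n))

lemma TT_spec (a b : ∀ n, Tup K n n) (ha : NatCh a) (hb : NatCh b) (h0 : cyc (b 0 - a 0)) :
    dL (TT a b 0) = b 0 - a 0 ∧ ∀ n, dL (TT a b (n+1)) = b (n+1) - a (n+1) - fL (TT a b n) := by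
  have h00 : dL (TT a b 0) = b 0 - a 0 := dL_cone _ _ h0
  have : ∀ n, dL (TT a b (n+1)) = b (n+1) - a (n+1) - fL (TT a b n) := by
    intro n
    induction n with
    | zero =>
      refine dL_cone _ _ ?_
      change dL _ = 0
      rw [map_sub, map_sub, ha, hb, dL_fL, h00, map_sub, sub_self]
    | succ n ih =>
      refine dL_cone _ _ ?_
      change dL _ = 0
      rw [map_sub, map_sub, ha, hb, dL_fL, ih, map_sub, map_sub, fL_fL, sub_zero, sub_self]
  exact ⟨h00, this⟩

end F1

section F2
variable {K : Type} [CommRing K] {Y Z : Type} [TopologicalSpace Y] [TopologicalSpace Z]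
open Finsupp (single)

def affD {m n : ℕ} (w : Fin (m+1) → Δ n) : C(Δ m, Δ n) :=
  ⟨fun x => ⟨fun l => ∑ k, x.1 k * (w k).1 l, fun l => Finset.sum_nonneg fun k _ => mul_nonneg (x.2.1 k) ((w k).2.1 l), by
    rw [Finset.sum_comm]; simp_rw [← Finset.mul_sum, (w _).2.2, mul_one]; exact x.2.2⟩,
    Continuous.subtype_mk (continuous_pi fun l => continuous_finsetSum _ fun k _ => ((continuous_apply k).comp continuous_subtype_val).mul continuous_const) _⟩

def aff {m n : ℕ} (w : Fin (m+1) → PP n) : C(Δ m, PP n) :=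
  (affD fun k => (w k).1).prodMk ⟨fun x => ∑ k, x.1 k * (w k).2, continuous_finsetSum _ fun k _ => ((continuous_apply k).comp continuous_subtype_val).mul continuous_const⟩

lemma sum_face {m : ℕ} (i : Fin (m+2)) (x : Δ m) (f : Fin (m+2) → ℝ) :
    ∑ k, (face i x).1 k * f k = ∑ k, x.1 k * f (i.succAbove k) := by
  rw [Fin.sum_univ_succAbove _ i, face_self, zero_mul, zero_add]
  simp_rw [face_succAbove]

lemma aff_face {m n : ℕ} (w : Fin (m+2) → PP n) (i : Fin (m+2)) : (aff w).comp (face i) = aff (w ∘ i.succAbove) := by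
  ext x l
  · exact sum_face i x _
  · exact sum_face i x _

lemma aff_fc {m n : ℕ} (w : Fin (m+1) → PP n) (i : Fin (n+2)) (x : Δ m) : aff (fc i ∘ w) x = (face i (aff w x).1, (aff w x).2) := by
  refine Prod.ext (Subtype.ext ?_) rfl
  funext l
  change ∑ k, x.1 k * (face i (w k).1).1 l = (face i (affD (fun k => (w k).1) x)).1 l
  refine Fin.succAboveCases i ?_ (fun l => ?_) l
  · simp [face_self]
  · simp_rw [face_succAbove]; rfl

def opS {m n : ℕ} (H : C(X × ℝ, Z)) (σ : SSimplex X n) (w : Fin (m+1) → PP n) : SSimplex Z m :=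
  H.comp ((σ.prodMap (ContinuousMap.id ℝ)).comp (aff w))

lemma opS_apply {m n : ℕ} (H : C(X × ℝ, Z)) (σ : SSimplex X n) (w : Fin (m+1) → PP n) (x : Δ m) :
    opS H σ w x = H (σ (aff w x).1, (aff w x).2) := rfl

def op {m n : ℕ} (T : Tup K m n) (H : C(X × ℝ, Z)) : Ch K X n →ₗ[K] Ch K Z m :=
  Finsupp.linearCombination K fun σ => Finsupp.mapDomain (opS H σ) T

lemma op_single {m n : ℕ} (T : Tup K m n) (H : C(X × ℝ, Z)) (σ : SSimplex X n) (r : K) :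
    op T H (single σ r) = r • Finsupp.mapDomain (opS H σ) T := by simp [op]

lemma ch_ext {n : ℕ} {M : Type*} [AddCommGroup M] [Module K M] {f g : Ch K X n →ₗ[K] M} (h : ∀ σ, f (single σ 1) = g (single σ 1)) (c : Ch K X n) : f c = g c := by
  have : f = g := Finsupp.lhom_ext' fun σ => LinearMap.ext_ring (h σ)
  rw [this]

lemma op_sub {m n : ℕ} (T T' : Tup K m n) (H : C(X × ℝ, Z)) (c : Ch K X n) : op (T - T') H c = op T H c - op T' H c := by
  refine ch_ext (f := op (T - T') H) (g := op T H - op T' H) (fun σ => ?_) c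
  simp only [LinearMap.sub_apply, op_single, one_smul]
  exact map_sub (Finsupp.lmapDomain K K (opS H σ)) T T'

lemma dd_op {m n : ℕ} (T : Tup K (m+1) n) (H : C(X × ℝ, Z)) (c : Ch K X n) : dd (op T H c) = op (dL T) H c := by
  refine ch_ext (f := dd ∘ₗ op T H) (g := op (dL T) H) (fun σ => ?_) c
  simp only [LinearMap.comp_apply, op_single, one_smul]
  refine bdF_nat (fun (i : Fin (m+2)) (w : Fin (m+2) → PP n) => w ∘ i.succAbove) (fun i σ => faceOf σ i) _ _ (fun i w => ?_) T
  rw [opS, opS, ← aff_face]; rfl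

lemma op_dd {m n : ℕ} (T : Tup K m n) (H : C(X × ℝ, Z)) (c : Ch K X (n+1)) : op T H (dd c) = op (fL T) H c := by
  refine ch_ext (f := op T H ∘ₗ dd) (g := op (fL T) H) (fun σ => ?_) c
  simp only [LinearMap.comp_apply, op_single, one_smul]
  rw [dd, bdF_apply, map_sum, fL, bdF_apply, Finsupp.mapDomain_finsetSum]
  refine Finset.sum_congr rfl fun i _ => ?_
  rw [Finsupp.mapDomain_single, map_smul, op_single, one_smul, Finsupp.mapDomain_smul, ← Finsupp.mapDomain_comp]
  congr 2
  funext w; ext x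
  simp only [opS_apply, Function.comp_apply, aff_fc]; rfl

lemma op_mem {m n : ℕ} (T : Tup K m n) (H : C(X × ℝ, Z)) {F : Set (Set X)} {G : Set (Set Z)}
    (h : ∀ A ∈ F, ∃ B ∈ G, ∀ x ∈ A, ∀ t, H (x, t) ∈ B) {c : Ch K X n} (hc : c ∈ supp K F n) : op T H c ∈ supp K G m := by
  refine supp_le (P := (supp K G m).comap (op T H)) (fun σ ⟨A, hA, hs⟩ => ?_) hc
  rw [Submodule.mem_comap, op_single, one_smul]
  obtain ⟨B, hB, hAB⟩ := h A hA
  refine mapDomain_mem_supp _ _ fun w _ => ⟨B, hB, ?_⟩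
  rintro _ ⟨x, rfl⟩; exact hAB _ (hs ⟨_, rfl⟩) _

lemma TT_op (a b : ∀ n, Tup K n n) (ha : NatCh a) (hb : NatCh b) (h0 : cyc (b 0 - a 0)) (H : C(X × ℝ, Z)) {n : ℕ} (c : Ch K X (n+1)) :
    dd (op (TT a b (n+1)) H c) = op (b (n+1)) H c - op (a (n+1)) H c - op (TT a b n) H (dd c) := by
  rw [dd_op, (TT_spec a b ha hb h0).2, op_sub, op_sub, op_dd]

def dv {n : ℕ} (k : Fin (n+1)) : Δ n := ⟨Pi.single k 1, single_mem_stdSimplex ℝ k⟩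
def vtx (n : ℕ) (t : ℝ) (k : Fin (n+1)) : PP n := (dv k, t)

lemma affD_dv {n : ℕ} (x : Δ n) : affD dv x = x := by
  apply Subtype.ext; funext l
  change ∑ k, x.1 k * (Pi.single k 1 : Fin (n+1) → ℝ) l = _
  simp [Pi.single_apply]

lemma aff_vtx {n : ℕ} (t : ℝ) (x : Δ n) : aff (vtx n t) x = (x, t) := by
  refine Prod.ext (affD_dv x) ?_
  change ∑ k, x.1 k * t = t
  rw [← Finset.sum_mul, x.2.2, one_mul]

def idt (K : Type) [CommRing K] (t : ℝ) (n : ℕ) : Tup K n n := single (vtx n t) 1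

lemma face_dv {n : ℕ} (i : Fin (n+2)) (k : Fin (n+1)) : face i (dv k) = dv (i.succAbove k) := by
  apply Subtype.ext; funext l
  refine Fin.succAboveCases i ?_ (fun l => ?_) l
  · rw [face_self]; exact (Pi.single_eq_of_ne (M := fun _ => ℝ) (Fin.succAbove_ne i k).symm _).symm
  · rw [face_succAbove]
    change (Pi.single k 1 : Fin (n+1) → ℝ) l = (Pi.single (i.succAbove k) 1 : Fin (n+2) → ℝ) (i.succAbove l)
    simp [Pi.single_apply]

lemma nat_idt (t : ℝ) : NatCh (idt K t) := by
  intro n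
  rw [dL, fL, bdF_apply, bdF_apply]
  refine Finset.sum_congr rfl fun i _ => ?_
  rw [idt, idt, Finsupp.mapDomain_single, Finsupp.mapDomain_single]
  congr 2
  funext k
  exact Prod.ext (face_dv i k).symm rfl

lemma op_idt {n : ℕ} (t : ℝ) (H : C(X × ℝ, Z)) (c : Ch K X n) : op (idt K t n) H c = psh (H.comp ((ContinuousMap.id X).prodMk (.const X t))) c := by
  refine ch_ext (g := psh (H.comp ((ContinuousMap.id X).prodMk (.const X t)))) (fun σ => ?_) c
  rw [op_single, psh_single, one_smul, idt, Finsupp.mapDomain_single]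
  congr 1
  ext x; rw [opS_apply, aff_vtx]; rfl

lemma htpy (H : C(X × ℝ, Z)) : ∃ P : ∀ n, Ch K X n →ₗ[K] Ch K Z (n+1),
    (∀ n (c : Ch K X (n+1)), dd (P (n+1) c) = psh (H.comp ((ContinuousMap.id X).prodMk (.const X 1))) c
      - psh (H.comp ((ContinuousMap.id X).prodMk (.const X 0))) c - P n (dd c)) ∧
    (∀ c : Ch K X 0, dd (P 0 c) = psh (H.comp ((ContinuousMap.id X).prodMk (.const X 1))) c
      - psh (H.comp ((ContinuousMap.id X).prodMk (.const X 0))) c) ∧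
    ∀ (F : Set (Set X)) (G : Set (Set Z)), (∀ A ∈ F, ∃ B ∈ G, ∀ x ∈ A, ∀ t, H (x, t) ∈ B) → ∀ n, ∀ c ∈ supp K F n, P n c ∈ supp K G (n+1) := by
  have h0 : cyc (idt K 1 0 - idt K 0 0) := by
    change Finsupp.lmapDomain K K (fun _ => ()) (idt K 1 0 - idt K 0 0) = 0
    rw [map_sub]; simp [idt]
  refine ⟨fun n => op (TT (idt K 0) (idt K 1) n) H, fun n c => ?_, fun c => ?_, fun F G h n c hc => op_mem _ _ h hc⟩
  · rw [TT_op _ _ (nat_idt 0) (nat_idt 1) h0, op_idt, op_idt]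
  · rw [dd_op, (TT_spec _ _ (nat_idt 0) (nat_idt 1) h0).1, op_sub, op_idt, op_idt]

def sdt (K : Type) [CommRing K] : ∀ n, Tup K n n
  | 0 => idt K 0 0
  | n+1 => cone (apx (n+1)) (fL (sdt K n))

lemma nat_sdt : NatCh (sdt K) := by
  have key : ∀ n, cyc (fL (sdt K n)) → dL (sdt K (n+1)) = fL (sdt K n) := fun n h => dL_cone _ _ h
  intro n
  apply key
  cases n with
  | zero =>
    change Finsupp.mapDomain _ _ = 0
    rw [show sdt K 0 = idt K 0 0 from rfl, ← nat_idt (K := K) 0 0]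
    exact cyc_dL (idt K 0 1)
  | succ n =>
    induction n with
    | zero =>
      change dL _ = 0
      rw [dL_fL, key 0, fL_fL]
      change Finsupp.mapDomain _ _ = 0
      rw [show sdt K 0 = idt K 0 0 from rfl, ← nat_idt (K := K) 0 0]
      exact cyc_dL (idt K 0 1)
    | succ n ih =>
      change dL _ = 0
      rw [dL_fL, key _ ih, fL_fL]

def fstH (X : Type) [TopologicalSpace X] : C(X × ℝ, X) := ⟨Prod.fst, continuous_fst⟩
lemma fstH_id (t : ℝ) : (fstH X).comp ((ContinuousMap.id X).prodMk (.const X t)) = ContinuousMap.id X := rfl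

lemma nat_homotopy (a : ∀ n, Tup K n n) (ha : NatCh a) (h0 : cyc (idt K 0 0 - a 0)) {n : ℕ} (c : Ch K X (n+1)) :
    ∃ e r, c - op (a (n+1)) (fstH X) c = dd e + r ∧ (∀ G, c ∈ supp K G (n+1) → e ∈ supp K G (n+2)) ∧
     (∀ G, dd c ∈ supp K G n → r ∈ supp K G (n+1)) := by
  refine ⟨op (TT a (idt K 0) (n+1)) (fstH X) c, op (TT a (idt K 0) n) (fstH X) (dd c), ?_, fun G hc => ?_, fun G hc => ?_⟩
  · rw [TT_op a _ ha (nat_idt 0) h0, op_idt, fstH_id, psh_id]; abel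
  · exact op_mem _ _ (fun A hA => ⟨A, hA, fun x hx t => hx⟩) hc
  · exact op_mem _ _ (fun A hA => ⟨A, hA, fun x hx t => hx⟩) hc

def Sd {n : ℕ} : Ch K X n →ₗ[K] Ch K X n := op (sdt K n) (fstH X)

lemma Sd_mem {n : ℕ} {G : Set (Set X)} {c : Ch K X n} (hc : c ∈ supp K G n) : Sd c ∈ supp K G n :=
  op_mem _ _ (fun A hA => ⟨A, hA, fun x hx t => hx⟩) hc

lemma Sd_dd {n : ℕ} (c : Ch K X (n+1)) : dd (Sd c) = Sd (dd c) := by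
  rw [Sd, Sd, dd_op, nat_sdt, op_dd]

lemma Sd_iter {k n : ℕ} (c : Ch K X (n+1)) :
    ∃ e r, c - (Sd (n := n+1))^[k] c = dd e + r ∧ (∀ G, c ∈ supp K G (n+1) → e ∈ supp K G (n+2)) ∧
     (∀ G, dd c ∈ supp K G n → r ∈ supp K G (n+1)) := by
  induction k generalizing c with
  | zero => exact ⟨0, 0, by simp, fun G _ => Submodule.zero_mem _, fun G _ => Submodule.zero_mem _⟩
  | succ k ih =>
    obtain ⟨e, r, h1, h2, h3⟩ := ih (Sd c)
    obtain ⟨e', r', h1', h2', h3'⟩ := nat_homotopy (sdt K) nat_sdt (by rw [sdt, sub_self]; exact Finsupp.mapDomain_zero) c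
    refine ⟨e + e', r + r', ?_, fun G hG => Submodule.add_mem _ (h2 G (Sd_mem hG)) (h2' G hG), fun G hG => Submodule.add_mem _ (h3 G ?_) (h3' G hG)⟩
    · rw [Function.iterate_succ_apply, map_add]
      calc _ = (Sd c - Sd^[k] (Sd c)) + (c - Sd c) := by abel
        _ = _ := by rw [h1, show c - Sd c = dd e' + r' from h1']; abel
    · rw [Sd_dd]; exact Sd_mem hG

lemma mesh_aux {E : Type*} [NormedAddCommGroup E] [NormedSpace ℝ E] {n : ℕ} (w : Fin (n+1) → E) (d : ℝ) (hw : ∀ k l, ‖w k - w l‖ ≤ d)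
    (x : Δ n) (e : E) (he : ∀ k, ‖w k - e‖ ≤ d) : ‖∑ k, x.1 k • w k - e‖ ≤ d := by
  have : ∑ k, x.1 k • w k - e = ∑ k, x.1 k • (w k - e) := by
    simp_rw [smul_sub, Finset.sum_sub_distrib, ← Finset.sum_smul, x.2.2, one_smul]
  rw [this]
  calc _ ≤ ∑ k, x.1 k * d := norm_sum_le_of_le _ fun k _ => by
        rw [norm_smul, Real.norm_of_nonneg (x.2.1 k)]; exact mul_le_mul_of_nonneg_left (he k) (x.2.1 k)
    _ = d := by rw [← Finset.sum_mul, x.2.2, one_mul]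

lemma mesh {E : Type*} [NormedAddCommGroup E] [NormedSpace ℝ E] {n : ℕ} (t : Fin (n+1) → PP n) (ht : t ∈ (sdt K n).support)
    (w : Fin (n+1) → E) (d : ℝ) (hd : 0 ≤ d) (hw : ∀ k l, ‖w k - w l‖ ≤ d) (i j : Fin (n+1)) :
    ‖∑ k, (t i).1.1 k • w k - ∑ k, (t j).1.1 k • w k‖ ≤ (n / (n+1) : ℝ) * d := by
  induction n generalizing d with
  | zero => rw [Subsingleton.elim (α := Fin 1) i j]; simp
  | succ n ih =>
    classical
    obtain ⟨s, hs, rfl⟩ : ∃ s ∈ (fL (sdt K n)).support, Fin.cons (apx (n+1)) s = t := by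
      simpa using Finsupp.mapDomain_support ht
    obtain ⟨l, s', hs', rfl⟩ : ∃ l : Fin (n+2), ∃ s' ∈ (sdt K n).support, fc l ∘ s' = s := by
      rw [fL, bdF_apply] at hs
      obtain ⟨l, -, hl⟩ := Finset.mem_biUnion.1 (Finsupp.support_finsetSum hs)
      obtain ⟨s', h1, h2⟩ := Finset.mem_image.1 (Finsupp.mapDomain_support (Finsupp.support_smul hl))
      exact ⟨l, s', h1, h2⟩
    have hle : (n / (n+1) : ℝ) * d ≤ ((n+1:ℕ) / ((n+1:ℕ)+1) : ℝ) * d := by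
      refine mul_le_mul_of_nonneg_right ?_ hd
      rw [div_le_div_iff₀ (by positivity) (by positivity)]; push_cast; nlinarith
    have hf : ∀ a, ∑ k, ((fc l ∘ s') a).1.1 k • w k = ∑ k, (s' a).1.1 k • w (l.succAbove k) := by
      intro a
      rw [Fin.sum_univ_succAbove _ l]
      simp [fc, face_self, face_succAbove]
    have hap : ∀ x : Δ (n+1), ‖∑ k, (apx (n+1)).1.1 k • w k - ∑ k, x.1 k • w k‖ ≤ ((n+1:ℕ) / ((n+1:ℕ)+1) : ℝ) * d := by
      intro x
      rw [norm_sub_rev]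
      have hb : ∀ k, ‖w k - ∑ l, (apx (n+1)).1.1 l • w l‖ ≤ ((n+1:ℕ) / ((n+1:ℕ)+1) : ℝ) * d := by
        intro k
        have : w k - ∑ l, (apx (n+1)).1.1 l • w l = ∑ l, (((n+1:ℕ):ℝ)+1)⁻¹ • (w k - w l) := by
          simp_rw [smul_sub, Finset.sum_sub_distrib, Finset.sum_const, Finset.card_univ, Fintype.card_fin]
          congr 1
          rw [← Nat.cast_smul_eq_nsmul ℝ, smul_smul, show ((n+1+1:ℕ):ℝ) * (((n+1:ℕ):ℝ)+1)⁻¹ = 1 by push_cast; field_simp, one_smul]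
        rw [this, ← Finset.add_sum_erase _ _ (Finset.mem_univ k), sub_self, smul_zero, zero_add]
        refine (norm_sum_le_of_le _ (fun l _ => ?_) : _ ≤ ∑ l ∈ Finset.univ.erase k, (((n+1:ℕ):ℝ)+1)⁻¹ * d).trans ?_
        · rw [norm_smul, Real.norm_of_nonneg (by positivity)]
          exact mul_le_mul_of_nonneg_left (hw k l) (by positivity)
        · rw [Finset.sum_const, Finset.card_erase_of_mem (Finset.mem_univ k), Finset.card_univ, Fintype.card_fin]
          rw [nsmul_eq_mul]; apply le_of_eq; push_cast; field_simp
      have : ∑ k, x.1 k • w k - ∑ k, (apx (n+1)).1.1 k • w k = ∑ k, x.1 k • (w k - ∑ l, (apx (n+1)).1.1 l • w l) := by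
        simp_rw [smul_sub, Finset.sum_sub_distrib, ← Finset.sum_smul, x.2.2, one_smul]
      rw [this]
      refine (norm_sum_le_of_le _ (fun k _ => ?_) : _ ≤ ∑ k, x.1 k * (((n+1:ℕ) / ((n+1:ℕ)+1) : ℝ) * d)).trans ?_
      · rw [norm_smul, Real.norm_of_nonneg (x.2.1 k)]; exact mul_le_mul_of_nonneg_left (hb k) (x.2.1 k)
      · rw [← Finset.sum_mul, x.2.2, one_mul]
    refine Fin.cases ?_ (fun i => ?_) i
    · exact hap _
    · refine Fin.cases ?_ (fun j => ?_) j
      · rw [norm_sub_rev]; exact hap _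
      · simp only [Fin.cons_succ]
        rw [hf, hf]
        exact (ih s' hs' (w ∘ l.succAbove) d hd (fun _ _ => hw _ _) i j).trans hle

def Aff {n : ℕ} (K : Type) [CommRing K] (σ : SSimplex X n) (r : ℝ) : Submodule K (Ch K X n) :=
  Finsupp.supported K K {τ | ∃ v : Fin (n+1) → Δ n, (∀ i j, ‖(v i).1 - (v j).1‖ ≤ r) ∧ τ = σ.comp (affD v)}

lemma affD_affD {m n : ℕ} (v : Fin (m+1) → Δ n) (w : Fin (m+1) → Δ m) : (affD v).comp (affD w) = affD fun i => affD v (w i) := by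
  ext x l
  change ∑ k, (∑ j, x.1 j * (w j).1 k) * (v k).1 l = ∑ j, x.1 j * ∑ k, (w j).1 k * (v k).1 l
  simp_rw [Finset.sum_mul, Finset.mul_sum, mul_assoc]
  exact Finset.sum_comm

lemma Sd_Aff {n : ℕ} (σ : SSimplex X n) {r : ℝ} (hr : 0 ≤ r) {c : Ch K X n} (hc : c ∈ Aff K σ r) : Sd c ∈ Aff K σ ((n / (n+1) : ℝ) * r) := by
  have : Aff K σ r ≤ (Aff K σ ((n / (n+1) : ℝ) * r)).comap Sd := by
    rw [Aff, Finsupp.supported_eq_span_single, Submodule.span_le]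
    rintro _ ⟨_, ⟨v, hv, rfl⟩, rfl⟩
    change (Sd : Ch K X n →ₗ[K] _) (single _ 1) ∈ Aff K σ ((n / (n+1) : ℝ) * r)
    rw [Sd, op_single, one_smul]
    refine Submodule.sum_mem _ fun w hw => Finsupp.single_mem_supported K _ ⟨fun i => affD v (w i).1, fun i j => ?_, ?_⟩
    · have := mesh (K := K) w hw (fun k => (v k).1) r hr hv i j
      have e : ∀ x, (affD v x).1 = ∑ k, x.1 k • (v k).1 := by intro x; ext l; simp [affD]
      rw [e, e]; exact this
    · rw [← affD_affD]; rfl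
  exact this hc

lemma Sd_small {n : ℕ} (σ : SSimplex X n) (F : Set (Set X)) (h : (∃ A ∈ F, Set.range σ ⊆ A) ∨ (Set.range σ ⊆ ⋃₀ {A ∈ F | IsOpen A})) :
    ∃ k, (Sd (K := K))^[k] (single σ 1) ∈ supp K F n := by
  rcases h with ⟨A, hA, h⟩ | h
  · exact ⟨0, single_mem_supp hA h 1⟩
  have key : ∀ k, (Sd (K := K))^[k] (single σ 1) ∈ Aff K σ ((n / (n+1) : ℝ)^k * 1) := by
    intro k
    induction k with
    | zero =>
      refine Finsupp.single_mem_supported K _ ⟨dv, fun i j => ?_, ?_⟩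
      · rw [pi_norm_le_iff_of_nonneg (by simp)]
        intro l
        have h1 := (dv i).2.1 l; have h2 := (dv j).2.1 l
        have h3 : (dv i).1 l ≤ 1 := (mem_Icc_of_mem_stdSimplex (dv i).2 l).2
        have h4 : (dv j).1 l ≤ 1 := (mem_Icc_of_mem_stdSimplex (dv j).2 l).2
        simp only [pow_zero, one_mul, Pi.sub_apply, Real.norm_eq_abs, abs_le]; constructor <;> linarith
      · ext x; simp [affD_dv]
    | succ k ih =>
      rw [Function.iterate_succ_apply', pow_succ', mul_assoc]
      exact Sd_Aff σ (by positivity) ih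
  have hcov : (Set.univ : Set (Δ n)) ⊆ ⋃ A : {A ∈ F | IsOpen A}, σ ⁻¹' A.1 := by
    intro x _
    obtain ⟨A, hA, hx⟩ := h ⟨x, rfl⟩
    exact Set.mem_iUnion.2 ⟨⟨A, hA⟩, hx⟩
  obtain ⟨δ, hδ, hb⟩ := lebesgue_number_lemma_of_metric (isCompact_univ (X := Δ n)) (fun A : {A ∈ F | IsOpen A} => A.2.2.preimage σ.continuous) hcov
  have hlim : Filter.Tendsto (fun k : ℕ => (n / (n+1) : ℝ)^k * 1) Filter.atTop (nhds (0 * 1)) :=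
    (tendsto_pow_atTop_nhds_zero_of_lt_one (by positivity) (by rw [div_lt_one (by positivity)]; linarith)).mul_const 1
  rw [zero_mul] at hlim
  obtain ⟨k, hk⟩ := (hlim.eventually (gt_mem_nhds hδ)).exists
  refine ⟨k, ?_⟩
  refine Finsupp.supported_mono ?_ (key k)
  rintro _ ⟨v, hv, rfl⟩
  obtain ⟨A, hA⟩ := hb (v 0) trivial
  refine ⟨A.1, A.2.1, ?_⟩
  rintro _ ⟨x, rfl⟩
  refine hA ?_
  rw [Metric.mem_ball, Subtype.dist_eq, dist_eq_norm]
  refine lt_of_le_of_lt ?_ hk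
  have := mesh_aux (fun k => (v k).1) _ hv x (v 0).1 (fun k => hv k 0)
  have e : (affD v x).1 = ∑ k, x.1 k • (v k).1 := by ext l; simp [affD]
  change ‖(affD v x).1 - _‖ ≤ _
  rw [e]; exact this

lemma Sd_small_chain {n : ℕ} (F F' : Set (Set X)) (h : ∀ A ∈ F, (∃ A' ∈ F', A ⊆ A') ∨ (A ⊆ ⋃₀ {A ∈ F' | IsOpen A}))
    (c : Ch K X n) (hc : c ∈ supp K F n) : ∃ k, (Sd (K := K))^[k] c ∈ supp K F' n := by
  have up : ∀ (k l : ℕ) (c : Ch K X n), k ≤ l → (Sd (K := K))^[k] c ∈ supp K F' n → (Sd (K := K))^[l] c ∈ supp K F' n := by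
    intro k l c hkl hk
    obtain ⟨m, rfl⟩ := Nat.exists_eq_add_of_le' hkl
    clear hkl
    induction m with
    | zero => simpa using hk
    | succ m ih => rw [show m + 1 + k = (m+k)+1 by ring, Function.iterate_succ_apply']; exact Sd_mem ih
  have e : ∀ k (c : Ch K X n), (Sd (K := K))^[k] c = (Sd (K := K) ^ k) c := fun k c => by rw [Module.End.pow_apply]
  rw [supp, Finsupp.supported_eq_span_single] at hc
  induction hc using Submodule.span_induction with
  | mem x hx =>
    obtain ⟨σ, ⟨A, hA, hs⟩, rfl⟩ := hx
    refine Sd_small σ F' ?_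
    rcases h A hA with ⟨A', h1, h2⟩ | h1
    · exact Or.inl ⟨A', h1, hs.trans h2⟩
    · exact Or.inr (hs.trans h1)
  | zero => exact ⟨0, Submodule.zero_mem _⟩
  | add x y _ _ hx hy =>
    obtain ⟨k, hk⟩ := hx; obtain ⟨l, hl⟩ := hy
    have h1 := up k (max k l) x (le_max_left _ _) hk
    have h2 := up l (max k l) y (le_max_right _ _) hl
    exact ⟨max k l, by rw [e, map_add, ← e, ← e]; exact Submodule.add_mem _ h1 h2⟩
  | smul a x _ hx =>
    obtain ⟨k, hk⟩ := hx
    exact ⟨k, by rw [e, map_smul, ← e]; exact Submodule.smul_mem _ _ hk⟩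

lemma small {n : ℕ} (F F' : Set (Set X)) (h : ∀ A ∈ F, (∃ A' ∈ F', A ⊆ A') ∨ (A ⊆ ⋃₀ {A ∈ F' | IsOpen A}))
    (c : Ch K X (n+1)) (hc : c ∈ supp K F (n+1)) : ∃ c' ∈ supp K F' (n+1), ∃ e r, c - c' = dd e + r ∧
     (∀ G, c ∈ supp K G (n+1) → e ∈ supp K G (n+2)) ∧ (∀ G, dd c ∈ supp K G n → r ∈ supp K G (n+1)) := by
  obtain ⟨k, hk⟩ := Sd_small_chain F F' h c hc
  exact ⟨_, hk, Sd_iter c⟩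

end F2

section F3
variable {K : Type} [CommRing K] {Y Z : Type} [TopologicalSpace Y] [TopologicalSpace Z]
open Finsupp (single)

def bd (K : Type) [CommRing K] (F : Set (Set X)) (n : ℕ) : Submodule K (Ch K X n) := LinearMap.range (dd (K := K) (X := X) (n := n)) ⊔ supp K F n

lemma mem_bd {F : Set (Set X)} {n : ℕ} {w : Ch K X n} : w ∈ bd K F n ↔ ∃ b s, s ∈ supp K F n ∧ w = dd b + s := by
  rw [bd, Submodule.mem_sup]
  constructor
  · rintro ⟨_, ⟨b, rfl⟩, s, hs, rfl⟩; exact ⟨b, s, hs, rfl⟩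
  · rintro ⟨b, s, hs, rfl⟩; exact ⟨_, ⟨b, rfl⟩, s, hs, rfl⟩

lemma dd_mem_bd {F : Set (Set X)} {n : ℕ} (b : Ch K X (n+1)) : dd b ∈ bd K F n := Submodule.mem_sup_left ⟨b, rfl⟩
lemma supp_le_bd (F : Set (Set X)) (n : ℕ) : supp K F n ≤ bd K F n := le_sup_right

lemma bd_mono {F G : Set (Set X)} (h : ∀ A ∈ F, ∃ B ∈ G, A ⊆ B) (n : ℕ) : bd K F n ≤ bd K G n := sup_le_sup_left (supp_mono h n) _

lemma dd_bd {F : Set (Set X)} {n : ℕ} {w : Ch K X (n+1)} (h : w ∈ bd K F (n+1)) : dd w ∈ supp K F n := by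
  obtain ⟨b, s, hs, rfl⟩ := mem_bd.1 h
  rw [map_add, dd_dd, zero_add]; exact dd_mem_supp hs

lemma pair_mono {B U V : Set X} (h : U ⊆ V) : ∀ A ∈ ({B, U} : Set (Set X)), ∃ C ∈ ({B, V} : Set (Set X)), A ⊆ C := by
  rintro A (rfl | rfl)
  · exact ⟨_, Or.inl rfl, le_rfl⟩
  · exact ⟨_, Or.inr rfl, h⟩

lemma supp_pair {B U1 U2 : Set X} {n : ℕ} {c : Ch K X n} (h : c ∈ supp K {B, U1, U2} n) :
    ∃ c1 ∈ supp K {B, U1} n, ∃ c2 ∈ supp K {B, U2} n, c = c1 + c2 := by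
  have : ({B, U1, U2} : Set (Set X)) = {B, U1} ∪ {B, U2} := by ext; simp; tauto
  rw [this, supp_union, Submodule.mem_sup] at h
  obtain ⟨a, ha, b, hb, rfl⟩ := h
  exact ⟨a, ha, b, hb, rfl⟩

lemma supp_two {U1 U2 : Set X} {n : ℕ} {c : Ch K X n} (h : c ∈ supp K {U1, U2} n) :
    ∃ c1 ∈ supp K {U1} n, ∃ c2 ∈ supp K {U2} n, c = c1 + c2 := by
  have : ({U1, U2} : Set (Set X)) = {U1} ∪ {U2} := by ext; simp; tauto
  rw [this, supp_union, Submodule.mem_sup] at h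
  obtain ⟨a, ha, b, hb, rfl⟩ := h
  exact ⟨a, ha, b, hb, rfl⟩

lemma pair_inf {B U1 U2 : Set X} {n : ℕ} {c : Ch K X n} (h1 : c ∈ supp K {B, U1} n) (h2 : c ∈ supp K {B, U2} n) : c ∈ supp K {B, U1 ∩ U2} n := by
  refine supp_inf ?_ h1 h2
  rintro A (rfl | rfl) C (rfl | rfl)
  · exact ⟨_, Or.inl rfl, Set.inter_subset_left⟩
  · exact ⟨_, Or.inl rfl, Set.inter_subset_left⟩
  · exact ⟨_, Or.inl rfl, Set.inter_subset_right⟩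
  · exact ⟨_, Or.inr rfl, le_rfl⟩

lemma cov_pair {B U1 U2 : Set X} (h1 : IsOpen U1) (h2 : IsOpen U2) : ∀ A ∈ ({B, U1 ∪ U2} : Set (Set X)),
    (∃ A' ∈ ({B, U1, U2} : Set (Set X)), A ⊆ A') ∨ A ⊆ ⋃₀ {A ∈ ({B, U1, U2} : Set (Set X)) | IsOpen A} := by
  rintro A (rfl | rfl)
  · exact Or.inl ⟨_, Or.inl rfl, le_rfl⟩
  · right
    rintro x (hx | hx)
    · exact ⟨U1, ⟨by simp, h1⟩, hx⟩
    · exact ⟨U2, ⟨by simp, h2⟩, hx⟩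

def EE (K : Type) [CommRing K] (i : ℕ) (B U U' : Set X) : Prop :=
  ∀ w : Ch K X (i+1), dd w ∈ supp K {B, U} i → w ∈ bd K {B, U'} (i+1) → w ∈ bd K {B, U} (i+1)

lemma bd_univ (B : Set X) (n : ℕ) (w : Ch K X n) : w ∈ bd K {B, Set.univ} n :=
  supp_le_bd _ _ (supp_mono (by rintro _ rfl; exact ⟨_, Or.inr rfl, le_rfl⟩) n (supp_univ n w))

lemma EE_univ (i : ℕ) (B U' : Set X) : EE K i B Set.univ U' := fun w _ _ => bd_univ _ _ w

lemma MV {i : ℕ} {B U1 U2 : Set X} (o1 : IsOpen U1) (o2 : IsOpen U2) (hT : EE K (i+1) B (U1 ∪ U2) Set.univ) {w : Ch K X (i+1)}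
    (h1 : w ∈ bd K {B, U1} (i+1)) (h2 : w ∈ bd K {B, U2} (i+1)) : w ∈ bd K {B, U1 ∩ U2} (i+1) := by
  obtain ⟨b1, s1, hs1, e1⟩ := mem_bd.1 h1
  obtain ⟨b2, s2, hs2, e2⟩ := mem_bd.1 h2
  have hd : dd (b1 - b2) = s2 - s1 := by
    rw [map_sub, sub_eq_sub_iff_add_eq_add, ← e1, e2]; abel
  have m1 : ∀ A ∈ ({B, U1} : Set (Set X)), ∃ C ∈ ({B, U1, U2} : Set (Set X)), A ⊆ C := by
    rintro A (rfl | rfl) <;> exact ⟨_, by simp, le_rfl⟩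
  have m2 : ∀ A ∈ ({B, U2} : Set (Set X)), ∃ C ∈ ({B, U1, U2} : Set (Set X)), A ⊆ C := by
    rintro A (rfl | rfl) <;> exact ⟨_, by simp, le_rfl⟩
  have hs : s2 - s1 ∈ supp K {B, U1, U2} (i+1) := Submodule.sub_mem _ (supp_mono m2 _ hs2) (supp_mono m1 _ hs1)
  have hs' : s2 - s1 ∈ supp K {B, U1 ∪ U2} (i+1) :=
    Submodule.sub_mem _ (supp_mono (pair_mono Set.subset_union_right) _ hs2) (supp_mono (pair_mono Set.subset_union_left) _ hs1)
  obtain ⟨e, g, hg, e3⟩ := mem_bd.1 (hT (b1 - b2) (hd ▸ hs') (bd_univ _ _ _))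
  obtain ⟨g', hg', e', r, e4, -, hr⟩ := small _ _ (cov_pair o1 o2) g hg
  have hdg : dd g = s2 - s1 := by rw [← hd, e3, map_add, dd_dd, zero_add]
  have hr' := hr _ (hdg ▸ hs)
  obtain ⟨g1, hg1, g2, hg2, e5⟩ := supp_pair (Submodule.add_mem _ hg' hr')
  have e6 : b1 - b2 = dd (e + e') + g1 + g2 := by
    rw [e3, map_add, add_assoc _ g1, ← e5, show g = g' + (dd e' + r) by rw [← e4]; abel]; abel
  have e7 : dd g1 + dd g2 = s2 - s1 := by
    rw [← hd, e6, map_add, map_add, dd_dd, zero_add]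
  refine mem_bd.2 ⟨b1 - g1, s1 + dd g1, pair_inf (Submodule.add_mem _ hs1 (dd_mem_supp hg1)) ?_, ?_⟩
  · rw [show s1 + dd g1 = s2 - dd g2 by rw [eq_sub_iff_add_eq, add_assoc, e7]; abel]
    exact Submodule.sub_mem _ hs2 (dd_mem_supp hg2)
  · rw [e1, map_sub]; abel

def cl (t : ℝ) : ℝ := max 0 (min t 1)
lemma cl_cont : Continuous cl := by unfold cl; fun_prop
lemma cl_mem (t : ℝ) : 0 ≤ cl t ∧ cl t ≤ 1 := ⟨le_max_left _ _, max_le zero_le_one (min_le_right _ _)⟩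
lemma cl_zero : cl 0 = 0 := by simp [cl]
lemma cl_one : cl 1 = 1 := by simp [cl]

def jc (c : ℝ) : C(X × ℝ, X × ℝ) := ⟨fun p => (p.1, c), by fun_prop⟩

lemma retr (c : ℝ) : ∃ P : ∀ n, Ch K (X × ℝ) n →ₗ[K] Ch K (X × ℝ) (n+1),
    (∀ n (v : Ch K (X × ℝ) (n+1)), dd (P (n+1) v) = psh (jc c) v - v - P n (dd v)) ∧
    ∀ (F : Set (Set (X × ℝ))), (∀ A ∈ F, ∀ p ∈ A, ∀ t, 0 ≤ t → t ≤ 1 → (p.1, (1-t) * p.2 + t * c) ∈ A) → ∀ n, ∀ v ∈ supp K F n, P n v ∈ supp K F (n+1) := by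
  let H : C((X × ℝ) × ℝ, X × ℝ) := ⟨fun q => (q.1.1, (1 - cl q.2) * q.1.2 + cl q.2 * c), by
    have := cl_cont; fun_prop⟩
  obtain ⟨P, h1, -, h3⟩ := htpy (K := K) H
  refine ⟨P, fun n v => ?_, fun F hF n v hv => h3 F F (fun A hA => ⟨A, hA, fun p hp t => hF A hA p hp _ (cl_mem t).1 (cl_mem t).2⟩) n v hv⟩
  rw [h1]
  have a1 : H.comp ((ContinuousMap.id (X × ℝ)).prodMk (.const _ 1)) = jc c := by
    ext p
    · rfl
    · change (1 - cl 1) * p.2 + cl 1 * c = c; simp [cl_one]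
  have a0 : H.comp ((ContinuousMap.id (X × ℝ)).prodMk (.const _ 0)) = ContinuousMap.id _ := by
    ext p
    · rfl
    · change (1 - cl 0) * p.2 + cl 0 * c = p.2; simp [cl_zero]
  rw [a1, a0, psh_id]

def cyl (U : Set X) : Set (X × ℝ) := {p | p.1 ∈ U}

lemma susp {i : ℕ} {B U U' : Set X} (oU : IsOpen U) (oU' : IsOpen U') (hU : U ⊆ U') {a b a' b' : ℝ} (ha : a ≤ a') (hab : a' ≤ b') (hb : b' ≤ b)
    (h : EE K i B U U') :
    EE K (i+1) (cyl B) (cyl U ∪ {p : X × ℝ | p.2 < a ∨ b < p.2}) (cyl U' ∪ {p : X × ℝ | p.2 < a' ∨ b' < p.2}) := by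
  set W : Set X → ℝ → Set (X × ℝ) := fun U b => cyl U ∪ {p | b < p.2} with hW
  set V : Set X → ℝ → Set (X × ℝ) := fun U a => cyl U ∪ {p | p.2 < a} with hV
  have oc : ∀ U : Set X, IsOpen U → IsOpen (cyl U) := fun U hU => hU.preimage continuous_fst
  have oW : ∀ U b, IsOpen U → IsOpen (W U b) := fun U b hU => (oc U hU).union (isOpen_lt continuous_const continuous_snd)
  have oV : ∀ U a, IsOpen U → IsOpen (V U a) := fun U a hU => (oc U hU).union (isOpen_lt continuous_snd continuous_const)
  have eq : ∀ (U : Set X) a b, cyl U ∪ {p : X × ℝ | p.2 < a ∨ b < p.2} = W U b ∪ V U a := by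
    intro U a b; ext p; simp [hW, hV]; tauto
  have eqI : ∀ (U : Set X) {a b : ℝ}, a ≤ b → W U b ∩ V U a ⊆ cyl U := by
    rintro U a b hab p ⟨h1 | h1, h2 | h2⟩
    · exact h1
    · exact h1
    · exact h2
    · exact absurd (h1.trans h2) (not_lt.2 hab)
  rw [eq, eq]
  have split : ∀ {U : Set X} {a b : ℝ}, IsOpen U → ∀ {j : ℕ} (f : Ch K (X × ℝ) (j+1)), f ∈ supp K {cyl B, W U b ∪ V U a} (j+1) →
      dd f ∈ supp K {cyl B, W U b, V U a} j → ∃ f1 ∈ supp K {cyl B, W U b} (j+1), ∃ f2 ∈ supp K {cyl B, V U a} (j+1), ∃ e ∈ supp K {cyl B, W U b ∪ V U a} (j+2),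
        f = f1 + f2 + dd e := by
    intro U a b oU j f hf hdf
    obtain ⟨f', hf', e, r, e1, he, hr⟩ := small _ _ (cov_pair (oW U b oU) (oV U a oU)) f hf
    obtain ⟨f1, h1, f2, h2, e2⟩ := supp_pair (Submodule.add_mem _ hf' (hr _ hdf))
    exact ⟨f1, h1, f2, h2, e, he _ hf, by rw [← e2, show f = f' + (dd e + r) by rw [← e1]; abel]; abel⟩
  intro w hw1 hw2
  obtain ⟨f1, hf1, f2, hf2, e, he, efe⟩ := split (a := a) (b := b) oU (dd w) hw1 (by rw [dd_dd]; exact Submodule.zero_mem _)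
  have hf : dd (w - e) = f1 + f2 := by rw [map_sub, efe]; abel
  suffices hh : w - e ∈ bd K {cyl B, W U b ∪ V U a} (i+1+1) by
    have := Submodule.add_mem _ hh (supp_le_bd _ _ he); simpa using this
  have d1 : dd f1 ∈ supp K {cyl B, cyl U} i := by
    refine supp_mono (pair_mono (eqI U (ha.trans (hab.trans hb)))) _ (pair_inf (dd_mem_supp hf1) ?_)
    have : dd f1 = - dd f2 := by rw [eq_neg_iff_add_eq_zero, ← map_add, ← hf, dd_dd]
    rw [this]; exact Submodule.neg_mem _ (dd_mem_supp hf2)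
  let p : C(X × ℝ, X) := ⟨Prod.fst, continuous_fst⟩
  have hp : ∀ (U : Set X) n (v : Ch K (X × ℝ) n), v ∈ supp K {cyl B, cyl U} n → psh p v ∈ supp K {B, U} n := by
    intro U n v hv
    refine psh_mem_supp p ?_ hv
    rintro A (rfl | rfl)
    · exact ⟨_, Or.inl rfl, fun x hx => hx⟩
    · exact ⟨_, Or.inr rfl, fun x hx => hx⟩
  have hWW : W U b ⊆ W U' b' := by
    rintro x (h | h)
    · exact Or.inl (hU h)
    · exact Or.inr (lt_of_le_of_lt hb h)
  have hVV : V U a ⊆ V U' a' := by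
    rintro x (h | h)
    · exact Or.inl (hU h)
    · exact Or.inr (lt_of_lt_of_le h ha)
  have key : psh p f1 ∈ bd K {B, U'} (i+1) := by
    have hw3 : w - e ∈ bd K {cyl B, W U' b' ∪ V U' a'} (i+1+1) :=
      Submodule.sub_mem _ hw2 (supp_le_bd _ _ (supp_mono (pair_mono (Set.union_subset_union hWW hVV)) _ he))
    obtain ⟨c, s, hs, e3⟩ := mem_bd.1 hw3
    have hds : dd s = f1 + f2 := by rw [← hf, e3, map_add, dd_dd, zero_add]
    obtain ⟨s1, hs1, s2, hs2, e', -, e4⟩ := split (a := a') (b := b') oU' s hs (by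
      rw [hds]
      refine Submodule.add_mem _ (supp_mono ?_ _ hf1) (supp_mono ?_ _ hf2)
      · rintro A (rfl | rfl)
        · exact ⟨_, by simp, le_rfl⟩
        · exact ⟨_, Or.inr (Or.inl rfl), hWW⟩
      · rintro A (rfl | rfl)
        · exact ⟨_, by simp, le_rfl⟩
        · exact ⟨_, Or.inr (Or.inr rfl), hVV⟩)
    have e5 : f1 - dd s1 = dd s2 - f2 := by
      have : dd s = dd s1 + dd s2 := by rw [e4, map_add, map_add, dd_dd, add_zero]
      rw [sub_eq_sub_iff_add_eq_add, ← hds, this]; abel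
    have h6 : f1 - dd s1 ∈ supp K {cyl B, cyl U'} (i+1) := by
      refine supp_mono (pair_mono (eqI U' hab)) _ (pair_inf (Submodule.sub_mem _ (supp_mono (pair_mono hWW) _ hf1) (dd_mem_supp hs1)) ?_)
      rw [e5]; exact Submodule.sub_mem _ (dd_mem_supp hs2) (supp_mono (pair_mono hVV) _ hf2)
    refine mem_bd.2 ⟨psh p s1, _, hp U' _ _ h6, ?_⟩
    rw [dd_psh, ← map_add]; congr 1; abel
  obtain ⟨q, s0, hs0, e7⟩ := mem_bd.1 (h (psh p f1) (by rw [dd_psh]; exact hp _ _ _ d1) key)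
  obtain ⟨P, hP1, hP2⟩ := retr (K := K) (X := X) (b+1)
  obtain ⟨Q, hQ1, hQ2⟩ := retr (K := K) (X := X) (a-1)
  have pres : ∀ (A A' : Set (X × ℝ)) (c : ℝ), (∀ p ∈ A, ∀ t, 0 ≤ t → t ≤ 1 → (p.1, (1-t) * p.2 + t * c) ∈ A) →
     (∀ p ∈ A', ∀ t, 0 ≤ t → t ≤ 1 → (p.1, (1-t) * p.2 + t * c) ∈ A') →
     ∀ C ∈ ({A, A'} : Set (Set (X × ℝ))), ∀ p ∈ C, ∀ t, 0 ≤ t → t ≤ 1 → (p.1, (1-t) * p.2 + t * c) ∈ C := by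
    rintro A A' c h1 h2 C (rfl | rfl)
    · exact h1
    · exact h2
  have prc : ∀ (A : Set X) (c : ℝ), ∀ p ∈ cyl A, ∀ t, 0 ≤ t → t ≤ 1 → (p.1, (1-t) * p.2 + t * c) ∈ cyl A := fun A c p hp t _ _ => hp
  have prW : ∀ p ∈ W U b, ∀ t, 0 ≤ t → t ≤ 1 → (p.1, (1-t) * p.2 + t * (b+1)) ∈ W U b := by
    rintro p (h | h) t h0 h1
    · exact Or.inl h
    · right
      have h : b < p.2 := h
      change b < (1-t) * p.2 + t * (b+1)
      rcases h1.lt_or_eq with h1 | rfl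
      · nlinarith
      · linarith
  have prV : ∀ p ∈ V U a, ∀ t, 0 ≤ t → t ≤ 1 → (p.1, (1-t) * p.2 + t * (a-1)) ∈ V U a := by
    rintro p (h | h) t h0 h1
    · exact Or.inl h
    · right
      have h : p.2 < a := h
      change (1-t) * p.2 + t * (a-1) < a
      rcases h1.lt_or_eq with h1 | rfl
      · nlinarith
      · linarith
  let j : C(X, X × ℝ) := ⟨fun x => (x, b+1), by fun_prop⟩
  have hj : psh (jc (b+1)) f1 = psh j (psh p f1) := by rw [psh_psh]; rfl
  have hjU : psh j s0 ∈ supp K {cyl B, V U a} (i+1) := by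
    refine psh_mem_supp j ?_ hs0
    rintro A (rfl | rfl)
    · exact ⟨_, Or.inl rfl, fun x hx => hx⟩
    · exact ⟨_, Or.inr rfl, fun x hx => Or.inl hx⟩
  have hq : psh j q - P (i+1) f1 ∈ supp K {cyl B, W U b} (i+2) := by
    refine Submodule.sub_mem _ (supp_mono (F := {W U b}) ?_ _ (psh_mem_supp (F := {Set.univ}) j ?_ (supp_univ _ q))) (hP2 _ (pres _ _ _ (prc _ _) prW) _ _ hf1)
    · rintro _ rfl; exact ⟨_, Or.inr rfl, le_rfl⟩
    · rintro _ rfl; exact ⟨_, rfl, fun x _ => Or.inr (lt_add_one b)⟩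
  have hv : dd (w - e - (psh j q - P (i+1) f1)) ∈ supp K {cyl B, V U a} (i+1) := by
    have : dd (w - e - (psh j q - P (i+1) f1)) = f2 + psh j s0 - P i (dd f1) := by
      rw [map_sub, hf, map_sub, hP1, dd_psh, hj, e7, map_add]; abel
    rw [this]
    refine Submodule.sub_mem _ (Submodule.add_mem _ hf2 hjU) ?_
    exact supp_mono (pair_mono Set.subset_union_left) _ (hP2 _ (pres _ _ _ (prc _ _) (prc _ _)) _ _ d1)
  set v := w - e - (psh j q - P (i+1) f1)
  have hv2 : v ∈ bd K {cyl B, W U b ∪ V U a} (i+2) := by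
    have e8 : v = dd (- Q _ v) + (psh (jc (a-1)) v - Q _ (dd v)) := by
      rw [map_neg, hQ1]; abel
    refine mem_bd.2 ⟨_, _, ?_, e8⟩
    refine Submodule.sub_mem _ (supp_mono (F := {V U a}) ?_ _ (psh_mem_supp (F := {Set.univ}) _ ?_ (supp_univ _ v)))
      (supp_mono (pair_mono Set.subset_union_right) _ (hQ2 _ (pres _ _ _ (prc _ _) prV) _ _ hv))
    · rintro _ rfl; exact ⟨_, Or.inr rfl, Set.subset_union_right⟩
    · rintro _ rfl; exact ⟨_, rfl, fun x _ => Or.inr (sub_one_lt a)⟩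
  have := Submodule.add_mem _ hv2 (supp_le_bd _ _ (supp_mono (pair_mono Set.subset_union_left) _ hq))
  rwa [sub_add_cancel] at this

end F3

section F4
variable {K : Type} [CommRing K] {Y Z : Type} [TopologicalSpace Y] [TopologicalSpace Z]
open Finsupp (single)

lemma dpt (n : ℕ) : Nonempty (Δ n) := ⟨⟨Pi.single 0 1, single_mem_stdSimplex ℝ 0⟩⟩

lemma mem_supp1 {C : Set X} {n : ℕ} {x : Ch K X n} : x ∈ supp K {C} n ↔ ∀ σ, x σ ≠ 0 → Set.range σ ⊆ C := by
  rw [supp, Finsupp.mem_supported]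
  constructor
  · intro h σ hσ; obtain ⟨A, rfl, hA⟩ := h (Finsupp.mem_support_iff.2 hσ); exact hA
  · intro h σ hσ; exact ⟨C, rfl, h σ (Finsupp.mem_support_iff.1 hσ)⟩

lemma fam_zero {ι : Type} [Fintype ι] {C : ι → Set X} (hC : ∀ k l, k ≠ l → Disjoint (C k) (C l)) {n : ℕ} {x : ι → Ch K X n}
    (hx : ∀ k, x k ∈ supp K {C k} n) (h : ∑ k, x k = 0) (k : ι) : x k = 0 := by
  classical
  ext σ
  by_contra hk
  have := DFunLike.congr_fun h σ
  rw [Finsupp.finsetSum_apply, Finset.sum_eq_single k] at this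
  · exact hk this
  · intro l _ hl
    by_contra h0
    obtain ⟨p⟩ := dpt n
    exact Set.disjoint_left.1 (hC k l hl.symm) (mem_supp1.1 (hx k) σ hk ⟨p, rfl⟩) (mem_supp1.1 (hx l) σ h0 ⟨p, rfl⟩)
  · simp

lemma fam_split {ι : Type} [Fintype ι] {C : ι → Set X} (hC : ∀ k l, k ≠ l → Disjoint (C k) (C l)) {n : ℕ} {f : Ch K X n}
    (hf : f ∈ supp K (Set.range C) n) : ∃ x : ι → Ch K X n, (∀ k, x k ∈ supp K {C k} n) ∧ ∑ k, x k = f := by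
  classical
  refine ⟨fun k => Finsupp.filter (fun σ => Set.range σ ⊆ C k) f, fun k => mem_supp1.2 fun σ hσ => ?_, ?_⟩
  · by_contra h; exact hσ (Finsupp.filter_apply_neg _ _ h)
  · ext σ
    rw [Finsupp.finsetSum_apply]
    by_cases h0 : f σ = 0
    · rw [h0]; refine Finset.sum_eq_zero fun k _ => ?_
      rw [Finsupp.filter_apply]; split_ifs <;> simp [h0]
    obtain ⟨_, ⟨k, rfl⟩, hk⟩ := hf (Finsupp.mem_support_iff.2 h0)
    rw [Finset.sum_eq_single k, Finsupp.filter_apply_pos (fun σ : SSimplex X n => Set.range σ ⊆ C k) f hk]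
    · intro l _ hl
      refine Finsupp.filter_apply_neg _ _ fun h => ?_
      obtain ⟨p⟩ := dpt n
      exact Set.disjoint_left.1 (hC k l hl.symm) (hk ⟨p, rfl⟩) (h ⟨p, rfl⟩)
    · simp

lemma const_bd (c : X) (n : ℕ) (f : Ch K X (n+1)) (hf : dd f = 0) :
    ∃ q ∈ supp K {{c}} (n+2), psh (ContinuousMap.const X c) f = dd q := by
  have key : ∀ m (g : Ch K X m), psh (ContinuousMap.const X c) g = single (ContinuousMap.const _ c : SSimplex X m) (g.sum fun _ r => r) := by
    intro m g
    rw [psh_apply, Finsupp.mapDomain, Finsupp.sum, Finsupp.sum, Finsupp.single_finset_sum]; rfl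
  have hd : ∀ m r, dd (single (ContinuousMap.const _ c : SSimplex X (m+1)) r : Ch K X (m+1)) = single (ContinuousMap.const _ c) (if Even m then 0 else r) := by
    intro m r
    rw [dd, bdF_apply]
    have : ∀ i : Fin (m+2), Finsupp.mapDomain (fun σ => faceOf σ i) (single (ContinuousMap.const _ c : SSimplex X (m+1)) r) = single (ContinuousMap.const _ c) r := by
      intro i; rw [Finsupp.mapDomain_single]; rfl
    simp_rw [this, ← Finset.sum_smul]
    rw [Fin.sum_univ_eq_sum_range (fun i => (-1:K)^i), neg_one_geom_sum]
    by_cases h : Even m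
    · have : Even (m+2) := by rw [Nat.even_add]; simpa using h
      simp [this, h]
    · have : ¬ Even (m+2) := by rw [Nat.even_add]; simpa using h
      simp [this, h]
  by_cases h : Even n
  · refine ⟨single (ContinuousMap.const _ c) (f.sum fun _ r => r), single_mem_supp (Set.mem_singleton {c}) (Set.range_subset_iff.2 fun _ => rfl) _, ?_⟩
    rw [hd, key, if_neg (by rw [Nat.even_add_one]; simpa using h)]
  · have h2 : dd (psh (ContinuousMap.const X c) f) = 0 := by rw [dd_psh, hf, map_zero]
    rw [key, hd, if_neg h, Finsupp.single_eq_zero] at h2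
    refine ⟨0, Submodule.zero_mem _, ?_⟩
    rw [key, h2]; simp

section base
variable {J : Set ℝ} (hJ : J.OrdConnected)
include hJ

lemma contr (C : Set J) (hC : C.OrdConnected) (c : J) (hc : c ∈ C) : ∃ P : ∀ n, Ch K J n →ₗ[K] Ch K J (n+1),
    (∀ n (v : Ch K J (n+1)), dd (P (n+1) v) = psh (.const _ c) v - v - P n (dd v)) ∧
    (∀ (v : Ch K J 0), dd (P 0 v) = psh (.const _ c) v - v) ∧ ∀ n, ∀ v ∈ supp K {C} n, P n v ∈ supp K {C} (n+1) := by
  have hm : ∀ (x y : ℝ) (t : ℝ), (1 - cl t) * x + cl t * y ∈ Set.uIcc x y := by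
    intro x y t
    obtain ⟨h0, h1⟩ := cl_mem t
    rw [Set.mem_uIcc]
    rcases le_total x y with h | h
    · left; constructor <;> nlinarith
    · right; constructor <;> nlinarith
  let H : C(J × ℝ, J) := ⟨fun q => ⟨(1 - cl q.2) * q.1 + cl q.2 * c, hJ.uIcc_subset q.1.2 c.2 (hm _ _ _)⟩, by
    have := cl_cont; fun_prop⟩
  obtain ⟨P, h1, h2, h3⟩ := htpy (K := K) H
  have a1 : H.comp ((ContinuousMap.id J).prodMk (.const _ 1)) = .const _ c := by
    ext p
    change (1 - cl 1) * (p:ℝ) + cl 1 * c = c; simp [cl_one]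
  have a0 : H.comp ((ContinuousMap.id J).prodMk (.const _ 0)) = ContinuousMap.id _ := by
    ext p
    change (1 - cl 0) * (p:ℝ) + cl 0 * c = p; simp [cl_zero]
  simp_rw [a1, a0, psh_id] at h1 h2
  refine ⟨P, h1, h2, h3 _ _ ?_⟩
  rintro A rfl
  refine ⟨A, rfl, fun x hx t => hC.uIcc_subset hx hc ?_⟩
  have := hm x c t
  rw [Set.mem_uIcc] at this ⊢
  exact this

lemma acyc (C : Set J) (hC : C.OrdConnected) (n : ℕ) (f : Ch K J n) (hf : f ∈ supp K {C} n) (s : Ch K J (n+1)) (hs : dd s = f) :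
    ∃ q ∈ supp K {C} (n+1), dd q = f := by
  rcases C.eq_empty_or_nonempty with rfl | ⟨c, hc⟩
  · refine ⟨0, Submodule.zero_mem _, ?_⟩
    rw [map_zero]; ext σ; by_contra h
    obtain ⟨p⟩ := dpt n
    exact mem_supp1.1 hf σ (Ne.symm h) ⟨p, rfl⟩
  obtain ⟨P, h1, h2, h3⟩ := contr (K := K) hJ C hC c hc
  refine ⟨psh (.const _ c) s - P n f, Submodule.sub_mem _ (psh_mem_supp (F := {Set.univ}) _ ?_ (supp_univ _ s)) (h3 _ _ hf), ?_⟩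
  · rintro _ rfl; exact ⟨C, rfl, fun _ _ => hc⟩
  · have : dd (P n f) = psh (.const _ c) f - f := by
      cases n with
      | zero => exact h2 f
      | succ n => rw [h1, ← hs, dd_dd, map_zero, sub_zero]
    rw [map_sub, dd_psh, hs, this]; abel

lemma acyc1 (C : Set J) (hC : C.OrdConnected) (n : ℕ) (f : Ch K J (n+1)) (hf : dd f = 0) : ∃ s, dd s = f := by
  by_cases h : Nonempty J
  swap
  · refine ⟨0, ?_⟩
    rw [map_zero]; ext σ
    obtain ⟨p⟩ := dpt (n+1)
    exact absurd ⟨σ p⟩ h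
  obtain ⟨c⟩ := h
  obtain ⟨P, h1, -, -⟩ := contr (K := K) hJ Set.univ Set.ordConnected_univ c trivial
  obtain ⟨q, -, hq⟩ := const_bd c n f hf
  refine ⟨q - P _ f, ?_⟩
  rw [map_sub, h1, ← hq, hf, map_zero]; abel

def UJ (J : Set ℝ) (a b : ℝ) : Set J := {p | (p:ℝ) < a ∨ b < p}
def BJ (J : Set ℝ) : Set J := {p | (p:ℝ) = 0}

lemma base (i : ℕ) (a b y1 y2 : ℝ) (U' : Set J) (h1 : a ≤ y1) (h12 : y1 ≤ y2) (h2 : y2 ≤ b)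
    (Hb1 : (0:ℝ) ∈ J → 0 < y1 → 0 < a ∨ ∀ p ∈ J, a ≤ p) (Hb2 : (0:ℝ) ∈ J → y2 < 0 → b < 0 ∨ ∀ p ∈ J, p ≤ b)
    (hU : (0 < i) ∨ ∀ p ∈ U', (p:ℝ) ≠ y1 ∧ (p:ℝ) ≠ y2) : EE K i (BJ J) (UJ J a b) U' := by
  let P : Fin 3 → Set J := ![{p | (p:ℝ) < y1}, {p | y1 ≤ p ∧ p ≤ y2}, {p | y2 < p}]
  let C : Fin 3 → Set J := fun k => P k ∩ (BJ J ∪ UJ J a b)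
  have hPd : ∀ k l, k ≠ l → Disjoint (P k) (P l) := by
    have : ∀ k l, k < l → Disjoint (P k) (P l) := by
      intro k l hkl
      rw [Set.disjoint_left]; intro x hx hx'
      fin_cases k <;> fin_cases l <;> simp [P] at hkl hx hx' <;> first | linarith | (obtain ⟨_, _⟩ := hx; linarith) | (obtain ⟨_, _⟩ := hx'; linarith)
    intro k l hkl
    rcases lt_or_gt_of_ne hkl with h | h
    · exact this k l h
    · exact (this l k h).symm
  have hCd : ∀ k l, k ≠ l → Disjoint (C k) (C l) := fun k l h => (hPd k l h).mono Set.inter_subset_left Set.inter_subset_left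
  have hcon : ∀ (σ : Set J), IsPreconnected σ → ∀ y : ℝ, (∀ p ∈ σ, (p:ℝ) ≠ y) → (∀ p ∈ σ, (p:ℝ) < y) ∨ (∀ p ∈ σ, y < p) := by
    intro σ hσ y h
    rw [isPreconnected_iff_subset_of_disjoint] at hσ
    refine hσ {p | (p:ℝ) < y} {p | y < p} (isOpen_lt continuous_subtype_val continuous_const) (isOpen_lt continuous_const continuous_subtype_val)
      (fun p hp => lt_or_gt_of_ne (h p hp)) ?_
    ext p; simp only [Set.mem_inter_iff, Set.mem_setOf_eq, Set.mem_empty_iff_false, iff_false]; rintro ⟨-, h1, h2⟩; linarith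
  have hBk : ∀ σ : Set J, IsPreconnected σ → (σ ⊆ BJ J ∨ ∀ p ∈ σ, (p:ℝ) ≠ y1 ∧ (p:ℝ) ≠ y2) → ∃ k, σ ⊆ P k := by
    intro σ hσ h
    rcases h with h | h
    · by_cases h3 : (0:ℝ) < y1
      · exact ⟨0, fun p hp => by have h : (p:ℝ) = 0 := h hp; simp [P, h, h3]⟩
      by_cases h4 : y2 < 0
      · exact ⟨2, fun p hp => by have h : (p:ℝ) = 0 := h hp; simp [P, h, h4]⟩
      · exact ⟨1, fun p hp => by have h : (p:ℝ) = 0 := h hp; simp [P, h]; constructor <;> linarith⟩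
    rcases hcon σ hσ y1 (fun p hp => (h p hp).1) with h3 | h3
    · exact ⟨0, h3⟩
    rcases hcon σ hσ y2 (fun p hp => (h p hp).2) with h4 | h4
    · exact ⟨1, fun p hp => ⟨(h3 p hp).le, (h4 p hp).le⟩⟩
    · exact ⟨2, h4⟩
  have hUn : ∀ p ∈ UJ J a b, (p:ℝ) ≠ y1 ∧ (p:ℝ) ≠ y2 := by
    rintro p (h | h) <;> constructor <;> intro h' <;> linarith
  have hpc : ∀ {m : ℕ} (σ : SSimplex J m), IsPreconnected (Set.range σ) := fun {m} σ => by
    have : PreconnectedSpace (Δ m) := Subtype.preconnectedSpace (convex_stdSimplex ℝ _).isPreconnected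
    exact isPreconnected_range σ.continuous
  have hPf : ∀ {m : ℕ} {F : Set (Set J)}, (∀ A ∈ F, A ⊆ BJ J ∨ ∀ p ∈ A, (p:ℝ) ≠ y1 ∧ (p:ℝ) ≠ y2) → ∀ f ∈ supp K F m, f ∈ supp K (Set.range P) m := by
    intro m F hF
    refine supp_le ?_
    rintro σ ⟨A, hA, hs⟩
    obtain ⟨k, hk⟩ := hBk _ (hpc σ) ((hF A hA).imp hs.trans fun h p hp => h p (hs hp))
    exact single_mem_supp (Set.mem_range_self k) hk _
  have hCf : ∀ {m : ℕ}, ∀ f ∈ supp K {BJ J, UJ J a b} m, f ∈ supp K (Set.range C) m := by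
    intro m
    refine supp_le ?_
    rintro σ ⟨A, hA, hs⟩
    have : (Set.range σ ⊆ BJ J ∨ ∀ p ∈ Set.range σ, (p:ℝ) ≠ y1 ∧ (p:ℝ) ≠ y2) ∧ Set.range σ ⊆ BJ J ∪ UJ J a b := by
      rcases hA with rfl | rfl
      · exact ⟨Or.inl hs, fun p hp => Or.inl (hs hp)⟩
      · exact ⟨Or.inr fun p hp => hUn p (hs hp), fun p hp => Or.inr (hs hp)⟩
    obtain ⟨k, hk⟩ := hBk _ (hpc σ) this.1
    exact single_mem_supp (Set.mem_range_self k) (Set.subset_inter hk this.2) _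
  have hCo : ∀ k, (C k).OrdConnected ∧ (C k ⊆ BJ J ∨ C k ⊆ UJ J a b) := by
    have hB : ∀ T : Set J, T ⊆ BJ J → T.OrdConnected := by
      refine fun T hT => ⟨fun x hx y hy z hz => ?_⟩
      have e : x = y := Subtype.ext ((hT hx).trans (hT hy).symm)
      rwa [← le_antisymm hz.1 (e ▸ hz.2)]
    have c0 : C 0 ⊆ BJ J ∨ C 0 = {p : J | (p:ℝ) < a} := by
      by_cases h : ((0:ℝ) ∈ J → 0 < y1 → 0 < a)
      · right; ext p
        simp only [C, P, Set.mem_inter_iff, Set.mem_union, BJ, UJ, Set.mem_setOf_eq, Matrix.cons_val_zero]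
        constructor
        · rintro ⟨h3, h4 | h4 | h4⟩
          · rw [h4]; rw [h4] at h3; exact h (h4 ▸ p.2) h3
          · exact h4
          · linarith
        · exact fun h => ⟨by linarith, Or.inr (Or.inl h)⟩
      · push Not at h
        have := (Hb1 h.1 h.2.1).resolve_left (not_lt.2 h.2.2)
        left; rintro p ⟨h3, h4 | h4 | h4⟩
        · exact h4
        · linarith [this p p.2]
        · have h3 : (p:ℝ) < y1 := h3
          linarith
    have c2 : C 2 ⊆ BJ J ∨ C 2 = {p : J | b < (p:ℝ)} := by
      by_cases h : ((0:ℝ) ∈ J → y2 < 0 → b < 0)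
      · right; ext p
        simp only [C, P, Set.mem_inter_iff, Set.mem_union, BJ, UJ, Set.mem_setOf_eq, Matrix.cons_val]
        constructor
        · rintro ⟨h3, h4 | h4 | h4⟩
          · rw [h4]; rw [h4] at h3; exact h (h4 ▸ p.2) h3
          · linarith
          · exact h4
        · exact fun h => ⟨by linarith, Or.inr (Or.inr h)⟩
      · push Not at h
        have := (Hb2 h.1 h.2.1).resolve_left (not_lt.2 h.2.2)
        left; rintro p ⟨h3, h4 | h4 | h4⟩
        · exact h4
        · have h3 : y2 < (p:ℝ) := h3
          linarith
        · linarith [this p p.2]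
    intro k
    fin_cases k
    · rcases c0 with h | h
      · exact ⟨hB _ h, Or.inl h⟩
      · refine ⟨?_, Or.inr ?_⟩
        · change (C 0).OrdConnected
          rw [h]; exact ⟨fun x hx y hy z hz => lt_of_le_of_lt (show (z:ℝ) ≤ y from hz.2) hy⟩
        · change C 0 ⊆ _
          rw [h]; exact fun p hp => Or.inl hp
    · have : C 1 ⊆ BJ J := by
        rintro p ⟨h3, h4 | h4⟩
        · exact h4
        · have h3 : y1 ≤ (p:ℝ) ∧ (p:ℝ) ≤ y2 := h3
          rcases h4 with h4 | h4 <;> linarith [h3.1, h3.2]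
      exact ⟨hB _ this, Or.inl this⟩
    · rcases c2 with h | h
      · exact ⟨hB _ h, Or.inl h⟩
      · refine ⟨?_, Or.inr ?_⟩
        · change (C 2).OrdConnected
          rw [h]; exact ⟨fun x hx y hy z hz => lt_of_lt_of_le hx (show (x:ℝ) ≤ z from hz.1)⟩
        · change C 2 ⊆ _
          rw [h]; exact fun p hp => Or.inr hp
  intro w hw1 hw2
  suffices hs : ∀ f : Fin 3 → Ch K J i, (∀ k, f k ∈ supp K {C k} i) → ∑ k, f k = dd w → ∀ k, ∃ s, dd s = f k by
    obtain ⟨f, hf, hfs⟩ := fam_split hCd (hCf _ hw1)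
    choose s hs using hs f hf hfs
    choose q hq hqs using fun k => acyc hJ _ (hCo k).1 _ _ (hf k) _ (hs k)
    obtain ⟨c, hc⟩ := acyc1 hJ Set.univ Set.ordConnected_univ _ (w - ∑ k, q k) (by rw [map_sub, map_sum]; simp_rw [hqs]; rw [hfs, sub_self])
    refine mem_bd.2 ⟨c, ∑ k, q k, Submodule.sum_mem _ fun k _ => supp_mono ?_ _ (hq k), by rw [hc]; abel⟩
    rintro A rfl
    rcases (hCo k).2 with h | h
    · exact ⟨_, Or.inl rfl, h⟩
    · exact ⟨_, Or.inr rfl, h⟩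
  intro f hf hfs k
  rcases hU with hU | hU
  · obtain ⟨i, rfl⟩ : ∃ l, i = l + 1 := ⟨i - 1, by omega⟩
    refine acyc1 hJ Set.univ Set.ordConnected_univ _ _ (fam_zero hCd (x := fun k => dd (f k)) (fun k => dd_mem_supp (hf k)) ?_ k)
    rw [← map_sum, hfs, dd_dd]
  · obtain ⟨b, s, hs, e⟩ := mem_bd.1 hw2
    obtain ⟨x, hx, hxs⟩ := fam_split hPd (hPf (by rintro A (rfl | rfl); exacts [Or.inl le_rfl, Or.inr hU]) s hs)
    refine ⟨x k, sub_eq_zero.1 (fam_zero hPd (x := fun k => dd (x k) - f k) (fun k => Submodule.sub_mem _ (dd_mem_supp (hx k)) (supp_mono ?_ _ (hf k))) ?_ k)⟩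
    · rintro A rfl; exact ⟨_, rfl, Set.inter_subset_left⟩
    · rw [Finset.sum_sub_distrib, ← map_sum, hxs, hfs, e, map_add, dd_dd, zero_add, sub_self]
end base
end F4

section F5
variable {K : Type} [CommRing K] {Y Z : Type} [TopologicalSpace Y] [TopologicalSpace Z]
open Finsupp (single)

lemma EE_homeo (h : X ≃ₜ Y) {i : ℕ} {B U U' : Set Y} (hE : EE K i (h ⁻¹' B) (h ⁻¹' U) (h ⁻¹' U')) : EE K i B U U' := by
  have hs : ∀ (V : Set Y) n (v : Ch K Y n), v ∈ supp K {B, V} n → psh (h.symm : C(Y, X)) v ∈ supp K {h ⁻¹' B, h ⁻¹' V} n := by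
    intro V n v hv
    refine psh_mem_supp _ ?_ hv
    rintro A (rfl | rfl)
    · exact ⟨_, Or.inl rfl, fun x hx => by simpa using hx⟩
    · exact ⟨_, Or.inr rfl, fun x hx => by simpa using hx⟩
  have hid : ∀ n (v : Ch K Y n), psh (h : C(X, Y)) (psh (h.symm : C(Y, X)) v) = v := by
    intro n v
    rw [psh_psh, show (h : C(X, Y)).comp (h.symm : C(Y, X)) = ContinuousMap.id Y by ext x; simp, psh_id]
  intro w h1 h2
  obtain ⟨b, s, hs', e⟩ := mem_bd.1 h2
  obtain ⟨b', s', hs2, e'⟩ := mem_bd.1 (hE (psh (h.symm : C(Y, X)) w) (by rw [dd_psh]; exact hs _ _ _ h1)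
    (mem_bd.2 ⟨psh (h.symm : C(Y, X)) b, _, hs _ _ _ hs', by rw [dd_psh, ← map_add, ← e]⟩))
  refine mem_bd.2 ⟨psh (h : C(X, Y)) b', psh (h : C(X, Y)) s', ?_, by rw [dd_psh, ← map_add, ← e', hid]⟩
  refine psh_mem_supp _ ?_ hs2
  rintro A (rfl | rfl)
  · exact ⟨_, Or.inl rfl, fun x hx => hx⟩
  · exact ⟨_, Or.inr rfl, fun x hx => hx⟩

abbrev XX (J : Set ℝ) (m : ℕ) : Type := J × (Fin m → ℝ)
def BX (J : Set ℝ) (m : ℕ) : Set (XX J m) := {x | (x.1:ℝ) = 0}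
def box (J : Set ℝ) {m : ℕ} (a b : ℝ) (lo hi : Fin m → ℝ) : Set (XX J m) := {x | (a ≤ x.1 ∧ x.1 ≤ b) ∧ ∀ i, lo i ≤ x.2 i ∧ x.2 i ≤ hi i}

def XXs (J : Set ℝ) (m : ℕ) : XX J m × ℝ ≃ₜ XX J (m+1) where
  toFun q := (q.1.1, Fin.cons q.2 q.1.2)
  invFun p := ((p.1, fun i => p.2 i.succ), p.2 0)
  left_inv q := by simp
  right_inv p := by ext i; rfl; refine Fin.cases ?_ (fun i => ?_) i <;> simp
  continuous_toFun := (continuous_fst.comp continuous_fst).prodMk (Continuous.finCons continuous_snd (continuous_snd.comp continuous_fst))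
  continuous_invFun := by fun_prop

lemma boxE {J : Set ℝ} (hJ : J.OrdConnected) (a b y1 y2 : ℝ) (D' : Set ℝ) (hD : D'.Finite) (hDab : D' ⊆ Set.Icc a b)
    (h1 : a ≤ y1) (h12 : y1 ≤ y2) (h2 : y2 ≤ b)
    (Hb1 : (0:ℝ) ∈ J → 0 < y1 → 0 < a ∨ ∀ p ∈ J, a ≤ p) (Hb2 : (0:ℝ) ∈ J → y2 < 0 → b < 0 ∨ ∀ p ∈ J, p ≤ b) (i : ℕ)
    (hU : (0 < i) ∨ (y1 ∈ D' ∧ y2 ∈ D')) (m : ℕ) (lo hi v : Fin m → ℝ) (hlo : ∀ i, lo i ≤ v i) (hhi : ∀ i, v i ≤ hi i) :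
    EE K (i + m) (BX J m) (box J a b lo hi)ᶜ {x | ¬ ((x.1:ℝ) ∈ D' ∧ x.2 = v)} := by
  induction m with
  | zero =>
    refine EE_homeo (Homeomorph.prodUnique J (Fin 0 → ℝ)).symm ?_
    have := base (K := K) hJ i a b y1 y2 {p | (p:ℝ) ∉ D'} h1 h12 h2 Hb1 Hb2 (hU.imp id fun h p hp => ⟨fun e => hp (e ▸ h.1), fun e => hp (e ▸ h.2)⟩)
    convert this using 1
    · rfl
    · rfl
    · ext p; change ¬ (_ ∧ ∀ i : Fin 0, _) ↔ (p:ℝ) < a ∨ b < p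
      rw [show (∀ i : Fin 0, lo i ≤ _ ∧ _ ≤ hi i) ↔ True from ⟨fun _ => trivial, fun _ i => i.elim0⟩, and_true, not_and_or, not_le, not_le]; rfl
    · ext p; change ¬ (_ ∧ _) ↔ _
      rw [show _ = v ↔ True from ⟨fun _ => trivial, fun _ => Subsingleton.elim _ _⟩, and_true]; rfl
  | succ m ih =>
    have ih := ih (fun i => lo i.succ) (fun i => hi i.succ) (fun i => v i.succ) (fun i => hlo i.succ) (fun i => hhi i.succ)
    refine EE_homeo (XXs J m) ?_
    have := susp (a := lo 0) (b := hi 0) (a' := v 0) (b' := v 0) ?_ ?_ ?_ (hlo 0) le_rfl (hhi 0) ih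
    · convert this using 1
      · rfl
      · rfl
      · ext q
        have h3 : (XXs J m) q ∈ box J a b lo hi ↔ q.1 ∈ box J a b (fun i => lo i.succ) (fun i => hi i.succ) ∧ ¬ (q.2 < lo 0 ∨ hi 0 < q.2) := by
          change ((_ ∧ _) ∧ ∀ i : Fin (m+1), lo i ≤ (Fin.cons q.2 q.1.2 : Fin (m+1) → ℝ) i ∧ (Fin.cons q.2 q.1.2 : Fin (m+1) → ℝ) i ≤ hi i) ↔ ((_ ∧ _) ∧ ∀ i : Fin m, _) ∧ _
          rw [Fin.forall_fin_succ, not_or, not_lt, not_lt]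
          exact ⟨fun h => ⟨⟨h.1, h.2.2⟩, h.2.1⟩, fun h => ⟨h.1.1, h.2, h.1.2⟩⟩
        change ¬ _ ↔ _
        rw [h3, not_and_or, not_not]; rfl
      · ext q
        have h5 : q.2 = v 0 ↔ ¬ (q.2 < v 0 ∨ v 0 < q.2) := by rw [not_or, not_lt, not_lt, le_antisymm_iff, and_comm]
        have h4 : (Fin.cons q.2 q.1.2 : Fin (m+1) → ℝ) = v ↔ q.1.2 = (fun i => v i.succ) ∧ q.2 = v 0 :=
          ⟨fun h => ⟨by ext i; rw [← h]; simp, by rw [← h]; simp⟩, fun h => by ext i; refine Fin.cases ?_ (fun i => ?_) i <;> simp [h]⟩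
        change ¬ (_ ∧ (Fin.cons q.2 q.1.2 : Fin (m+1) → ℝ) = v) ↔ _
        rw [h4, ← and_assoc, h5, not_and_or, not_not]; rfl
    · refine isOpen_compl_iff.2 ?_
      simp only [box, Set.setOf_and, Set.setOf_forall]
      refine ((isClosed_le (by fun_prop) (by fun_prop)).inter (isClosed_le (by fun_prop) (by fun_prop))).inter (isClosed_iInter fun i => (isClosed_le (by fun_prop) (by fun_prop)).inter (isClosed_le (by fun_prop) (by fun_prop)))
    · refine isOpen_compl_iff.2 ((hD.isClosed.preimage (by fun_prop : Continuous fun x : XX J m => (x.1:ℝ))).inter (isClosed_eq continuous_snd continuous_const))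
    · rintro x hx ⟨h3, h4⟩
      exact hx ⟨hDab h3, fun i => by rw [h4]; exact ⟨hlo _, hhi _⟩⟩

def IsBox {J : Set ℝ} {m : ℕ} (A : Set (XX J m)) : Prop := ∃ a b lo hi, A = box J a b lo hi

lemma IsBox.closed {J : Set ℝ} {m : ℕ} {A : Set (XX J m)} (h : IsBox A) : IsClosed A := by
  obtain ⟨a, b, lo, hi, rfl⟩ := h
  simp only [box, Set.setOf_and, Set.setOf_forall]
  exact ((isClosed_le (by fun_prop) (by fun_prop)).inter (isClosed_le (by fun_prop) (by fun_prop))).inter (isClosed_iInter fun i => (isClosed_le (by fun_prop) (by fun_prop)).inter (isClosed_le (by fun_prop) (by fun_prop)))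

lemma IsBox.inter {J : Set ℝ} {m : ℕ} {A A' : Set (XX J m)} (h : IsBox A) (h' : IsBox A') : IsBox (A ∩ A') := by
  obtain ⟨a, b, lo, hi, rfl⟩ := h
  obtain ⟨a', b', lo', hi', rfl⟩ := h'
  refine ⟨max a a', min b b', fun i => max (lo i) (lo' i), fun i => min (hi i) (hi' i), ?_⟩
  ext x; simp only [box, Set.mem_inter_iff, Set.mem_setOf_eq, max_le_iff, le_min_iff]
  constructor
  · rintro ⟨⟨h1, h2⟩, h3, h4⟩; exact ⟨⟨⟨h1.1, h3.1⟩, h1.2, h3.2⟩, fun i => ⟨⟨(h2 i).1, (h4 i).1⟩, (h2 i).2, (h4 i).2⟩⟩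
  · rintro ⟨⟨h1, h2⟩, h3⟩; exact ⟨⟨⟨h1.1, h2.1⟩, fun i => ⟨(h3 i).1.1, (h3 i).2.1⟩⟩, ⟨h1.2, h2.2⟩, fun i => ⟨(h3 i).1.2, (h3 i).2.2⟩⟩

lemma IsBox.T {J : Set ℝ} (hJ : J.OrdConnected) {m : ℕ} {A : Set (XX J m)} (h : IsBox A) (i : ℕ) : EE K (i + 1 + m) (BX J m) Aᶜ Set.univ := by
  obtain ⟨a, b, lo, hi, rfl⟩ := h
  by_cases hab : a ≤ b ∧ ∀ i, lo i ≤ hi i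
  · have := boxE (K := K) hJ a b a b ∅ Set.finite_empty (Set.empty_subset _) le_rfl hab.1 le_rfl (fun _ h => Or.inl h) (fun _ h => Or.inl h) (i+1) (Or.inl (Nat.succ_pos _)) m lo hi lo
      (fun _ => le_rfl) hab.2
    simpa using this
  · have : (box J a b lo hi)ᶜ = Set.univ := by
      rw [Set.compl_univ_iff, Set.eq_empty_iff_forall_notMem]
      rintro x ⟨h1, h2⟩
      exact hab ⟨h1.1.trans h1.2, fun i => (h2 i).1.trans (h2 i).2⟩
    rw [this]; exact EE_univ _ _ _

lemma boxes_T {J : Set ℝ} (hJ : J.OrdConnected) {m : ℕ} (n : ℕ) : ∀ (L : Fin n → Set (XX J m)), (∀ k, IsBox (L k)) →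
    ∀ i, EE K (i + 1 + m) (BX J m) (⋃ k, L k)ᶜ Set.univ := by
  induction n with
  | zero => intro L _ i; simpa using EE_univ _ _ _
  | succ n ih =>
    intro L hL i w h1 _
    have e : (⋃ k, L k) = L 0 ∪ ⋃ k : Fin n, L k.succ := by
      ext x; simp [Fin.exists_fin_succ]
    rw [e] at h1 ⊢
    rw [Set.compl_union] at h1 ⊢
    have c2 : IsClosed (⋃ k : Fin n, L k.succ) := isClosed_iUnion_of_finite fun k => (hL _).closed
    refine MV (hL 0).closed.isOpen_compl c2.isOpen_compl ?_ ((hL 0).T hJ i w (supp_mono (pair_mono Set.inter_subset_left) _ h1) (bd_univ _ _ _))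
      (ih _ (fun k => hL k.succ) i w (supp_mono (pair_mono Set.inter_subset_right) _ h1) (bd_univ _ _ _))
    have := ih (fun k => L 0 ∩ L k.succ) (fun k => (hL 0).inter (hL _)) (i+1)
    rw [← Set.inter_iUnion, Set.compl_inter, show i + 1 + 1 + m = i + 1 + m + 1 by omega] at this
    exact this

lemma isBox_ball {J : Set ℝ} {m : ℕ} (x : XX J m) (r : ℝ) (hr : 0 ≤ r) : IsBox (Metric.closedBall x r) := by
  refine ⟨x.1 - r, x.1 + r, fun i => x.2 i - r, fun i => x.2 i + r, ?_⟩
  ext y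
  rw [Metric.mem_closedBall, Prod.dist_eq, max_le_iff, dist_pi_le_iff hr, Subtype.dist_eq]
  simp only [box, Set.mem_setOf_eq, Real.dist_eq, abs_le]
  refine and_congr ⟨fun h => ⟨by linarith [h.1], by linarith [h.2]⟩, fun h => ⟨by linarith [h.1], by linarith [h.2]⟩⟩
    (forall_congr' fun i => ⟨fun h => ⟨by linarith [h.1], by linarith [h.2]⟩, fun h => ⟨by linarith [h.1], by linarith [h.2]⟩⟩)

lemma cpt_T {J : Set ℝ} (hJ : J.OrdConnected) {m : ℕ} {C : Set (XX J m)} (hC : IsCompact C) (i : ℕ) : EE K (i + 1 + m) (BX J m) Cᶜ Set.univ := by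
  classical
  intro w hw _
  let f := dd w
  have key : ∃ D : Set (XX J m), IsClosed D ∧ Disjoint D C ∧ ∀ V, Disjoint D V → dd w ∈ supp K {BX J m, Vᶜ} (i+1+m) := by
    refine ⟨⋃ σ ∈ f.support.filter (fun σ : SSimplex (XX J m) (i+1+m) => Set.range σ ⊆ Cᶜ), Set.range σ, ?_, ?_, ?_⟩
    · exact isClosed_biUnion_finset fun σ _ => (isCompact_range σ.continuous).isClosed
    · rw [Set.disjoint_left]; intro x hx
      simp only [Set.mem_iUnion, Finset.mem_filter] at hx
      obtain ⟨σ, ⟨-, h⟩, hx⟩ := hx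
      exact h hx
    · intro V hV σ hσ
      obtain ⟨A, rfl | rfl, hA⟩ := hw hσ
      · exact ⟨_, Or.inl rfl, hA⟩
      · refine ⟨_, Or.inr rfl, fun x hx hxV => Set.disjoint_left.1 hV ?_ hxV⟩
        simp only [Set.mem_iUnion, Finset.mem_filter]
        exact ⟨σ, ⟨hσ, hA⟩, hx⟩
  obtain ⟨D, hD, hDC, hV⟩ := key
  have : ∀ x ∈ C, ∃ r > 0, Metric.closedBall x r ⊆ Dᶜ := fun x hx =>
    Metric.nhds_basis_closedBall.mem_iff.1 (hD.isOpen_compl.mem_nhds fun h => Set.disjoint_left.1 hDC h hx)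
  choose! r hr hrD using this
  obtain ⟨t, htC, ht⟩ := hC.elim_nhds_subcover (fun x => Metric.closedBall x (r x)) (fun x hx => Metric.closedBall_mem_nhds x (hr x hx))
  have e : (⋃ k : Fin t.card, Metric.closedBall (t.equivFin.symm k : XX J m) (r (t.equivFin.symm k))) = ⋃ x ∈ t, Metric.closedBall x (r x) := by
    ext y; simp only [Set.mem_iUnion]
    exact ⟨fun ⟨k, h⟩ => ⟨_, (t.equivFin.symm k).2, h⟩, fun ⟨x, hx, h⟩ => ⟨t.equivFin ⟨x, hx⟩, by simpa using h⟩⟩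
  have := boxes_T (K := K) hJ t.card (fun k => Metric.closedBall (t.equivFin.symm k : XX J m) (r (t.equivFin.symm k))) (fun k => isBox_ball _ _ (hr _ (htC _ (t.equivFin.symm k).2)).le) i w
  rw [e] at this
  refine bd_mono (pair_mono (Set.compl_subset_compl.2 ht)) _ (this (hV _ ?_) (bd_univ _ _ _))
  rw [Set.disjoint_left]; intro x hx hx'
  simp only [Set.mem_iUnion] at hx'
  obtain ⟨y, hy, h⟩ := hx'
  exact hrD y (htC y hy) h hx

variable {M : Type} [TopologicalSpace M]

lemma lift_supp {G : C(X, M)} (hG : Topology.IsEmbedding G) {n : ℕ} {w : Ch K M n} (hw : w ∈ supp K {Set.range G} n) : ∃ v : Ch K X n, psh G v = w := by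
  refine supp_le (P := LinearMap.range (psh G)) ?_ hw
  rintro σ ⟨A, rfl, hs⟩
  let τ : SSimplex X n := ⟨fun p => hG.toHomeomorph.symm ⟨σ p, hs ⟨p, rfl⟩⟩, by fun_prop⟩
  refine ⟨single τ 1, ?_⟩
  rw [psh_single]; congr 1; ext p
  change G (hG.toHomeomorph.symm ⟨σ p, hs ⟨p, rfl⟩⟩) = σ p
  have := congrArg Subtype.val (hG.toHomeomorph.apply_symm_apply ⟨σ p, hs ⟨p, rfl⟩⟩)
  exact this

lemma supp_of_psh {G : C(X, M)} (hG : Function.Injective G) {n : ℕ} {B U : Set M} {v : Ch K X n} (h : psh G v ∈ supp K {B, U} n) :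
    v ∈ supp K {G ⁻¹' B, G ⁻¹' U} n := by
  intro σ hσ
  have hi : Function.Injective (fun σ : SSimplex X n => G.comp σ) := fun a b hab => by
    ext p; exact hG (DFunLike.congr_fun hab p)
  have : (psh G v) (G.comp σ) ≠ 0 := by
    rw [psh_apply, Finsupp.mapDomain_apply hi (x := v) (a := σ)]; exact Finsupp.mem_support_iff.1 hσ
  obtain ⟨A, rfl | rfl, hA⟩ := h (Finsupp.mem_support_iff.2 this)
  · refine ⟨_, Or.inl rfl, ?_⟩
    rintro _ ⟨p, rfl⟩; exact hA ⟨p, rfl⟩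
  · refine ⟨_, Or.inr rfl, ?_⟩
    rintro _ ⟨p, rfl⟩; exact hA ⟨p, rfl⟩

lemma exc1 {G : C(X, M)} (hG : Topology.IsOpenEmbedding G) {B U : Set M} (hU : IsOpen U) (hN : Uᶜ ⊆ Set.range G) {i : ℕ} {w : Ch K M (i+1)}
    (hw : dd w ∈ supp K {B, U} i) : ∃ v : Ch K X (i+1), dd v ∈ supp K {G ⁻¹' B, G ⁻¹' U} i ∧ w - psh G v ∈ bd K {B, U} (i+1) ∧
      dd (psh G v) ∈ supp K {B, U} i := by
  have hc : ∀ A ∈ ({Set.univ} : Set (Set M)), (∃ A' ∈ ({Set.range G, U} : Set (Set M)), A ⊆ A') ∨ A ⊆ ⋃₀ {A ∈ ({Set.range G, U} : Set (Set M)) | IsOpen A} := by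
    rintro _ rfl; right; intro x _
    by_cases h : x ∈ U
    · exact ⟨U, ⟨by simp, hU⟩, h⟩
    · exact ⟨_, ⟨Or.inl rfl, hG.isOpen_range⟩, hN h⟩
  obtain ⟨w', hw', e, r, e1, -, hr⟩ := small _ _ hc w (supp_univ _ w)
  obtain ⟨w1, h1, w2, h2, rfl⟩ := supp_two hw'
  obtain ⟨v, rfl⟩ := lift_supp hG.isEmbedding h1
  have mU : ∀ A ∈ ({U} : Set (Set M)), ∃ C ∈ ({B, U} : Set (Set M)), A ⊆ C := by rintro _ rfl; exact ⟨_, Or.inr rfl, le_rfl⟩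
  have h3 : dd (psh G v) ∈ supp K {B, U} i := by
    have : dd (psh G v) = dd w - dd r - dd w2 := by
      have := congrArg dd e1
      rw [map_sub, map_add, map_add, dd_dd, zero_add] at this
      rw [← this]; abel
    rw [this]
    exact Submodule.sub_mem _ (Submodule.sub_mem _ hw (dd_mem_supp (hr _ hw))) (supp_mono mU _ (dd_mem_supp h2))
  refine ⟨v, supp_of_psh hG.injective (by rw [← dd_psh]; exact h3), mem_bd.2 ⟨e, r + w2, Submodule.add_mem _ (hr _ hw) (supp_mono mU _ h2), ?_⟩, h3⟩
  rw [← add_assoc, ← e1]; abel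

lemma exc {G : C(X, M)} (hG : Topology.IsOpenEmbedding G) {B : Set M} {A A' : Set X} (hA : IsClosed (G '' A)) (hAA : A' ⊆ A) {i : ℕ}
    (hE : EE K i (G ⁻¹' B) Aᶜ A'ᶜ) : EE K i B (G '' A)ᶜ (G '' A')ᶜ := by
  intro w hw1 hw2
  have pre : ∀ A : Set X, G ⁻¹' (G '' A)ᶜ = Aᶜ := fun A => by rw [Set.preimage_compl, Set.preimage_image_eq _ hG.injective]
  have hN : ((G '' A)ᶜ)ᶜ ⊆ Set.range G := by rw [compl_compl]; exact Set.image_subset_range _ _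
  have hUU : (G '' A)ᶜ ⊆ (G '' A')ᶜ := Set.compl_subset_compl.2 (Set.image_mono hAA)
  obtain ⟨v, hv1, hv2, -⟩ := exc1 hG hA.isOpen_compl hN hw1
  rw [pre] at hv1
  suffices hv3 : v ∈ bd K {G ⁻¹' B, A'ᶜ} (i+1) by
    obtain ⟨q, s, hs, e⟩ := mem_bd.1 (hE v hv1 hv3)
    have : psh G v ∈ bd K {B, (G '' A)ᶜ} (i+1) := by
      refine mem_bd.2 ⟨psh G q, psh G s, psh_mem_supp _ ?_ hs, by rw [dd_psh, ← map_add, e]⟩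
      rintro C (rfl | rfl)
      · exact ⟨_, Or.inl rfl, fun x hx => hx⟩
      · refine ⟨_, Or.inr rfl, fun x hx => ?_⟩
        rw [← pre] at hx; exact hx
    have := Submodule.add_mem _ hv2 this
    rwa [sub_add_cancel] at this
  have h4 : psh G v ∈ bd K {B, (G '' A')ᶜ} (i+1) := by
    have := Submodule.sub_mem _ hw2 (bd_mono (pair_mono hUU) _ hv2)
    rwa [sub_sub_cancel] at this
  obtain ⟨c, s, hs, e⟩ := mem_bd.1 h4
  have hc : ∀ A1 ∈ ({Set.univ} : Set (Set M)), (∃ A' ∈ ({Set.range G, (G '' A)ᶜ} : Set (Set M)), A1 ⊆ A') ∨ A1 ⊆ ⋃₀ {A' ∈ ({Set.range G, (G '' A)ᶜ} : Set (Set M)) | IsOpen A'} := by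
    rintro _ rfl; right; intro x _
    by_cases h : x ∈ (G '' A)ᶜ
    · exact ⟨_, ⟨by simp, hA.isOpen_compl⟩, h⟩
    · exact ⟨_, ⟨Or.inl rfl, hG.isOpen_range⟩, hN h⟩
  obtain ⟨c', hc', e', r, e1, -, hr⟩ := small _ _ hc c (supp_univ _ c)
  obtain ⟨c1, h1, c2, h2, rfl⟩ := supp_two hc'
  have hv : psh G v ∈ supp K {Set.range G} (i+1) := by
    refine psh_mem_supp (F := {Set.univ}) G ?_ (supp_univ _ v)
    rintro _ rfl; exact ⟨_, rfl, fun x _ => ⟨x, rfl⟩⟩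
  have hr' : r ∈ supp K ({Set.range G} ∪ {B, (G '' A')ᶜ}) (i+2) := by
    refine hr _ ?_
    rw [show dd c = psh G v - s by rw [e]; abel]
    refine Submodule.sub_mem _ (supp_mono ?_ _ hv) (supp_mono ?_ _ hs)
    · rintro D hD; exact ⟨D, Or.inl hD, le_rfl⟩
    · rintro D hD; exact ⟨D, Or.inr hD, le_rfl⟩
  rw [supp_union, Submodule.mem_sup] at hr'
  obtain ⟨r1, hr1, r2, hr2, rfl⟩ := hr'
  obtain ⟨b, hb⟩ := lift_supp hG.isEmbedding (Submodule.add_mem _ h1 hr1)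
  refine mem_bd.2 ⟨b, v - dd b, ?_, by abel⟩
  have := supp_of_psh (G := G) hG.injective (B := B) (U := (G '' A')ᶜ) (v := v - dd b) ?_
  · rwa [pre] at this
  rw [map_sub, ← dd_psh, hb, e]
  have : dd c + s - dd (c1 + r1) = dd c2 + dd r2 + s := by
    have h9 : dd c = dd c1 + dd c2 + (dd r1 + dd r2) := by
      have := congrArg dd (sub_eq_iff_eq_add.1 e1)
      rw [map_add, map_add, map_add, map_add, dd_dd, zero_add] at this
      rw [this]; abel
    rw [h9, map_add]; abel
  rw [this]
  refine Submodule.add_mem _ (Submodule.add_mem _ (supp_mono ?_ _ (dd_mem_supp h2)) (dd_mem_supp hr2)) hs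
  rintro _ rfl; exact ⟨_, Or.inr rfl, hUU⟩

end F5

section F6
variable {K : Type} [CommRing K] {M : Type} [TopologicalSpace M]
open Set

def JT (J : Set ℝ) : Prop := J = Ioo 0 1 ∨ J = Ico 0 1 ∨ J = Ioo (-1) 1

def IsChart (B : Set M) {J : Set ℝ} {m : ℕ} (G : C(XX J m, M)) : Prop := Topology.IsOpenEmbedding G ∧ G ⁻¹' B = BX J m

lemma JT.ord {J : Set ℝ} (h : JT J) : J.OrdConnected := by
  rcases h with rfl | rfl | rfl <;> infer_instance

lemma box_cpt {J : Set ℝ} {m : ℕ} {a b : ℝ} (hab : IsCompact ((↑) ⁻¹' Icc a b : Set J)) (lo hi : Fin m → ℝ) :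
    IsCompact (box J a b lo hi) := by
  have : box J a b lo hi = ((↑) ⁻¹' Icc a b : Set J) ×ˢ Icc lo hi := by
    ext x
    change (_ ∧ ∀ i, _) ↔ _ ∧ (_ ∧ _)
    rw [Pi.le_def, Pi.le_def, ← forall_and]; rfl
  rw [this]; exact hab.prod isCompact_Icc

lemma sub_cpt {J : Set ℝ} {a b : ℝ} {S : Set ℝ} (hS : S ⊆ J) (hSc : IsCompact S) (e : ∀ p ∈ J, a ≤ p ∧ p ≤ b ↔ p ∈ S) : IsCompact ((↑) ⁻¹' Icc a b : Set J) := by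
  have : ((↑) ⁻¹' Icc a b : Set J) = (↑) ⁻¹' S := by ext p; exact e p p.2
  rw [this, Topology.IsInducing.subtypeVal.isCompact_iff, Subtype.image_preimage_coe, inter_eq_right.2 hS]; exact hSc

lemma loc {B : Set M} [T2Space M] {J : Set ℝ} (hJ : JT J) {m : ℕ} {G : C(XX J m, M)} (hG : IsChart B G) {w : Ch K M (m+1)}
    (hw : dd w ∈ supp K {B} m) (hv : ∀ y ∈ range G, y ∉ B → w ∈ bd K {B, {y}ᶜ} (m+1)) (q : XX J m) :
    ∃ A : Set (XX J m), IsCompact A ∧ A ∈ nhds q ∧ w ∈ bd K {B, (G '' A)ᶜ} (m+1) := by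
  have key : ∀ (a b y1 y2 : ℝ) (S : Set ℝ), S ⊆ J → IsCompact S → (∀ p ∈ J, a ≤ p ∧ p ≤ b ↔ p ∈ S) → a < q.1 → q.1 < b → a ≤ y1 → y1 ≤ y2 → y2 ≤ b →
      y1 ∈ J → y2 ∈ J → y1 ≠ 0 → y2 ≠ 0 → ((0:ℝ) ∈ J → 0 < y1 → 0 < a ∨ ∀ p ∈ J, a ≤ p) → ((0:ℝ) ∈ J → y2 < 0 → b < 0 ∨ ∀ p ∈ J, p ≤ b) →
      ∃ A : Set (XX J m), IsCompact A ∧ A ∈ nhds q ∧ w ∈ bd K {B, (G '' A)ᶜ} (m+1) := by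
    intro a b y1 y2 S hS hSc hSe ha hb h1 h12 h2 hy1 hy2 n1 n2 H1 H2
    have hc : IsCompact (box J a b (fun i => q.2 i - 1) (fun i => q.2 i + 1)) := box_cpt (sub_cpt hS hSc hSe) _ _
    refine ⟨_, hc, ?_, ?_⟩
    · refine Filter.mem_of_superset (IsOpen.mem_nhds (s := {x : XX J m | (a < x.1 ∧ x.1 < b) ∧ ∀ i, q.2 i - 1 < x.2 i ∧ x.2 i < q.2 i + 1}) ?_ ?_) ?_
      · simp only [Set.setOf_and, Set.setOf_forall]
        refine ((isOpen_lt (by fun_prop) (by fun_prop)).inter (isOpen_lt (by fun_prop) (by fun_prop))).inter (isOpen_iInter_of_finite fun i => (isOpen_lt (by fun_prop) (by fun_prop)).inter (isOpen_lt (by fun_prop) (by fun_prop)))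
      · exact ⟨⟨ha, hb⟩, fun i => ⟨by linarith, by linarith⟩⟩
      · rintro x ⟨hx, hx'⟩; exact ⟨⟨hx.1.le, hx.2.le⟩, fun i => ⟨(hx' i).1.le, (hx' i).2.le⟩⟩
    · have E0 := boxE (K := K) hJ.ord a b y1 y2 {y1, y2} (toFinite _) (by rintro _ (rfl | rfl); exacts [⟨h1, h12.trans h2⟩, ⟨h1.trans h12, h2⟩]) h1 h12 h2 H1 H2 0 (Or.inr ⟨by simp, by simp⟩) m
        (fun i => q.2 i - 1) (fun i => q.2 i + 1) q.2 (fun i => by linarith) (fun i => by linarith)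
      have e : {x : XX J m | ¬ ((x.1:ℝ) ∈ ({y1, y2} : Set ℝ) ∧ x.2 = q.2)} = ({(⟨y1, hy1⟩, q.2), (⟨y2, hy2⟩, q.2)} : Set (XX J m))ᶜ := by
        ext ⟨x, v⟩
        simp only [mem_setOf_eq, mem_compl_iff, mem_insert_iff, mem_singleton_iff, Prod.mk.injEq, Subtype.ext_iff]
        rw [or_and_right]
      rw [e, zero_add] at E0
      rw [← hG.2] at E0
      have sub : ({(⟨y1, hy1⟩, q.2), (⟨y2, hy2⟩, q.2)} : Set (XX J m)) ⊆ box J a b (fun i => q.2 i - 1) (fun i => q.2 i + 1) := by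
        rintro _ (rfl | rfl)
        · exact ⟨⟨h1, h12.trans h2⟩, fun i => ⟨by simp, by simp⟩⟩
        · exact ⟨⟨h1.trans h12, h2⟩, fun i => ⟨by simp, by simp⟩⟩
      refine exc hG.1 (hc.image G.continuous).isClosed sub E0 w (supp_mono ?_ _ hw) ?_
      · rintro _ rfl; exact ⟨_, Or.inl rfl, le_rfl⟩
      · rw [image_pair, show ∀ u v : M, ({u, v} : Set M)ᶜ = {u}ᶜ ∩ {v}ᶜ from fun u v => by rw [insert_eq, compl_union]]
        have nb : ∀ y (hy : y ∈ J), y ≠ 0 → G (⟨y, hy⟩, q.2) ∉ B := fun y hy h0 hB => by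
          have : ((⟨y, hy⟩, q.2) : XX J m) ∈ BX J m := hG.2 ▸ hB
          exact h0 this
        have w1 := hv _ ⟨_, rfl⟩ (nb y1 hy1 n1)
        have w2 := hv _ ⟨_, rfl⟩ (nb y2 hy2 n2)
        by_cases hyy : y1 = y2
        · subst hyy; rwa [inter_self]
        · refine MV isOpen_compl_singleton isOpen_compl_singleton ?_ w1 w2
          have : ({G (⟨y1, hy1⟩, q.2)} : Set M)ᶜ ∪ {G (⟨y2, hy2⟩, q.2)}ᶜ = univ := by
            rw [← compl_inter, singleton_inter_eq_empty.2, compl_empty]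
            intro h; exact hyy (by simpa using hG.1.injective h)
          rw [this]; exact EE_univ _ _ _
  obtain ⟨⟨p, hp⟩, v⟩ := q
  rcases hJ with rfl | rfl | rfl
  · refine key (p/2) ((p+1)/2) p p (Icc (p/2) ((p+1)/2)) ?_ isCompact_Icc (fun _ _ => Iff.rfl) ?_ ?_ ?_ le_rfl ?_ hp hp hp.1.ne' hp.1.ne' (fun h => absurd h.1 (lt_irrefl _)) (fun h => absurd h.1 (lt_irrefl _))
    · rintro x ⟨h1, h2⟩; exact ⟨by linarith [hp.1], by linarith [hp.2]⟩
    all_goals linarith [hp.1, hp.2]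
  · refine key (-1) ((p+1)/2) ((p+1)/2) ((p+1)/2) (Icc 0 ((p+1)/2)) ?_ isCompact_Icc (fun x hx => ⟨fun h => ⟨hx.1, h.2⟩, fun h => ⟨by linarith [h.1], h.2⟩⟩) ?_ ?_ ?_ le_rfl ?_ ⟨?_, ?_⟩ ⟨?_, ?_⟩ ?_ ?_ (fun _ _ => Or.inr fun x hx => by linarith [hx.1]) (fun _ h => ?_)
    · rintro x ⟨h1, h2⟩; exact ⟨h1, by linarith [hp.2]⟩
    all_goals first | (apply ne_of_gt; linarith [hp.1, hp.2]) | linarith [hp.1, hp.2]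
  · have hm := hp.1; have hm2 := hp.2
    have i1 := min_le_left p 0; have i2 := min_le_right p 0; have i3 := le_max_left p 0; have i4 := le_max_right p 0
    have i5 : -1 < min p 0 := lt_min hm (by norm_num)
    have i6 : max p 0 < 1 := max_lt hm2 (by norm_num)
    refine key ((min p 0 - 1)/2) ((max p 0 + 1)/2) ((min p 0 - 1)/2) ((max p 0 + 1)/2) (Icc ((min p 0 - 1)/2) ((max p 0 + 1)/2)) ?_ isCompact_Icc (fun _ _ => Iff.rfl) ?_ ?_ le_rfl ?_ le_rfl ⟨?_, ?_⟩ ⟨?_, ?_⟩ ?_ ?_ (fun _ h => ?_) (fun _ h => ?_)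
    · rintro x ⟨h1, h2⟩; exact ⟨by linarith, by linarith⟩
    all_goals first | (apply ne_of_gt; linarith) | (apply ne_of_lt; linarith) | linarith | (exfalso; linarith)

lemma glob {B : Set M} [T2Space M] [CompactSpace M] {m : ℕ} (hM : ∀ x : M, ∃ J, JT J ∧ ∃ G : C(XX J m, M), IsChart B G ∧ x ∈ range G) {w : Ch K M (m+1)}
    (hw : dd w ∈ supp K {B} m) (hv : ∀ y ∉ B, w ∈ bd K {B, {y}ᶜ} (m+1)) : w ∈ bd K {B} (m+1) := by
  have h1 : ∀ x : M, ∃ S : Set M, S ∈ nhds x ∧ IsCompact S ∧ w ∈ bd K {B, Sᶜ} (m+1) ∧ ∀ S' ⊆ S, IsCompact S' → EE K (m+1) B S'ᶜ univ := by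
    intro x
    obtain ⟨J, hJ, G, hG, q, rfl⟩ := hM x
    obtain ⟨A, hA, hAq, hwA⟩ := loc hJ hG hw (fun y _ h => hv y h) q
    refine ⟨G '' A, hG.1.isOpenMap.image_mem_nhds hAq, hA.image G.continuous, hwA, fun S' hS hS' => ?_⟩
    have := cpt_T (K := K) hJ.ord (m := m) (C := G ⁻¹' S') ?_ 0
    · have h2 := exc hG.1 (B := B) (A := G ⁻¹' S') (A' := ∅) (i := 0 + 1 + m) (K := K)
      rw [image_empty, compl_empty, compl_empty, image_preimage_eq_of_subset (hS.trans (image_subset_range _ _)), hG.2] at h2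
      have h3 := h2 hS'.isClosed (empty_subset _) this
      rwa [zero_add, add_comm] at h3
    · refine (hG.1.isEmbedding.isInducing.isCompact_iff).2 ?_
      rwa [image_preimage_eq_of_subset (hS.trans (image_subset_range _ _))]
  choose S hS1 hS2 hS3 hS4 using h1
  obtain ⟨t, ht⟩ := isCompact_univ.elim_nhds_subcover S (fun x _ => hS1 x)
  have h2 : ∀ t : Finset M, IsCompact (⋃ x ∈ t, S x) ∧ w ∈ bd K {B, (⋃ x ∈ t, S x)ᶜ} (m+1) := by
    intro t
    classical
    induction t using Finset.induction_on with
    | empty => simp only [Finset.notMem_empty, iUnion_false, iUnion_empty, compl_empty]; exact ⟨isCompact_empty, bd_univ _ _ _⟩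
    | insert a s _ ih =>
      rw [Finset.set_biUnion_insert]
      refine ⟨(hS2 a).union ih.1, ?_⟩
      rw [compl_union]
      refine MV (hS2 a).isClosed.isOpen_compl ih.1.isClosed.isOpen_compl ?_ (hS3 a) ih.2
      rw [← compl_inter]
      exact hS4 a _ inter_subset_left ((hS2 a).inter ih.1)
  have h3 := (h2 t).2
  rw [eq_univ_of_univ_subset ht.2, compl_univ] at h3
  refine bd_mono ?_ _ h3
  rintro _ (rfl | rfl)
  · exact ⟨_, rfl, le_rfl⟩
  · exact ⟨B, rfl, empty_subset _⟩

lemma van_loc {B : Set M} [T2Space M] {m : ℕ} {G : C(XX (Ioo 0 1) m, M)} (hG : Topology.IsOpenEmbedding G) (hGB : range G ∩ B = ∅) {w : Ch K M (m+1)}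
    (hw : dd w ∈ supp K {B} m) {y y' : M} (hy : y ∈ range G) (hy' : y' ∈ range G) (h : w ∈ bd K {B, {y}ᶜ} (m+1)) : w ∈ bd K {B, {y'}ᶜ} (m+1) := by
  obtain ⟨q, rfl⟩ := hy; obtain ⟨q', rfl⟩ := hy'
  have hGB' : G ⁻¹' B = BX (Ioo 0 1) m := by
    ext x
    exact ⟨fun hx => (hGB.subset ⟨⟨x, rfl⟩, hx⟩ : G x ∈ (∅ : Set M)).elim, fun hx => absurd hx x.1.2.1.ne'⟩
  have E0 := boxE (K := K) (J := Ioo 0 1) inferInstance (min q.1 q'.1) (max q.1 q'.1) q.1 q.1 {(q.1:ℝ)} (toFinite _) (by rintro _ rfl; exact ⟨min_le_left _ _, le_max_left _ _⟩) (min_le_left _ _) le_rfl (le_max_left _ _)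
    (fun h => absurd h.1 (lt_irrefl _)) (fun h => absurd h.1 (lt_irrefl _)) 0 (Or.inr ⟨rfl, rfl⟩) m (fun i => min (q.2 i) (q'.2 i)) (fun i => max (q.2 i) (q'.2 i)) q.2 (fun i => min_le_left _ _) (fun i => le_max_left _ _)
  have e : {x : XX (Ioo 0 1) m | ¬ ((x.1:ℝ) ∈ ({(q.1:ℝ)} : Set ℝ) ∧ x.2 = q.2)} = ({q} : Set _)ᶜ := by
    ext x
    simp only [mem_setOf_eq, mem_compl_iff, mem_singleton_iff, Prod.ext_iff, Subtype.ext_iff]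
  rw [e, zero_add, ← hGB'] at E0
  have hc : IsCompact (box (Ioo 0 1) (min q.1 q'.1 : ℝ) (max q.1 q'.1) (fun i => min (q.2 i) (q'.2 i)) (fun i => max (q.2 i) (q'.2 i))) := by
    refine box_cpt (sub_cpt (S := Icc (min q.1 q'.1 : ℝ) (max q.1 q'.1)) ?_ isCompact_Icc fun _ _ => Iff.rfl) _ _
    rintro x ⟨h1, h2⟩; exact ⟨(lt_min q.1.2.1 q'.1.2.1).trans_le h1, h2.trans_lt (max_lt q.1.2.2 q'.1.2.2)⟩
  have := exc hG (hc.image G.continuous).isClosed (singleton_subset_iff.2 (show q ∈ box _ _ _ _ _ from ⟨⟨min_le_left _ _, le_max_left _ _⟩, fun i => ⟨min_le_left _ _, le_max_left _ _⟩⟩)) E0 w (supp_mono (by rintro _ rfl; exact ⟨_, Or.inl rfl, le_rfl⟩) _ hw) (by rwa [image_singleton])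
  refine bd_mono (pair_mono (compl_subset_compl.2 (singleton_subset_iff.2 (mem_image_of_mem G ?_)))) _ this
  exact ⟨⟨min_le_right _ _, le_max_right _ _⟩, fun i => ⟨min_le_right _ _, le_max_right _ _⟩⟩

lemma conn_prop {N : Type} [TopologicalSpace N] [PreconnectedSpace N] {I : Set N} (hI : Dense I) (V : N → Prop)
    (h : ∀ p, ∃ O ∈ nhds p, ∀ y ∈ O, y ∈ I → ∀ y' ∈ O, y' ∈ I → V y → V y') {y0 : N} (h0 : y0 ∈ I) (hV : V y0) : ∀ y ∈ I, V y := by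
  let S : Set N := {p | ∀ᶠ y in nhds p, y ∈ I → V y}
  have hS : IsClopen S := by
    refine ⟨⟨isOpen_iff_mem_nhds.2 fun p hp => ?_⟩, isOpen_iff_mem_nhds.2 fun p hp => eventually_eventually_nhds.2 hp⟩
    obtain ⟨O, hO, hc⟩ := h p
    have hf : ∀ y ∈ O, y ∈ I → ¬ V y := fun y hy hyI hVy => hp (Filter.mem_of_superset hO fun y' hy' hyI' => hc y hy hyI y' hy' hyI' hVy)
    filter_upwards [eventually_mem_nhds_iff.2 hO] with p' hp' hp'S
    obtain ⟨y, hy1, hy2⟩ := hI.inter_nhds_nonempty (Filter.inter_mem hp' hp'S)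
    exact hf y hy2.1 hy1 (hy2.2 hy1)
  have : S = univ := hS.eq_univ ⟨y0, by
    obtain ⟨O, hO, hc⟩ := h y0
    exact Filter.mem_of_superset hO fun y hy hyI => hc y0 (mem_of_mem_nhds hO) h0 y hy hyI hV⟩
  intro y hy
  exact (mem_of_mem_nhds (this ▸ mem_univ y : y ∈ S) : y ∈ I → V y) hy

end F6

section F7
variable {V : Type} [Fintype V] [DecidableEq V] {Z Z' : Type} [TopologicalSpace Z] [TopologicalSpace Z']
open Set

def sp (y : V → ℝ) : Finset V := Finset.univ.filter (fun v => y v ≠ 0)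
def ΔF (A : Finset V) : Set (V → ℝ) := {y | y ∈ stdSimplex ℝ V ∧ sp y ⊆ A}
def mj (j : ℕ) (y : V → ℝ) : ℝ := (Finset.univ.filter (fun T : Finset V => T.card ≤ j)).inf' ⟨∅, by simp⟩ (fun T => ∑ v ∈ Tᶜ, y v)
def cc (j : ℕ) (y : V → ℝ) (t : ℝ) : ℝ := min (mj j y) (cl t / (2 * Fintype.card V))
def yy (j : ℕ) (y : V → ℝ) (t : ℝ) : V → ℝ := fun v => max (y v - cc j y t) 0 / ∑ w, max (y w - cc j y t) 0
def tt (j : ℕ) (y : V → ℝ) (t : ℝ) : ℝ := cl t - 2 * Fintype.card V * cc j y t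

lemma mem_sp {y : V → ℝ} {v : V} : v ∈ sp y ↔ y v ≠ 0 := by simp [sp]

lemma mj_cont (j : ℕ) : Continuous (mj j : (V → ℝ) → ℝ) := by
  unfold mj
  exact Continuous.finset_inf'_apply _ fun T _ => by fun_prop

lemma mj_nonneg {j : ℕ} {y : V → ℝ} (hy : y ∈ stdSimplex ℝ V) : 0 ≤ mj j y :=
  Finset.le_inf' _ _ fun T _ => Finset.sum_nonneg fun v _ => hy.1 v

lemma mj_zero {j : ℕ} {y : V → ℝ} (hy : y ∈ stdSimplex ℝ V) (h : (sp y).card ≤ j) : mj j y = 0 := by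
  refine le_antisymm ?_ (mj_nonneg hy)
  refine (Finset.inf'_le (b := sp y) _ (by simpa using h)).trans (Finset.sum_eq_zero fun v hv => ?_).le
  by_contra h'; exact (Finset.mem_compl.1 hv) (mem_sp.2 h')

lemma cardV_pos {y : V → ℝ} (hy : y ∈ stdSimplex ℝ V) : (0:ℝ) < Fintype.card V := by
  rcases isEmpty_or_nonempty V with h | h
  · have := hy.2; simp at this
  · exact_mod_cast Fintype.card_pos

lemma cc_nonneg {j : ℕ} {y : V → ℝ} (hy : y ∈ stdSimplex ℝ V) (t : ℝ) : 0 ≤ cc j y t :=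
  le_min (mj_nonneg hy) (div_nonneg (cl_mem t).1 (by positivity))

lemma cc_le {j : ℕ} {y : V → ℝ} (hy : y ∈ stdSimplex ℝ V) (t : ℝ) : 2 * Fintype.card V * cc j y t ≤ cl t := by
  have := min_le_right (mj j y) (cl t / (2 * Fintype.card V))
  have h := cardV_pos hy
  rw [le_div_iff₀ (by positivity)] at this
  unfold cc; linarith

lemma den_pos {j : ℕ} {y : V → ℝ} (hy : y ∈ stdSimplex ℝ V) (t : ℝ) : 0 < ∑ w, max (y w - cc j y t) 0 := by
  have h1 : ∑ w, (y w - cc j y t) ≤ ∑ w, max (y w - cc j y t) 0 := Finset.sum_le_sum fun w _ => le_max_left _ _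
  rw [Finset.sum_sub_distrib, hy.2, Finset.sum_const, Finset.card_univ, nsmul_eq_mul] at h1
  have := cc_le (j := j) hy t
  linarith [(cl_mem t).2]

lemma yy_mem {j : ℕ} {y : V → ℝ} (hy : y ∈ stdSimplex ℝ V) (t : ℝ) : yy j y t ∈ stdSimplex ℝ V := by
  refine ⟨fun v => div_nonneg (le_max_right _ _) (den_pos hy t).le, ?_⟩
  unfold yy
  rw [← Finset.sum_div, div_self (den_pos hy t).ne']

lemma sp_yy {j : ℕ} {y : V → ℝ} (hy : y ∈ stdSimplex ℝ V) (t : ℝ) : sp (yy j y t) ⊆ sp y := by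
  intro v hv
  rw [mem_sp] at hv ⊢
  intro h
  apply hv
  unfold yy
  rw [h, max_eq_right (by linarith [cc_nonneg (j := j) hy t]), zero_div]

lemma yy_F {j : ℕ} {A : Finset V} {y : V → ℝ} (hy : y ∈ ΔF A) (t : ℝ) : yy j y t ∈ ΔF A := ⟨yy_mem hy.1 t, (sp_yy hy.1 t).trans hy.2⟩

lemma yy_c0 {j : ℕ} {y : V → ℝ} (hy : y ∈ stdSimplex ℝ V) {t : ℝ} (h : cc j y t = 0) : yy j y t = y ∧ tt j y t = cl t := by
  constructor
  · ext v
    unfold yy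
    simp only [h, sub_zero]
    rw [max_eq_left (hy.1 v), Finset.sum_congr rfl (fun w _ => max_eq_left (hy.1 w)), hy.2, div_one]
  · unfold tt; rw [h, mul_zero, sub_zero]

lemma yy_small {j : ℕ} {y : V → ℝ} (hy : y ∈ stdSimplex ℝ V) (h : (sp y).card ≤ j) (t : ℝ) : yy j y t = y ∧ tt j y t = cl t := by
  refine yy_c0 hy (le_antisymm ?_ (cc_nonneg hy t))
  rw [← mj_zero hy h]; exact min_le_left _ _

lemma yy_zero {j : ℕ} {y : V → ℝ} (hy : y ∈ stdSimplex ℝ V) : yy j y 0 = y ∧ tt j y 0 = 0 := by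
  have := yy_c0 (j := j) (t := 0) hy (le_antisymm ?_ (cc_nonneg hy 0))
  · rwa [cl_zero] at this
  · refine (min_le_right _ _).trans ?_
    rw [cl_zero, zero_div]

lemma tt_or {j : ℕ} {y : V → ℝ} (hy : y ∈ stdSimplex ℝ V) (t : ℝ) : tt j y t = 0 ∨ (sp (yy j y t)).card ≤ j := by
  have hN := cardV_pos hy
  rcases le_total (cl t / (2 * Fintype.card V)) (mj j y) with h | h
  · left; unfold tt cc; rw [min_eq_right h]; field_simp; ring
  · right
    have hc : cc j y t = mj j y := min_eq_left h
    obtain ⟨T, hT, e⟩ := Finset.exists_mem_eq_inf' (s := Finset.univ.filter (fun T : Finset V => T.card ≤ j)) ⟨∅, by simp⟩ (fun T => ∑ v ∈ Tᶜ, y v)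
    refine le_trans (Finset.card_le_card fun v hv => ?_) (Finset.mem_filter.1 hT).2
    by_contra hvT
    rw [mem_sp] at hv
    apply hv
    unfold yy
    rw [max_eq_right, zero_div]
    rw [hc, sub_nonpos]
    unfold mj; rw [e]
    exact Finset.single_le_sum (fun w _ => hy.1 w) (Finset.mem_compl.2 hvT)

lemma cc_cont (j : ℕ) : Continuous (fun p : (V → ℝ) × ℝ => cc j p.1 p.2) := by
  unfold cc
  exact ((mj_cont j).comp continuous_fst).min ((cl_cont.comp continuous_snd).div_const _)

lemma tt_cont (j : ℕ) : Continuous (fun p : (V → ℝ) × ℝ => tt j p.1 p.2) := by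
  unfold tt
  exact (cl_cont.comp continuous_snd).sub (continuous_const.mul (cc_cont j))

lemma yy_cont (j : ℕ) (A : Finset V) : Continuous (fun p : ΔF A × ℝ => yy j p.1.1 p.2) := by
  have hc : Continuous (fun p : ΔF A × ℝ => cc j p.1.1 p.2) := (cc_cont j).comp (by fun_prop : Continuous fun p : ΔF A × ℝ => (p.1.1, p.2))
  have hv : ∀ w, Continuous fun p : ΔF A × ℝ => max (p.1.1 w - cc j p.1.1 p.2) 0 := fun w =>
    (Continuous.sub ((continuous_apply w).comp (continuous_subtype_val.comp continuous_fst)) hc).max continuous_const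
  exact continuous_pi fun v => (hv v).div (continuous_finset_sum _ fun w _ => hv w) fun p => (den_pos p.1.2.1 p.2).ne'

def inc {A' A : Finset V} (h : A' ⊆ A) : C(ΔF A', ΔF A) := ⟨fun y => ⟨y.1, y.2.1, y.2.2.trans h⟩, by fun_prop⟩

lemma sp_closed (T : Finset V) : IsClosed {y : V → ℝ | sp y ⊆ T} := by
  have : {y : V → ℝ | sp y ⊆ T} = ⋂ v ∈ Tᶜ, {y : V → ℝ | y v = 0} := by
    ext y
    simp only [mem_setOf_eq, mem_iInter, Finset.subset_iff, mem_sp, Finset.mem_compl]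
    exact ⟨fun h v hv => by_contra fun h' => hv (h h'), fun h v hv => by_contra fun h' => hv (h v h')⟩
  rw [this]
  exact isClosed_biInter fun v _ => isClosed_eq (by fun_prop) (by fun_prop)

instance (A : Finset V) : CompactSpace (ΔF A) := by
  refine isCompact_iff_compactSpace.1 ?_
  exact (isCompact_stdSimplex (𝕜 := ℝ) V).inter_right (sp_closed A)

structure Dat (j : ℕ) {A : Finset V} (σ : C(ΔF A, Z)) (G : ∀ A', A' ⊆ A → C(ΔF A' × ℝ, Z)) : Prop where
  zero : ∀ A' h (y : ΔF A'), A'.card ≤ j → G A' h (y, 0) = σ (inc h y)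
  stat : ∀ A' h (y : ΔF A') t, A'.card ≤ j → (sp y.1).card < j → G A' h (y, t) = σ (inc h y)

open Classical in
def extF (j : ℕ) {A : Finset V} (σ : C(ΔF A, Z)) (G : ∀ A', A' ⊆ A → C(ΔF A' × ℝ, Z)) (p : ΔF A × ℝ) : Z :=
  if (sp (yy j p.1.1 p.2)).card ≤ j then G _ (yy_F p.1.2 p.2).2 (⟨yy j p.1.1 p.2, (yy_F p.1.2 p.2).1, le_rfl⟩, tt j p.1.1 p.2)
  else σ ⟨yy j p.1.1 p.2, yy_F p.1.2 p.2⟩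

lemma extF_T {j : ℕ} {A : Finset V} {σ : C(ΔF A, Z)} {G : ∀ A', A' ⊆ A → C(ΔF A' × ℝ, Z)} (D : Dat j σ G) {T : Finset V} (hT : T ⊆ A) (hTj : T.card ≤ j)
    (p : ΔF A × ℝ) (hp : sp (yy j p.1.1 p.2) ⊆ T) : extF j σ G p = G T hT (⟨yy j p.1.1 p.2, (yy_F p.1.2 p.2).1, hp⟩, tt j p.1.1 p.2) := by
  have hc : (sp (yy j p.1.1 p.2)).card ≤ j := (Finset.card_le_card hp).trans hTj
  rw [extF, if_pos hc]
  rcases hc.lt_or_eq with h | h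
  · rw [D.stat _ _ _ _ hc h, D.stat _ _ _ _ hTj h]; rfl
  · have := Finset.eq_of_subset_of_card_le hp (by omega)
    subst this; rfl

lemma extF_0 {j : ℕ} {A : Finset V} {σ : C(ΔF A, Z)} {G : ∀ A', A' ⊆ A → C(ΔF A' × ℝ, Z)} (D : Dat j σ G)
    (p : ΔF A × ℝ) (hp : tt j p.1.1 p.2 = 0) : extF j σ G p = σ ⟨yy j p.1.1 p.2, yy_F p.1.2 p.2⟩ := by
  unfold extF
  split_ifs with h
  · rw [hp, D.zero _ _ _ h]; rfl
  · rfl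

lemma extF_cont {j : ℕ} {A : Finset V} {σ : C(ΔF A, Z)} {G : ∀ A', A' ⊆ A → C(ΔF A' × ℝ, Z)} (D : Dat j σ G) : Continuous (extF j σ G) := by
  have ct : Continuous (fun p : ΔF A × ℝ => tt j p.1.1 p.2) := (tt_cont j).comp (by fun_prop : Continuous fun p : ΔF A × ℝ => (p.1.1, p.2))
  have cy := yy_cont j A
  let F : Option {T : Finset V // T ⊆ A ∧ T.card ≤ j} → Set (ΔF A × ℝ) := fun o => match o with
    | none => {p | tt j p.1.1 p.2 = 0}
    | some T => {p | sp (yy j p.1.1 p.2) ⊆ T.1}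
  refine (locallyFinite_of_finite F).continuous ?_ ?_ ?_
  · refine eq_univ_of_forall fun p => mem_iUnion.2 ?_
    rcases tt_or (j := j) p.1.2.1 p.2 with h | h
    · exact ⟨none, h⟩
    · exact ⟨some ⟨_, (yy_F p.1.2 p.2).2, h⟩, Finset.Subset.refl _⟩
  · rintro (_ | T)
    · exact isClosed_eq ct continuous_const
    · exact (sp_closed T.1).preimage cy
  · rintro (_ | T)
    · rw [continuousOn_iff_continuous_restrict]
      have : Continuous fun p : F none => σ ⟨yy j p.1.1.1 p.1.2, yy_F p.1.1.2 p.1.2⟩ := σ.continuous.comp (Continuous.subtype_mk (cy.comp continuous_subtype_val) _)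
      refine this.congr fun p => (extF_0 D p.1 p.2).symm
    · rw [continuousOn_iff_continuous_restrict]
      have : Continuous fun p : F (some T) => G T.1 T.2.1 (⟨yy j p.1.1.1 p.1.2, (yy_F p.1.1.2 p.1.2).1, p.2⟩, tt j p.1.1.1 p.1.2) :=
        (G T.1 T.2.1).continuous.comp (Continuous.prodMk (Continuous.subtype_mk (cy.comp continuous_subtype_val) _) (ct.comp continuous_subtype_val))
      refine this.congr fun p => (extF_T D T.2.1 T.2.2 p.1 p.2).symm

lemma extF_start {j : ℕ} {A : Finset V} {σ : C(ΔF A, Z)} {G : ∀ A', A' ⊆ A → C(ΔF A' × ℝ, Z)} (D : Dat j σ G) (y : ΔF A) : extF j σ G (y, 0) = σ y := by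
  have h := yy_zero (j := j) y.2.1
  rw [extF_0 D _ h.2]; congr 1; exact Subtype.ext h.1

lemma extF_face {j : ℕ} {A : Finset V} {σ : C(ΔF A, Z)} {G : ∀ A', A' ⊆ A → C(ΔF A' × ℝ, Z)} (D : Dat j σ G) {T : Finset V} (hT : T ⊆ A) (hTj : T.card ≤ j)
    (y : ΔF T) (t : ℝ) : extF j σ G (inc hT y, t) = G T hT (y, cl t) := by
  have h := yy_small (j := j) y.2.1 ((Finset.card_le_card y.2.2).trans hTj) t
  rw [extF_T D hT hTj (inc hT y, t) (by change sp (yy j y.1 t) ⊆ T; rw [h.1]; exact y.2.2)]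
  congr 2
  · exact Subtype.ext h.1
  · exact h.2

lemma extF_stat {j : ℕ} {A : Finset V} {σ : C(ΔF A, Z)} {G : ∀ A', A' ⊆ A → C(ΔF A' × ℝ, Z)} (D : Dat j σ G) (y : ΔF A) (hy : (sp y.1).card < j) (t : ℝ) :
    extF j σ G (y, t) = σ y := by
  have := extF_face D y.2.2 hy.le ⟨y.1, y.2.1, le_rfl⟩ t
  rw [D.stat _ _ _ _ hy.le hy] at this
  exact this

lemma extF_mem {j : ℕ} {A : Finset V} {σ : C(ΔF A, Z)} {G : ∀ A', A' ⊆ A → C(ΔF A' × ℝ, Z)} {W : Set Z} (hσ : ∀ y, σ y ∈ W) (hG : ∀ A' h p, G A' h p ∈ W) (p) :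
    extF j σ G p ∈ W := by
  unfold extF; split_ifs
  · exact hG _ _ _
  · exact hσ _

end F7

section F8
open Set Filter
def Bd {G : Type} (f : G → ℝ) (C : ℝ) : Prop := ∀ g, |f g| ≤ C
def HasMean (G : Type) [Group G] : Prop := ∃ m : (G → ℝ) →ₗ[ℝ] ℝ, (∀ f C, Bd f C → |m f| ≤ C) ∧ m (fun _ => 1) = 1 ∧
  ∀ h f C, Bd f C → m (fun g => f (h * g)) = m f

lemma ext_lin {G : Type} (Φ : (G → ℝ) → ℝ) (h : ∀ (c : ℝ) f g C C', Bd f C → Bd g C' → Φ (c • f + g) = c * Φ f + Φ g) :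
    ∃ m : (G → ℝ) →ₗ[ℝ] ℝ, ∀ f C, Bd f C → m f = Φ f := by
  have hz : Bd (0 : G → ℝ) 0 := fun g => by simp
  have h0 : Φ 0 = 0 := by have := h 1 0 0 0 0 hz hz; simp at this; linarith
  let S : Submodule ℝ (G → ℝ) :=
    { carrier := {f | ∃ C, Bd f C}
      zero_mem' := ⟨0, hz⟩
      add_mem' := fun {a b} ⟨C, ha⟩ ⟨C', hb⟩ => ⟨C + C', fun g => (abs_add_le _ _).trans (add_le_add (ha g) (hb g))⟩
      smul_mem' := fun c a ⟨C, ha⟩ => ⟨|c| * C, fun g => by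
        simp only [Pi.smul_apply, smul_eq_mul, abs_mul]; exact mul_le_mul_of_nonneg_left (ha g) (abs_nonneg c)⟩ }
  let m0 : S →ₗ[ℝ] ℝ :=
    { toFun := fun f => Φ f.1
      map_add' := fun ⟨a, C, ha⟩ ⟨b, C', hb⟩ => by have := h 1 a b C C' ha hb; simpa using this
      map_smul' := fun c ⟨a, C, ha⟩ => by have := h c a 0 C 0 ha hz; simpa [h0] using this }
  obtain ⟨m, hm⟩ := m0.exists_extend
  exact ⟨m, fun f C hf => DFunLike.congr_fun hm ⟨f, C, hf⟩⟩

lemma ulim {ι : Type} (𝓕 : Filter ι) [NeBot 𝓕] : ∃ L : (ι → ℝ) →ₗ[ℝ] ℝ, (∀ u C D, Bd u D → (∀ᶠ i in 𝓕, |u i| ≤ C) → |L u| ≤ C) ∧ L (fun _ => 1) = 1 := by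
  let U := Ultrafilter.of 𝓕
  have hlim : ∀ u : ι → ℝ, ∃ x, ∀ C, Bd u C → Tendsto u U (nhds x) := by
    intro u
    by_cases h : ∃ C, Bd u C
    · obtain ⟨C, hC⟩ := h
      obtain ⟨x, -, hx⟩ := isCompact_iff_ultrafilter_le_nhds.1 (isCompact_Icc (a := -C) (b := C)) (U.map u)
        (le_principal_iff.2 (Filter.mem_map.2 (Filter.univ_mem' fun i => abs_le.1 (hC i))))
      exact ⟨x, fun _ _ => hx⟩
    · exact ⟨0, fun C hC => (h ⟨C, hC⟩).elim⟩
  choose Φ hΦ using hlim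
  obtain ⟨L, hL⟩ := ext_lin Φ (fun c f g C C' hf hg => by
    have h1 := ((hΦ f C hf).const_mul c).add (hΦ g C' hg)
    refine tendsto_nhds_unique (hΦ (c • f + g) (|c| * C + C') fun i => ?_) h1
    refine (abs_add_le _ _).trans (add_le_add ?_ (hg i))
    simp only [Pi.smul_apply, smul_eq_mul, abs_mul]; exact mul_le_mul_of_nonneg_left (hf i) (abs_nonneg c))
  refine ⟨L, fun u C D hD hu => ?_, ?_⟩
  · rw [hL u D hD]
    exact le_of_tendsto (hΦ u D hD).abs (Ultrafilter.of_le 𝓕 hu)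
  · rw [hL _ 1 fun i => by simp]
    exact tendsto_nhds_unique (hΦ (fun _ => 1) 1 fun i => by simp) tendsto_const_nhds

open MeasureTheory in
lemma IsAmenable.hasMean {G : Type} [Group G] (h : IsAmenable G) : HasMean G := by
  obtain ⟨m, m0, m1, ma, mi⟩ := h
  letI : MeasurableSpace G := ⊤
  let T : Set G → ℝ →L[ℝ] ℝ := fun A => m A • ContinuousLinearMap.id ℝ ℝ
  have hT : FinMeasAdditive (0 : Measure G) T := fun s t _ _ _ _ hd => by simp only [T, ma s t hd, add_smul]
  have hint : ∀ f : SimpleFunc G ℝ, Integrable f (0 : Measure G) := fun f => integrable_zero_measure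
  let I : SimpleFunc G ℝ → ℝ := fun s => s.setToSimpleFunc T
  have hadd : ∀ f g, I (f + g) = I f + I g := fun f g => SimpleFunc.setToSimpleFunc_add T hT (hint f) (hint g)
  have hsm : ∀ (c : ℝ) f, I (c • f) = c * I f := fun c f => SimpleFunc.setToSimpleFunc_smul_real T hT c (hint f)
  have hpos : ∀ f, 0 ≤ f → 0 ≤ I f := fun f hf => SimpleFunc.setToSimpleFunc_nonneg T (fun s x hx => by
    simp only [T, ContinuousLinearMap.smul_apply, ContinuousLinearMap.id_apply, smul_eq_mul]; exact mul_nonneg (m0 s) hx) f hf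
  have hc : ∀ c, I (SimpleFunc.const G c) = c := fun c => by
    simp only [I]; rw [SimpleFunc.setToSimpleFunc_const T (by have := ma ∅ ∅ (by simp); simp only [union_empty] at this; simp only [T]; rw [show m ∅ = 0 by linarith, zero_smul])]
    simp [T, m1]
  have hbd : ∀ (f : SimpleFunc G ℝ) C, Bd f C → |I f| ≤ C := fun f C hf => by
    have h1 := hpos (SimpleFunc.const G C + f) fun g => by have := abs_le.1 (hf g); simp; linarith
    have h2 := hpos (SimpleFunc.const G C + (-1:ℝ) • f) fun g => by have := abs_le.1 (hf g); simp; linarith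
    rw [hadd, hc] at h1; rw [hadd, hc, hsm] at h2
    rw [abs_le]; constructor <;> linarith
  have hinv : ∀ (h : G) (f f' : SimpleFunc G ℝ), (∀ g, f' g = f (h * g)) → I f' = I f := by
    intro h f f' hf
    have hr : f'.range = f.range := by
      ext x; simp only [SimpleFunc.mem_range, mem_range]
      exact ⟨fun ⟨g, hg⟩ => ⟨h * g, by rw [← hf, hg]⟩, fun ⟨g, hg⟩ => ⟨h⁻¹ * g, by rw [hf, mul_inv_cancel_left, hg]⟩⟩
    simp only [I, SimpleFunc.setToSimpleFunc, hr]
    refine Finset.sum_congr rfl fun x _ => ?_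
    have : (f : G → ℝ) ⁻¹' {x} = (h * ·) '' (f' ⁻¹' {x}) := by
      ext g; simp only [mem_preimage, mem_singleton_iff, mem_image]
      exact ⟨fun hg => ⟨h⁻¹ * g, by rw [hf, mul_inv_cancel_left, hg], by simp⟩, fun ⟨g', h1, h2⟩ => by rw [← h2, ← hf, h1]⟩
    simp only [T]; rw [this, mi]
  have hap : ∀ (f : G → ℝ) (N : ℕ), ∃ s : SimpleFunc G ℝ, ∀ C, Bd f C → ∀ g, s g = ⌊(N + 1) * f g⌋ / (N + 1) := by
    intro f N
    by_cases h : ∃ C, Bd f C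
    · obtain ⟨C, hC⟩ := h
      refine ⟨⟨fun g => ⌊(N + 1) * f g⌋ / (N + 1), fun _ => trivial, ?_⟩, fun _ _ _ => rfl⟩
      refine ((Set.finite_Icc ⌊-((N + 1) * C)⌋ ⌊(N + 1) * C⌋).image (fun k : ℤ => (k : ℝ) / (N + 1))).subset ?_
      rintro _ ⟨g, rfl⟩
      have := abs_le.1 (hC g)
      have hN : (0:ℝ) < N + 1 := by positivity
      exact mem_image_of_mem _ ⟨Int.floor_le_floor (by nlinarith), Int.floor_le_floor (by nlinarith)⟩
    · exact ⟨0, fun C hC => (h ⟨C, hC⟩).elim⟩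
  choose s hs using hap
  have hfl : ∀ f C N, Bd f C → ∀ g, |s f N g - f g| ≤ 1 / (N + 1) := by
    intro f C N hf g
    have hN : (0:ℝ) < N + 1 := by positivity
    have e : s f N g - f g = (⌊(N + 1) * f g⌋ - (N + 1) * f g) / (N + 1) := by rw [hs f N C hf]; field_simp
    rw [e, abs_div, abs_of_pos hN]
    refine div_le_div_of_nonneg_right ?_ hN.le
    have := Int.floor_le ((N + 1) * f g); have := Int.lt_floor_add_one ((N + 1) * f g)
    rw [abs_le]; constructor <;> linarith
  have hbs : ∀ f C N, Bd f C → Bd (s f N) (C + 1) := fun f C N hf g => by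
    have h1 := hfl f C N hf g
    have h2 : 1 / ((N:ℝ) + 1) ≤ 1 := by rw [div_le_one (by positivity)]; linarith [(N.cast_nonneg : (0:ℝ) ≤ N)]
    calc |s f N g| = |(s f N g - f g) + f g| := by ring_nf
      _ ≤ _ := (abs_add_le _ _).trans (by linarith [hf g])
  obtain ⟨L, hL, hL1⟩ := ulim (atTop : Filter ℕ)
  have small : ∀ (u v : ℕ → ℝ) (D : ℝ), (∀ N, |u N - v N| ≤ D / (N + 1)) → L u = L v := by
    intro u v D h
    have hD : 0 ≤ D := by have := (abs_nonneg _).trans (h 0); simpa using this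
    have hb : Bd (u - v) D := fun N => (h N).trans (div_le_self hD (by linarith [(N.cast_nonneg : (0:ℝ) ≤ N)]))
    have : ∀ ε > 0, |L (u - v)| ≤ 0 + ε := fun ε hε => by
      have ht : Tendsto (fun N : ℕ => D / ((N:ℝ) + 1)) atTop (nhds 0) := tendsto_const_div_atTop_nhds_zero_nat D |>.comp (tendsto_add_atTop_nat 1) |>.congr fun N => by simp
      refine (hL _ _ D hb ((ht.eventually (ge_mem_nhds hε)).mono fun N hN => (h N).trans hN)).trans (by simp)
    have := le_of_forall_pos_le_add this
    rw [map_sub] at this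
    exact sub_eq_zero.1 (abs_nonpos_iff.1 this)
  obtain ⟨M, hM⟩ := ext_lin (fun f => L fun N => I (s f N)) (fun c f g C C' hf hg => by
    have hfg : Bd (c • f + g) (|c| * C + C') := fun i => by
      refine (abs_add_le _ _).trans (add_le_add ?_ (hg i))
      simp only [Pi.smul_apply, smul_eq_mul, abs_mul]; exact mul_le_mul_of_nonneg_left (hf i) (abs_nonneg c)
    have := small (fun N => I (s (c • f + g) N)) (c • (fun N => I (s f N)) + fun N => I (s g N)) (2 + |c|) fun N => by
      have e : I (s (c • f + g) N) - (c * I (s f N) + I (s g N)) = I (s (c • f + g) N + (-1:ℝ) • (c • s f N + s g N)) := by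
        rw [hadd, hsm, hadd, hsm]; ring
      change |_ - (c * I (s f N) + I (s g N))| ≤ _
      rw [e]
      refine hbd _ _ fun x => ?_
      have h1 := abs_le.1 (hfl _ _ N hfg x); have h2 := hfl _ _ N hf x; have h3 := abs_le.1 (hfl _ _ N hg x)
      have h4 : |c * (s f N x - f x)| ≤ |c| * (1 / (N + 1)) := by rw [abs_mul]; exact mul_le_mul_of_nonneg_left h2 (abs_nonneg c)
      have h5 := abs_le.1 h4
      have e2 : (2 + |c|) / ((N:ℝ) + 1) = 1 / (N + 1) + 1 / (N + 1) + |c| * (1 / (N + 1)) := by ring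
      simp only [Pi.add_apply, Pi.smul_apply, smul_eq_mul] at h1
      simp only [SimpleFunc.coe_add, SimpleFunc.coe_smul, Pi.add_apply, Pi.smul_apply, smul_eq_mul]
      rw [e2, abs_le]; constructor <;> linarith
    rw [this, map_add, map_smul, smul_eq_mul])
  refine ⟨M, fun f C hf => ?_, ?_, fun h f C hf => ?_⟩
  · rw [hM f C hf]
    have : ∀ ε > 0, |L fun N => I (s f N)| ≤ C + ε := fun ε hε => by
      have ht : Tendsto (fun N : ℕ => 1 / ((N:ℝ) + 1)) atTop (nhds 0) := tendsto_one_div_add_atTop_nhds_zero_nat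
      refine hL _ _ (C + 1) (fun N => hbd _ _ (hbs f C N hf)) ((ht.eventually (ge_mem_nhds hε)).mono fun N hN => hbd _ _ fun g => ?_)
      have := hfl f C N hf g
      calc |s f N g| = |(s f N g - f g) + f g| := by ring_nf
        _ ≤ _ := (abs_add_le _ _).trans (by linarith [hf g])
    exact le_of_forall_pos_le_add this
  · have h1 : Bd (fun _ : G => (1:ℝ)) 1 := fun g => by simp
    rw [hM _ 1 h1]
    refine (small _ _ 1 fun N => ?_).trans hL1
    have e : I (s (fun _ => 1) N) - 1 = I (s (fun _ => 1) N + (-1:ℝ) • SimpleFunc.const G 1) := by rw [hadd, hsm, hc]; ring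
    rw [e]
    refine hbd _ _ fun x => ?_
    have := hfl _ _ N h1 x
    simpa [sub_eq_add_neg] using this
  · have hf2 : Bd (fun g => f (h * g)) C := fun g => hf _
    rw [hM _ C hf2, hM f C hf]
    congr 1; ext N
    exact hinv h _ _ fun g => by rw [hs _ N C hf2, hs f N C hf]

def Sav {G : Type} [Group G] (h : G) (N : ℕ) (f : G → ℝ) : G → ℝ := fun g => (∑ i ∈ Finset.range (N + 1), f (h ^ i * g)) / (N + 1)
def Lav {G : Type} [Group G] (N : ℕ) : List G → (G → ℝ) → G → ℝ
  | [], f => f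
  | h :: l, f => Sav h N (Lav N l f)

lemma Sav_bd {G : Type} [Group G] (h : G) (N : ℕ) {f : G → ℝ} {C : ℝ} (hf : Bd f C) : Bd (Sav h N f) C := fun g => by
  unfold Sav
  rw [abs_div, abs_of_pos (by positivity : (0:ℝ) < N + 1), div_le_iff₀ (by positivity)]
  refine (Finset.abs_sum_le_sum_abs _ _).trans ((Finset.sum_le_sum fun i _ => hf _).trans ?_)
  simp; linarith

lemma Lav_bd {G : Type} [Group G] (N : ℕ) (l : List G) {f : G → ℝ} {C : ℝ} (hf : Bd f C) : Bd (Lav N l f) C := by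
  induction l with
  | nil => exact hf
  | cons h l ih => exact Sav_bd h N ih

lemma Lav_lin {G : Type} [Group G] (N : ℕ) (l : List G) (c : ℝ) (f g : G → ℝ) : Lav N l (c • f + g) = c • Lav N l f + Lav N l g := by
  induction l with
  | nil => rfl
  | cons h l ih =>
    ext x
    simp only [Lav, ih, Sav, Pi.add_apply, Pi.smul_apply, smul_eq_mul, Finset.sum_add_distrib, ← Finset.mul_sum]
    ring

lemma Lav_one {G : Type} [Group G] (N : ℕ) (l : List G) : Lav N l (fun _ => 1) = fun _ => 1 := by
  induction l with
  | nil => rfl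
  | cons h l ih =>
    ext x
    simp only [Lav, ih, Sav]; simp
    exact (by positivity : ((N:ℝ) + 1) ≠ 0)

lemma Lav_trans {G : Type} [Group G] (hc : ∀ a b : G, a * b = b * a) (N : ℕ) (l : List G) {f : G → ℝ} {C : ℝ} (hf : Bd f C) (h : G) :
    Lav N l (fun g => f (h * g)) = fun g => Lav N l f (h * g) := by
  induction l with
  | nil => rfl
  | cons k l ih =>
    ext x
    simp only [Lav, ih, Sav]
    simp only [← mul_assoc, hc h]

lemma Lav_inv {G : Type} [Group G] (hc : ∀ a b : G, a * b = b * a) (N : ℕ) (l : List G) {f : G → ℝ} {C : ℝ} (hf : Bd f C) (h : G) (hl : h ∈ l) :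
    ∀ g, |Lav N l f (h * g) - Lav N l f g| ≤ 2 * C / (N + 1) := by
  induction l with
  | nil => simp at hl
  | cons k l ih =>
    intro g
    have hN : (0:ℝ) < N + 1 := by positivity
    simp only [Lav, Sav]
    rw [← sub_div, abs_div, abs_of_pos hN]
    rcases List.mem_cons.1 hl with rfl | hl
    · refine div_le_div_of_nonneg_right ?_ hN.le
      have e : ∀ i ∈ Finset.range (N + 1), Lav N l f (h ^ i * (h * g)) = Lav N l f (h ^ (i + 1) * g) := fun i _ => by rw [pow_succ, mul_assoc]
      rw [Finset.sum_congr rfl e, ← Finset.sum_sub_distrib, Finset.sum_range_sub (fun i => Lav N l f (h ^ i * g))]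
      have := Lav_bd N l hf
      exact (abs_sub _ _).trans (by linarith [this (h ^ (N + 1) * g), this (h ^ 0 * g)])
    · rw [div_le_iff₀ hN, ← Finset.sum_sub_distrib]
      refine (Finset.abs_sum_le_sum_abs _ _).trans ((Finset.sum_le_sum (g := fun _ => 2 * C / ((N:ℝ) + 1)) fun i _ => ?_).trans ?_)
      · rw [← mul_assoc, hc _ h, mul_assoc]; exact ih hl _
      · simp; field_simp; rfl

lemma hasMean_comm {G : Type} [Group G] (hc : ∀ a b : G, a * b = b * a) : HasMean G := by
  classical
  obtain ⟨L, hL, hL1⟩ := ulim (atTop : Filter (Finset G × ℕ))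
  obtain ⟨M, hM⟩ := ext_lin (fun f : G → ℝ => L fun p => Lav p.2 p.1.toList f 1) (fun c f g C C' hf hg => by
    simp only [Lav_lin]
    rw [← smul_eq_mul, ← map_smul, ← map_add]; rfl)
  refine ⟨M, fun f C hf => ?_, ?_, fun h f C hf => ?_⟩
  · rw [hM f C hf]
    exact hL _ _ C (fun p => Lav_bd _ _ hf _) (Eventually.of_forall fun p => Lav_bd _ _ hf _)
  · rw [hM _ 1 fun g => by simp]
    simp only [Lav_one, hL1]
  · rw [hM _ C (fun g => hf _), hM f C hf, ← sub_eq_zero, ← map_sub, ← abs_nonpos_iff]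
    refine le_of_forall_pos_le_add fun ε hε => hL _ _ (2 * C) (fun p => ?_) ?_
    · have e := Lav_bd p.2 p.1.toList hf
      simp only [Pi.sub_apply, Lav_trans hc _ _ hf]
      exact (abs_sub _ _).trans (by linarith [e (h * 1), e 1])
    · have ht : Tendsto (fun N : ℕ => 2 * C / ((N:ℝ) + 1)) atTop (nhds 0) := tendsto_const_div_atTop_nhds_zero_nat (2 * C) |>.comp (tendsto_add_atTop_nat 1) |>.congr fun N => by simp
      have h1 := (ht.eventually (ge_mem_nhds hε))
      rw [← prod_atTop_atTop_eq]
      filter_upwards [(eventually_ge_atTop ({h} : Finset G)).prod_mk h1] with p hp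
      simp only [Pi.sub_apply, Lav_trans hc _ _ hf]
      rw [zero_add]
      exact (Lav_inv hc _ _ hf h (by simpa using hp.1) 1).trans hp.2

lemma HasMean.map {G H : Type} [Group G] [Group H] (π : G →* H) (hπ : Function.Surjective π) (h : HasMean G) : HasMean H := by
  obtain ⟨m, a, b, c⟩ := h
  refine ⟨m.comp (LinearMap.funLeft ℝ ℝ π), fun f C hf => a _ _ fun g => hf _, b, fun h f C hf => ?_⟩
  obtain ⟨k, rfl⟩ := hπ h
  have := c k (fun g => f (π g)) C fun g => hf _
  simp only [map_mul] at this
  exact this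

lemma HasMean.prod {G H : Type} [Group G] [Group H] (h : HasMean G) (h' : HasMean H) : HasMean (G × H) := by
  obtain ⟨m, a, b, c⟩ := h
  obtain ⟨m', a', b', c'⟩ := h'
  refine ⟨{ toFun := fun f => m fun x => m' fun y => f (x, y), map_add' := fun f g => ?_, map_smul' := fun r f => ?_ }, fun f C hf => a _ _ fun g => a' _ _ fun g' => hf _, ?_, ?_⟩
  · rw [← map_add]; congr 1; ext x; exact map_add m' (fun y => f (x, y)) fun y => g (x, y)
  · change _ = r • _
    rw [← map_smul]; congr 1; ext x; exact map_smul m' r (fun y => f (x, y))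
  · simp [b, b']
  · intro h f C hf
    have e : ∀ x, (m' fun y => f (h.1 * x, h.2 * y)) = m' fun y => f (h.1 * x, y) := fun x => c' h.2 (fun y => f (h.1 * x, y)) C fun y => hf _
    change (m fun x => m' fun y => f (h.1 * x, h.2 * y)) = _
    simp only [e]
    exact c h.1 (fun x => m' fun y => f (x, y)) C fun x => a' _ _ fun y => hf _

lemma HasMean.pi {ι : Type} [Finite ι] : ∀ (G : ι → Type) [∀ i, Group (G i)], (∀ i, HasMean (G i)) → HasMean (∀ i, G i) := by
  refine Finite.induction_empty_option (P := fun ι => ∀ (G : ι → Type) [∀ i, Group (G i)], (∀ i, HasMean (G i)) → HasMean (∀ i, G i)) ?_ ?_ ?_ ι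
  · intro α β e ih G _ h
    have := ih (fun a => G (e a)) fun a => h _
    let ψ : (∀ b, G b) →* (∀ a, G (e a)) := MonoidHom.mk' (fun f a => f (e a)) fun _ _ => rfl
    have hb : Function.Bijective ψ := (Equiv.piCongrLeft G e).symm.bijective
    exact this.map (MulEquiv.ofBijective ψ hb).symm.toMonoidHom (MulEquiv.ofBijective ψ hb).symm.surjective
  · intro G _ _
    exact hasMean_comm fun a b => Subsingleton.elim _ _
  · intro α _ ih G _ h
    refine ((h none).prod (ih (fun a => G (some a)) fun a => h _)).map (MonoidHom.mk' (fun p o => match o with | none => p.1 | some a => p.2 a) ?_) ?_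
    · intro f g; ext o; cases o <;> rfl
    · intro f
      refine ⟨(f none, fun a => f (some a)), ?_⟩
      ext o; cases o <;> rfl
end F8

section F9
open Set Filter
variable {V : Type} [Fintype V] [DecidableEq V] {Z : Type} [TopologicalSpace Z] {j : ℕ} {A A' : Finset V}

def WW (j : ℕ) (A : Finset V) (Z : Type) [TopologicalSpace Z] : Type := C(ΔF A, Z)
def WW.m (σ : WW j A Z) : C(ΔF A, Z) := σ
def WW.of (j : ℕ) (σ : C(ΔF A, Z)) : WW j A Z := σ
instance : TopologicalSpace (WW j A Z) := (inferInstance : TopologicalSpace C(ΔF A, Z)) ⊓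
  TopologicalSpace.induced (fun (σ : C(ΔF A, Z)) (y : {y : ΔF A // (sp y.1).card < j}) => σ y.1) ⊥

lemma WW.ext {σ τ : WW j A Z} (h : ∀ y, σ.m y = τ.m y) : σ = τ := ContinuousMap.ext h

lemma WW_ev : Continuous (fun p : WW j A Z × ΔF A => p.1.m p.2) := by
  have h1 : Continuous (WW.m : WW j A Z → C(ΔF A, Z)) := continuous_id_iff_le.2 inf_le_left
  exact continuous_eval.comp (h1.prodMap continuous_id)

lemma WW_loc (σ : WW j A Z) : ∀ᶠ τ in nhds σ, ∀ y, (sp y.1).card < j → WW.m τ y = σ.m y := by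
  have : IsOpen {τ : WW j A Z | (fun (y : {y : ΔF A // (sp y.1).card < j}) => τ.m y.1) = fun y => σ.m y.1} := by
    have h1 : @Continuous (WW j A Z) _ _ ⊥ (fun τ : WW j A Z => (fun (y : {y : ΔF A // (sp y.1).card < j}) => τ.m y.1)) :=
      continuous_iff_le_induced.2 inf_le_right
    exact @IsOpen.preimage _ _ _ ⊥ _ h1 {fun y => σ.m y.1} trivial
  filter_upwards [this.mem_nhds rfl] with τ hτ y hy
  exact congrFun hτ ⟨y, hy⟩

lemma WW_cont {T : Type} [TopologicalSpace T] {f : T → WW j A Z} (h : Continuous fun p : T × ΔF A => (f p.1).m p.2)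
    (h' : ∀ t, ∀ᶠ t' in nhds t, ∀ y, (sp y.1).card < j → (f t').m y = (f t).m y) : Continuous f := by
  refine continuous_inf_rng.2 ⟨ContinuousMap.continuous_of_continuous_uncurry _ h, continuous_induced_rng.2 ?_⟩
  refine @IsLocallyConstant.continuous _ _ _ ⊥ _ ((IsLocallyConstant.iff_eventually_eq _).2 fun t => ?_)
  filter_upwards [h' t] with t' ht'
  ext y; exact ht' y.1 y.2

lemma WW_stat {T : Type} [TopologicalSpace T] [PreconnectedSpace T] {f : T → WW j A Z} (h : Continuous f) (t t' : T) (y : ΔF A) (hy : (sp y.1).card < j) :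
    (f t).m y = (f t').m y := by
  have : IsLocallyConstant (fun t => (f t).m y) := (IsLocallyConstant.iff_eventually_eq _).2 fun t =>
    (h.continuousAt.eventually (WW_loc (f t))).mono fun t' ht' => ht' y hy
  exact this.apply_eq_of_preconnectedSpace t t'

lemma WW_cev {T : Type} [TopologicalSpace T] {f : T → WW j A Z} (h : Continuous f) : Continuous fun p : T × ΔF A => (f p.1).m p.2 :=
  WW_ev.comp ((h.comp continuous_fst).prodMk continuous_snd)

def WW.rs (h : A' ⊆ A) (σ : WW j A Z) : WW j A' Z := WW.of j (σ.m.comp (inc h))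

lemma rs_cont (h : A' ⊆ A) : Continuous (WW.rs h : WW j A Z → WW j A' Z) :=
  WW_cont (WW_ev.comp (continuous_id.prodMap (inc h).continuous)) fun σ => (WW_loc σ).mono fun τ hτ y hy => hτ (inc h y) hy

lemma joined_of (H : C(ΔF A × ℝ, Z)) (hs : ∀ y t, (sp y.1).card < j → H (y, t) = H (y, 0)) {α β : WW j A Z} (h0 : ∀ y, α.m y = H (y, 0))
    (h1 : ∀ y, β.m y = H (y, 1)) : Joined α β := by
  refine ⟨⟨⟨fun t => WW.of j (H.comp ⟨fun y => (y, (t:ℝ)), by fun_prop⟩), ?_⟩, ?_, ?_⟩⟩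
  · refine WW_cont ?_ fun t => Eventually.of_forall fun t' y hy => ?_
    · change Continuous fun p : unitInterval × ΔF A => H (p.2, (p.1:ℝ))
      fun_prop
    · exact (hs y _ hy).trans (hs y _ hy).symm
  · exact WW.ext fun y => (by rw [h0]; rfl)
  · exact WW.ext fun y => (by rw [h1]; rfl)

lemma pj0 : projIcc (0:ℝ) 1 zero_le_one 0 = (0 : unitInterval) := projIcc_left _
lemma pj1 : projIcc (0:ℝ) 1 zero_le_one 1 = (1 : unitInterval) := projIcc_right _

def pH {α β : WW j A Z} (P : Path α β) : C(ΔF A × ℝ, Z) := ⟨fun p => (P (projIcc 0 1 zero_le_one p.2)).m p.1,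
  (WW_cev (P.continuous.comp continuous_projIcc)).comp continuous_swap⟩

lemma pH_mem {α β : WW j A Z} (P : Path α β) (y) (t : unitInterval) : pH P (y, (t:ℝ)) = (P t).m y := by
  change (P (projIcc 0 1 zero_le_one t)).m y = _
  rw [projIcc_val]
lemma pH_zero {α β : WW j A Z} (P : Path α β) (y) : pH P (y, 0) = α.m y := by rw [show (0:ℝ) = ((0:unitInterval):ℝ) from rfl, pH_mem, P.source]
lemma pH_stat {α β : WW j A Z} (P : Path α β) (y t) (hy : (sp y.1).card < j) : pH P (y, t) = α.m y := by
  exact (WW_stat P.continuous _ 0 y hy).trans (by rw [P.source])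

lemma joined_r (α : WW j A Z) : Joined (WW.of (j + 1) α.m) (WW.of (j + 1) (α.m.comp ⟨fun y => ⟨yy j y.1 1, yy_F y.2 1⟩, by
    refine Continuous.subtype_mk ?_ _; exact (yy_cont j A).comp (by fun_prop : Continuous fun y : ΔF A => (y, (1:ℝ)))⟩)) := by
  refine joined_of (α.m.comp ⟨fun p => ⟨yy j p.1.1 p.2, yy_F p.1.2 p.2⟩, Continuous.subtype_mk (yy_cont j A) _⟩) (fun y t hy => ?_) (fun y => ?_) fun y => rfl
  · have h1 := yy_small (j := j) y.2.1 (by omega) t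
    have h2 := yy_small (j := j) y.2.1 (by omega) 0
    change α.m ⟨yy j y.1 t, _⟩ = α.m ⟨yy j y.1 0, _⟩
    congr 2; rw [h1.1, h2.1]
  · change α.m y = α.m ⟨yy j y.1 0, _⟩
    congr 1; exact Subtype.ext (yy_zero y.2.1).1.symm

lemma null_dat {α β : WW j A Z} (P : Path α β) (A' : Finset V) (hA : A' ⊆ A) (σ : C(ΔF A, C(unitInterval, Z))) (hσ : ∀ y t, σ y t = (P t).m y)
    (h : A'.card = j → ∃ (x : WW j A' Z) (q : Path x x), (∀ t, q t = (P t).rs hA) ∧ q.Homotopic (Path.refl x)) :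
    ∃ G : C(ΔF A' × ℝ, C(unitInterval, Z)), (∀ y, G (y, 0) = σ (inc hA y)) ∧ (∀ y t, (sp y.1).card < j → G (y, t) = σ (inc hA y)) ∧
      (∀ y s, G (y, s) 0 = α.m (inc hA y) ∧ G (y, s) 1 = β.m (inc hA y)) ∧ (A'.card = j → ∀ y t, G (y, 1) t = G (y, 1) 0) := by
  by_cases hc : A'.card = j
  · obtain ⟨x, q, hq, ⟨κ⟩⟩ := h hc
    have hκ : Continuous fun p : unitInterval × unitInterval => (κ p : WW j A' Z) := κ.continuous
    have e0 : x = α.rs hA := by rw [← P.source, ← hq, q.source]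
    have e1 : x = β.rs hA := by rw [← P.target, ← hq, q.target]
    let G : C(ΔF A' × ℝ, C(unitInterval, Z)) := ContinuousMap.curry ⟨fun p : (ΔF A' × ℝ) × unitInterval => WW.m (κ (projIcc 0 1 zero_le_one p.1.2, p.2)) p.1.1, by
      refine (WW_cev hκ).comp (Continuous.prodMk (Continuous.prodMk (continuous_projIcc.comp ?_) ?_) ?_) <;> fun_prop⟩
    have hG : ∀ y s t, G (y, s) t = WW.m (κ (projIcc 0 1 zero_le_one s, t)) y := fun _ _ _ => rfl
    have z0 : ∀ y, G (y, 0) = σ (inc hA y) := fun y => by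
      ext t; rw [hG, pj0, κ.apply_zero, hσ]
      change WW.m (q t) y = _; rw [hq]; rfl
    refine ⟨G, z0, fun y t hy => ?_, fun y s => ⟨?_, ?_⟩, fun _ y t => ?_⟩
    · rw [← z0]; ext u
      rw [hG, hG]; exact WW_stat hκ _ _ y hy
    · rw [hG, κ.source, e0]; rfl
    · rw [hG, κ.target, e1]; rfl
    · rw [hG, hG, pj1, κ.apply_one, κ.apply_one]; rfl
  · refine ⟨σ.comp ⟨fun p => inc hA p.1, by fun_prop⟩, fun y => rfl, fun y t _ => rfl, fun y s => ⟨?_, ?_⟩, fun h => (hc h).elim⟩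
    · change σ (inc hA y) 0 = _; rw [hσ, P.source]
    · change σ (inc hA y) 1 = _; rw [hσ, P.target]

lemma joined_null {α β : WW j A Z} (P : Path α β)
    (h : ∀ A' (hA : A' ⊆ A), A'.card = j → ∃ (x : WW j A' Z) (q : Path x x), (∀ t, q t = (P t).rs hA) ∧ q.Homotopic (Path.refl x)) :
    Joined (WW.of (j + 1) α.m) (WW.of (j + 1) β.m) := by
  refine (joined_r α).trans (Joined.trans ?_ (joined_r β).symm)
  obtain ⟨σ, hσ⟩ : ∃ σ : C(ΔF A, C(unitInterval, Z)), ∀ y t, σ y t = (P t).m y :=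
    ⟨ContinuousMap.curry ⟨fun p => (P p.2).m p.1, (WW_cev P.continuous).comp continuous_swap⟩, fun y t => rfl⟩
  have hK := fun A' (hA : A' ⊆ A) => null_dat P A' hA σ hσ (h A' hA)
  choose G g0 gs ge g1 using hK
  have D : Dat j σ G := ⟨fun A' h y _ => g0 A' h y, fun A' h y t _ hy => gs A' h y t hy⟩
  obtain ⟨H, hH⟩ : ∃ H : C(ΔF A × ℝ, Z), ∀ y t, H (y, t) = extF j σ G (y, 1) (projIcc 0 1 zero_le_one t) := by
    have hcont : Continuous fun p : ΔF A × ℝ => extF j σ G (p.1, 1) :=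
      (extF_cont D).comp (by fun_prop : Continuous fun p : ΔF A × ℝ => (p.1, (1:ℝ)))
    exact ⟨⟨_, continuous_eval.comp (hcont.prodMk ((continuous_projIcc (h := zero_le_one)).comp continuous_snd))⟩, fun _ _ => rfl⟩
  have hends : ∀ y, extF j σ G (y, 1) 0 = α.m ⟨yy j y.1 1, yy_F y.2 1⟩ ∧ extF j σ G (y, 1) 1 = β.m ⟨yy j y.1 1, yy_F y.2 1⟩ := by
    intro y
    unfold extF
    split_ifs with hc
    · exact ge _ _ _ _
    · rw [hσ, hσ, P.source, P.target]; exact ⟨rfl, rfl⟩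
  refine joined_of H (fun y t hy => ?_) (fun y => ?_) fun y => ?_
  · rw [hH, hH]
    rcases (Nat.lt_succ_iff.1 hy).lt_or_eq with hy | hy
    · rw [extF_stat D y hy, hσ, hσ]; exact WW_stat P.continuous _ _ y hy
    · have := extF_face D y.2.2 hy.le ⟨y.1, y.2.1, le_rfl⟩ 1
      rw [cl_one] at this
      change extF j σ G (y, 1) = _ at this
      rw [this]
      exact (g1 _ _ hy _ _).trans (g1 _ _ hy _ _).symm
  · rw [hH, pj0]; exact (hends y).1.symm
  · rw [hH, pj1]; exact (hends y).2.symm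
end F9

section F10
open Set Filter

lemma sq {T : Type} [TopologicalSpace T] {a b c d : T} (p : Path a b) (q : Path b d) (p' : Path a c) (q' : Path c d) (S : C(unitInterval × unitInterval, T))
    (h1 : ∀ s, S (s, 0) = p s) (h2 : ∀ t, S (1, t) = q t) (h3 : ∀ t, S (0, t) = p' t) (h4 : ∀ s, S (s, 1) = q' s) : (p.trans q).Homotopic (p'.trans q') := by
  obtain rfl : S (0, 0) = a := by rw [h1, p.source]
  obtain rfl : S (1, 0) = b := by rw [h1, p.target]
  obtain rfl : S (0, 1) = c := by rw [h3, p'.target]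
  obtain rfl : S (1, 1) = d := by rw [h2, q.target]
  let P : Path ((0:unitInterval), (0:unitInterval)) (1, 0) := ⟨⟨fun s => (s, 0), by fun_prop⟩, rfl, rfl⟩
  let Q : Path ((1:unitInterval), (0:unitInterval)) (1, 1) := ⟨⟨fun s => (1, s), by fun_prop⟩, rfl, rfl⟩
  let P' : Path ((0:unitInterval), (0:unitInterval)) (0, 1) := ⟨⟨fun s => (0, s), by fun_prop⟩, rfl, rfl⟩
  let Q' : Path ((0:unitInterval), (1:unitInterval)) (1, 1) := ⟨⟨fun s => (s, 1), by fun_prop⟩, rfl, rfl⟩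
  haveI : ContractibleSpace unitInterval := (convex_Icc (0:ℝ) 1).contractibleSpace ⟨0, by simp⟩
  have h : (P.trans Q).Homotopic (P'.trans Q') := SimplyConnectedSpace.paths_homotopic _ _
  have e1 : P.map S.continuous = p := Path.ext (funext h1)
  have e2 : Q.map S.continuous = q := Path.ext (funext h2)
  have e3 : P'.map S.continuous = p' := Path.ext (funext h3)
  have e4 : Q'.map S.continuous = q' := Path.ext (funext h4)
  have := h.map S
  rw [Path.map_trans, Path.map_trans, e1, e2, e3, e4] at this
  exact this

open Path in
lemma sqQ {T : Type} [TopologicalSpace T] {a b : T} {f : C(T, T)} (h : (ContinuousMap.id T).Homotopic f) (e : T) : ∃ γ : Path.Homotopic.Quotient e (f e),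
    ∀ p : Path e e, (Homotopic.Quotient.mk p).trans γ = γ.trans (Homotopic.Quotient.mk (p.map f.continuous)) := by
  obtain ⟨H⟩ := h
  refine ⟨Homotopic.Quotient.mk ⟨⟨fun t => H (t, e), by fun_prop⟩, by simp, by simp⟩, fun p => ?_⟩
  rw [← Homotopic.Quotient.mk_trans, ← Homotopic.Quotient.mk_trans, Homotopic.Quotient.eq]
  refine sq _ _ _ _ ⟨fun x => H (x.2, p x.1), by fun_prop⟩ (fun s => ?_) (fun t => ?_) (fun t => ?_) fun s => ?_
  · simp
  · simp
  · simp
  · simp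

open Path in
lemma comm_of_M {T : Type} [TopologicalSpace T] (e : T) (M : C(T × T, T)) (h1 : (ContinuousMap.id T).Homotopic ⟨fun x => M (x, e), by fun_prop⟩)
    (h2 : (ContinuousMap.id T).Homotopic ⟨fun x => M (e, x), by fun_prop⟩) (a b : FundamentalGroup T e) : a * b = b * a := by
  obtain ⟨γ, hγ⟩ := sqQ (a := e) (b := e) h1 e
  obtain ⟨δ, hδ⟩ := sqQ (a := e) (b := e) h2 e
  change Homotopic.Quotient e (M (e, e)) at γ δ
  have key : ∀ x y : Homotopic.Quotient e e, ((γ.symm.trans x).trans γ).trans ((δ.symm.trans y).trans δ) = ((δ.symm.trans y).trans δ).trans ((γ.symm.trans x).trans γ) := by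
    intro x y
    induction x using Homotopic.Quotient.ind with | mk p => ?_
    induction y using Homotopic.Quotient.ind with | mk q => ?_
    rw [Homotopic.Quotient.trans_assoc γ.symm, hγ, Homotopic.Quotient.trans_assoc δ.symm, hδ]
    rw [← Homotopic.Quotient.trans_assoc γ.symm, ← Homotopic.Quotient.trans_assoc δ.symm, Homotopic.Quotient.symm_trans, Homotopic.Quotient.symm_trans, Homotopic.Quotient.refl_trans, Homotopic.Quotient.refl_trans,
      ← Homotopic.Quotient.mk_trans, ← Homotopic.Quotient.mk_trans, Homotopic.Quotient.eq]
    exact sq _ _ _ _ ⟨fun x => M (p x.1, q x.2), by fun_prop⟩ (fun s => by simp) (fun s => by simp) (fun s => by simp) (fun s => by simp)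
  have k2 := key (FundamentalGroup.toPath a) ((((δ.trans γ.symm).trans (FundamentalGroup.toPath b)).trans γ).trans δ.symm)
  have e3 : (δ.symm.trans ((((δ.trans γ.symm).trans (FundamentalGroup.toPath b)).trans γ).trans δ.symm)).trans δ = (γ.symm.trans (FundamentalGroup.toPath b)).trans γ := by
    simp only [Homotopic.Quotient.trans_assoc, Homotopic.Quotient.symm_trans, Homotopic.Quotient.trans_refl]
    rw [← Homotopic.Quotient.trans_assoc δ.symm δ, Homotopic.Quotient.symm_trans, Homotopic.Quotient.refl_trans]
  rw [e3] at k2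
  have k3 := congrArg (fun z => (γ.trans z).trans γ.symm) k2
  have sim : ∀ u v : Homotopic.Quotient e e, (γ.trans (((γ.symm.trans u).trans γ).trans ((γ.symm.trans v).trans γ))).trans γ.symm = u.trans v := by
    intro u v
    simp only [Homotopic.Quotient.trans_assoc, Homotopic.Quotient.trans_symm, Homotopic.Quotient.trans_refl]
    rw [← Homotopic.Quotient.trans_assoc γ γ.symm, Homotopic.Quotient.trans_symm, Homotopic.Quotient.refl_trans, ← Homotopic.Quotient.trans_assoc γ γ.symm, Homotopic.Quotient.trans_symm, Homotopic.Quotient.refl_trans]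
  simp only [sim] at k3
  exact k3.symm

variable {V : Type} [Fintype V] [DecidableEq V] {Z : Type} [TopologicalSpace Z] {j : ℕ} {A : Finset V} {v0 : V}

def ca (A : Finset V) (v0 : V) (h : (A.erase v0).Nonempty) (x : V → ℝ) : ℝ := (A.erase v0).inf' h x
def cL (A : Finset V) (v0 : V) (h : (A.erase v0).Nonempty) (x : V → ℝ) : ℝ := ca A v0 h x + x v0 / (A.erase v0).card
def mvf (A : Finset V) (v0 : V) (h : (A.erase v0).Nonempty) (x : V → ℝ) (p : ℝ) : V → ℝ := fun v =>
  if v = v0 then (A.erase v0).card * (cL A v0 h x - max 0 (min p (cL A v0 h x))) else if v ∈ A then x v - ca A v0 h x + max 0 (min p (cL A v0 h x)) else 0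

lemma ca_cont (h : (A.erase v0).Nonempty) : Continuous (ca A v0 h) := by
  unfold ca; exact Continuous.finset_inf'_apply _ fun T _ => by fun_prop
lemma cL_cont (h : (A.erase v0).Nonempty) : Continuous (cL A v0 h) := by
  unfold cL; have := ca_cont h; fun_prop

lemma ca_nonneg (h : (A.erase v0).Nonempty) {x : V → ℝ} (hx : x ∈ ΔF A) : 0 ≤ ca A v0 h x := Finset.le_inf' _ _ fun v _ => hx.1.1 v
lemma ca_le (h : (A.erase v0).Nonempty) {x : V → ℝ} (hx : x ∈ ΔF A) : ca A v0 h x ≤ cL A v0 h x :=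
  le_add_of_nonneg_right (div_nonneg (hx.1.1 _) (by positivity))

lemma off {x : V → ℝ} (hx : x ∈ ΔF A) {v : V} (hv : v ∉ A) : x v = 0 := by
  by_contra h'; exact hv (hx.2 (mem_sp.2 h'))

lemma mvf_mem (h : (A.erase v0).Nonempty) (hv : v0 ∈ A) {x : V → ℝ} (hx : x ∈ ΔF A) (p : ℝ) : mvf A v0 h x p ∈ ΔF A := by
  have h1 := ca_nonneg h hx
  have h2 := ca_le h hx
  have hk : (0:ℝ) < (A.erase v0).card := by exact_mod_cast h.card_pos
  have m1 : max 0 (min p (cL A v0 h x)) ≤ cL A v0 h x := max_le (h1.trans h2) (min_le_right _ _)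
  have m0 : 0 ≤ max 0 (min p (cL A v0 h x)) := le_max_left _ _
  refine ⟨⟨fun v => ?_, ?_⟩, fun v hv' => ?_⟩
  · unfold mvf
    split_ifs with g1 g2
    · exact mul_nonneg hk.le (by linarith)
    · have : ca A v0 h x ≤ x v := Finset.inf'_le _ (Finset.mem_erase.2 ⟨g1, g2⟩)
      linarith
    · rfl
  · have e1 : ∑ v, mvf A v0 h x p v = ∑ v ∈ A, mvf A v0 h x p v := by
      refine (Finset.sum_subset (Finset.subset_univ _) fun v _ hv' => ?_).symm
      unfold mvf; rw [if_neg (fun h'' : v = v0 => hv' (h'' ▸ hv)), if_neg hv']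
    have e2 : ∑ v ∈ A.erase v0, mvf A v0 h x p v = ∑ v ∈ A.erase v0, (x v - ca A v0 h x + max 0 (min p (cL A v0 h x))) := by
      refine Finset.sum_congr rfl fun v hv' => ?_
      unfold mvf; rw [if_neg (Finset.ne_of_mem_erase hv'), if_pos (Finset.mem_of_mem_erase hv')]
    have e3 : ∑ v ∈ A, x v = 1 := by
      rw [← hx.1.2]; exact Finset.sum_subset (Finset.subset_univ _) fun v _ hv' => off hx hv'
    rw [← Finset.add_sum_erase _ _ hv] at e1 e3
    rw [e1, e2, Finset.sum_add_distrib, Finset.sum_sub_distrib, Finset.sum_const, Finset.sum_const]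
    unfold mvf; rw [if_pos rfl]
    have e4 : (A.erase v0).card * cL A v0 h x = (A.erase v0).card * ca A v0 h x + x v0 := by unfold cL; field_simp
    simp only [nsmul_eq_mul, mul_sub]
    linarith
  · by_contra h'
    refine mem_sp.1 hv' ?_
    unfold mvf; rw [if_neg (fun h'' : v = v0 => h' (h'' ▸ hv)), if_neg h']

def mv (A : Finset V) (v0 : V) (h : (A.erase v0).Nonempty) (hv : v0 ∈ A) (x : ΔF A) (p : ℝ) : ΔF A := ⟨mvf A v0 h x.1 p, mvf_mem h hv x.2 p⟩

lemma mv_cont (h : (A.erase v0).Nonempty) (hv : v0 ∈ A) : Continuous fun q : ΔF A × ℝ => mv A v0 h hv q.1 q.2 := by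
  refine Continuous.subtype_mk (continuous_pi fun v => ?_) _
  have h1 := ca_cont h
  have h2 := cL_cont h
  unfold mvf
  by_cases g1 : v = v0
  · simp only [if_pos g1]; fun_prop
  · by_cases g2 : v ∈ A
    · simp only [if_neg g1, if_pos g2]
      exact (((continuous_apply v).comp (continuous_subtype_val.comp continuous_fst)).sub (h1.comp (continuous_subtype_val.comp continuous_fst))).add (by fun_prop)
    · simp only [if_neg g1, if_neg g2]; fun_prop

lemma mv_id (h : (A.erase v0).Nonempty) (hv : v0 ∈ A) (x : ΔF A) : mv A v0 h hv x (ca A v0 h x.1) = x := by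
  have h1 := ca_nonneg h x.2
  have h2 := ca_le h x.2
  have hk : (0:ℝ) < (A.erase v0).card := by exact_mod_cast h.card_pos
  refine Subtype.ext (funext fun v => ?_)
  change mvf A v0 h x.1 _ v = x.1 v
  unfold mvf
  rw [min_eq_left h2, max_eq_right h1]
  split_ifs with g1 g2
  · unfold cL; rw [g1]; field_simp; ring
  · ring
  · exact (off x.2 g2).symm

lemma sp_lt {x : ΔF A} {v : V} (hv : v ∈ A) (h : x.1 v = 0) : (sp x.1).card < A.card :=
  Finset.card_lt_card ⟨x.2.2, fun h' => mem_sp.1 (h' hv) h⟩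

lemma mv_L (h : (A.erase v0).Nonempty) (hv : v0 ∈ A) (x : ΔF A) : (sp (mv A v0 h hv x (cL A v0 h x.1)).1).card < A.card := by
  refine sp_lt hv ?_
  change mvf A v0 h x.1 _ v0 = 0
  unfold mvf; rw [if_pos rfl, min_self, max_eq_right ((ca_nonneg h x.2).trans (ca_le h x.2)), sub_self, mul_zero]

lemma mv_0 (h : (A.erase v0).Nonempty) (hv : v0 ∈ A) (x : ΔF A) : (sp (mv A v0 h hv x 0).1).card < A.card := by
  obtain ⟨v, hv', hm⟩ := Finset.exists_mem_eq_inf' h x.1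
  refine sp_lt (Finset.mem_of_mem_erase hv') ?_
  change mvf A v0 h x.1 _ v = 0
  have : ca A v0 h x.1 = x.1 v := hm
  unfold mvf; rw [if_neg (Finset.ne_of_mem_erase hv'), if_pos (Finset.mem_of_mem_erase hv'), min_eq_left ((ca_nonneg h x.2).trans (ca_le h x.2)), this]; simp

lemma mv_bd (h : (A.erase v0).Nonempty) (hv : v0 ∈ A) (x : ΔF A) (hx : (sp x.1).card < A.card) : ca A v0 h x.1 = 0 ∨ ca A v0 h x.1 = cL A v0 h x.1 := by
  obtain ⟨v, hv', hm⟩ : ∃ v ∈ A, v ∉ sp x.1 := Finset.exists_mem_notMem_of_card_lt_card hx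
  have hm : x.1 v = 0 := by simpa [mem_sp] using hm
  by_cases g : v = v0
  · right; rw [g] at hm; unfold cL; rw [hm]; simp
  · left; exact le_antisymm ((Finset.inf'_le _ (Finset.mem_erase.2 ⟨g, hv'⟩)).trans hm.le) (ca_nonneg h x.2)

def TZ (e : WW A.card A Z) : Type := {f : WW A.card A Z // ∀ y, (sp y.1).card < A.card → f.m y = e.m y}
instance (e : WW A.card A Z) : TopologicalSpace (TZ e) := inferInstanceAs (TopologicalSpace {f : WW A.card A Z // ∀ y, (sp y.1).card < A.card → f.m y = e.m y})

lemma TZ_ev {e : WW A.card A Z} {T : Type} [TopologicalSpace T] {f : T → TZ e} {g : T → ΔF A} (hf : Continuous f) (hg : Continuous g) :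
    Continuous fun t => (f t).1.m (g t) := WW_ev.comp ((continuous_subtype_val.comp hf).prodMk hg)

lemma TZ_bld {e : WW A.card A Z} {T : Type} [TopologicalSpace T] (F : T × ΔF A → Z) (hF : Continuous F) (hb : ∀ t y, (sp y.1).card < A.card → F (t, y) = e.m y) :
    ∃ G : C(T, TZ e), ∀ t y, (G t).1.m y = F (t, y) := by
  refine ⟨⟨fun t => ⟨WW.of _ ⟨fun y => F (t, y), by fun_prop⟩, hb t⟩, Continuous.subtype_mk (WW_cont (f := fun t => WW.of _ ⟨fun y => F (t, y), by fun_prop⟩) hF ?_) _⟩, fun t y => rfl⟩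
  exact fun t => Eventually.of_forall fun t' y hy => (hb t' y hy).trans (hb t y hy).symm

lemma TZ_ext {e : WW A.card A Z} {f g : TZ e} (h : ∀ y, f.1.m y = g.1.m y) : f = g := Subtype.ext (WW.ext h)

lemma TZ_htpy {e : WW A.card A Z} (F0 F1 : C(TZ e, TZ e)) (F : (unitInterval × TZ e) × ΔF A → Z) (hF : Continuous F) (hb : ∀ t y, (sp y.1).card < A.card → F (t, y) = e.m y)
    (h0 : ∀ f y, F ((0, f), y) = (F0 f).1.m y) (h1 : ∀ f y, F ((1, f), y) = (F1 f).1.m y) : F0.Homotopic F1 := by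
  obtain ⟨G, hG⟩ := TZ_bld F hF hb
  exact ⟨⟨G, fun f => TZ_ext fun y => by change (G (0, f)).1.m y = _; rw [hG, h0], fun f => TZ_ext fun y => by change (G (1, f)).1.m y = _; rw [hG, h1]⟩⟩

lemma TZ_comm (hA : 2 ≤ A.card) (e : WW A.card A Z) (a b : FundamentalGroup (TZ e) ⟨e, fun _ _ => rfl⟩) : a * b = b * a := by
  obtain ⟨v0, hv⟩ : A.Nonempty := Finset.card_pos.1 (by omega)
  have h : (A.erase v0).Nonempty := Finset.card_pos.1 (by rw [Finset.card_erase_of_mem hv]; omega)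
  obtain ⟨r, hr⟩ : ∃ r : ΔF A → ℝ → ΔF A, r = mv A v0 h hv := ⟨_, rfl⟩
  obtain ⟨al, hal⟩ : ∃ al : ΔF A → ℝ, al = fun x => ca A v0 h x.1 := ⟨_, rfl⟩
  obtain ⟨L, hL⟩ : ∃ L : ΔF A → ℝ, L = fun x => cL A v0 h x.1 := ⟨_, rfl⟩
  have ac : Continuous al := by rw [hal]; exact (ca_cont h).comp continuous_subtype_val
  have Lc : Continuous L := by rw [hL]; exact (cL_cont h).comp continuous_subtype_val
  have a0 : ∀ x, 0 ≤ al x := fun x => by rw [hal]; exact ca_nonneg h x.2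
  have aL : ∀ x, al x ≤ L x := fun x => by rw [hal, hL]; exact ca_le h x.2
  have r_id : ∀ x p, p = al x → r x p = x := fun x p hp => by rw [hp, hr, hal]; exact mv_id h hv x
  have rc : Continuous fun q : ΔF A × ℝ => r q.1 q.2 := by rw [hr]; exact mv_cont h hv
  have bd : ∀ x : ΔF A, (sp x.1).card < A.card → al x = 0 ∨ al x = L x := fun x => by rw [hal, hL]; exact mv_bd h hv x
  have r0 : ∀ (f : TZ e) x p, p = 0 → f.1.m (r x p) = e.m (r x 0) := fun f x p hp => by rw [hp]; refine f.2 _ ?_; rw [hr]; exact mv_0 h hv x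
  have rL : ∀ (f : TZ e) x p, p = L x → f.1.m (r x p) = e.m (r x (L x)) := fun f x p hp => by rw [hp]; refine f.2 _ ?_; rw [hr, hL]; exact mv_L h hv x
  have rb : ∀ (f : TZ e) x p, (sp x.1).card < A.card → p = al x → f.1.m (r x p) = e.m x := fun f x p hx hp => by rw [r_id x p hp]; exact f.2 x hx
  clear hr hal hL
  obtain ⟨E, hE⟩ : ∃ E : TZ e, E = ⟨e, fun _ _ => rfl⟩ := ⟨_, rfl⟩
  have ev : ∀ {T : Type} [TopologicalSpace T] {f : T → TZ e} {g : T → ΔF A} {p : T → ℝ}, Continuous f → Continuous g → Continuous p → Continuous fun t => (f t).1.m (r (g t) (p t)) :=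
    fun hf hg hp => TZ_ev hf (rc.comp (hg.prodMk hp))
  obtain ⟨M, hM⟩ := TZ_bld (e := e) (fun q : (TZ e × TZ e) × ΔF A => if 3 * al q.2 ≤ L q.2 then q.1.1.1.m (r q.2 (3 * al q.2)) else
      if 3 * al q.2 ≤ 2 * L q.2 then E.1.m (r q.2 (2 * L q.2 - 3 * al q.2)) else q.1.2.1.m (r q.2 (3 * al q.2 - 2 * L q.2))) (by
    refine Continuous.if_le (ev (by fun_prop) (by fun_prop) (by fun_prop)) (Continuous.if_le (ev (by fun_prop) (by fun_prop) (by fun_prop))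
      (ev (by fun_prop) (by fun_prop) (by fun_prop)) (by fun_prop) (by fun_prop) fun q hq => ?_) (by fun_prop) (by fun_prop) fun q hq => ?_
    · rw [r0 _ _ _ (by linarith), r0 _ _ _ (by linarith)]
    · rw [if_pos (by linarith [a0 q.2, aL q.2]), rL _ _ _ (by linarith), rL _ _ _ (by linarith)]) fun t y hy => by
    have := a0 y; have := aL y
    dsimp only
    rcases bd y hy with h | h <;> split_ifs <;> exact rb _ _ _ hy (by linarith)
  subst hE
  refine comm_of_M _ M ?_ ?_ a b
  · obtain ⟨N, hN⟩ := TZ_bld (e := e) (fun q : TZ e × ΔF A => q.1.1.m (r q.2 (min (3 * al q.2) (L q.2)))) (ev (by fun_prop) (by fun_prop) (by fun_prop)) fun t y hy => by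
      have := a0 y; have := aL y
      refine rb _ _ _ hy ?_
      rcases bd y hy with h | h
      · rw [min_eq_left (by linarith)]; linarith
      · rw [min_eq_right (by linarith)]; linarith
    refine ContinuousMap.Homotopic.trans (g := N) (ContinuousMap.Homotopic.symm ?_) (ContinuousMap.Homotopic.symm ?_)
    · refine TZ_htpy _ _ (fun q => q.1.2.1.m (r q.2 ((1 - (q.1.1:ℝ)) * min (3 * al q.2) (L q.2) + q.1.1 * al q.2))) (ev (by fun_prop) (by fun_prop) (by fun_prop)) (fun t y hy => ?_) (fun f y => ?_) fun f y => ?_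
      · have := a0 y; have := aL y
        refine rb _ _ _ hy ?_
        dsimp only
        rcases bd y hy with h | h
        · rw [min_eq_left (by linarith), h]; ring
        · rw [min_eq_right (by linarith), h]; ring
      · rw [hN]; simp
      · rw [r_id _ _ (by simp)]; rfl
    · refine TZ_htpy _ _ (fun q => if 3 * al q.2 ≤ L q.2 then q.1.2.1.m (r q.2 (3 * al q.2)) else
        e.m (r q.2 ((1 - (q.1.1:ℝ)) * |2 * L q.2 - 3 * al q.2| + q.1.1 * L q.2))) (Continuous.if_le (ev (by fun_prop) (by fun_prop) (by fun_prop)) (ev (f := fun _ => ⟨e, fun _ _ => rfl⟩) (by fun_prop) (by fun_prop) (by fun_prop)) (by fun_prop) (by fun_prop) fun q hq => ?_) (fun t y hy => ?_) (fun f y => ?_) fun f y => ?_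
      · have := aL q.2; have := a0 q.2
        rw [rL _ _ _ (by linarith), show 2 * L q.2 - 3 * al q.2 = L q.2 by linarith, abs_of_nonneg (by linarith)]
        congr 2; ring
      · have := a0 y; have := aL y
        dsimp only
        split_ifs with g
        · exact rb _ _ _ hy (by rcases bd y hy with h | h <;> linarith)
        · refine rb ⟨e, fun _ _ => rfl⟩ _ _ hy ?_
          rcases bd y hy with h | h
          · exfalso; apply g; linarith
          · rw [← h, abs_of_nonpos (by linarith)]; ring
      · have := a0 y; have := aL y
        change _ = (M (f, _)).1.m y
        rw [hM]
        dsimp only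
        split_ifs with g g'
        · rfl
        · rw [abs_of_nonneg (by linarith)]; simp
        · rw [abs_of_neg (by linarith)]; simp
      · rw [hN]; dsimp only
        split_ifs with g
        · rw [min_eq_left g]
        · rw [min_eq_right (by linarith), rL _ _ _ rfl]; simp
  · obtain ⟨N, hN⟩ := TZ_bld (e := e) (fun q : TZ e × ΔF A => q.1.1.m (r q.2 (max (3 * al q.2 - 2 * L q.2) 0))) (ev (by fun_prop) (by fun_prop) (by fun_prop)) fun t y hy => by
      have := a0 y; have := aL y
      refine rb _ _ _ hy ?_
      rcases bd y hy with h | h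
      · rw [max_eq_right (by linarith)]; linarith
      · rw [max_eq_left (by linarith)]; linarith
    refine ContinuousMap.Homotopic.trans (g := N) (ContinuousMap.Homotopic.symm ?_) (ContinuousMap.Homotopic.symm ?_)
    · refine TZ_htpy _ _ (fun q => q.1.2.1.m (r q.2 ((1 - (q.1.1:ℝ)) * max (3 * al q.2 - 2 * L q.2) 0 + q.1.1 * al q.2))) (ev (by fun_prop) (by fun_prop) (by fun_prop)) (fun t y hy => ?_) (fun f y => ?_) fun f y => ?_
      · have := a0 y; have := aL y
        refine rb _ _ _ hy ?_
        dsimp only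
        rcases bd y hy with h | h
        · rw [max_eq_right (by linarith), h]; ring
        · rw [max_eq_left (by linarith), h]; ring
      · rw [hN]; simp
      · rw [r_id _ _ (by simp)]; rfl
    · refine TZ_htpy _ _ (fun q => if 3 * al q.2 ≤ 2 * L q.2 then e.m (r q.2 ((1 - (q.1.1:ℝ)) * min (3 * al q.2) (2 * L q.2 - 3 * al q.2))) else
        q.1.2.1.m (r q.2 (3 * al q.2 - 2 * L q.2))) (Continuous.if_le (ev (f := fun _ => ⟨e, fun _ _ => rfl⟩) (by fun_prop) (by fun_prop) (by fun_prop)) (ev (by fun_prop) (by fun_prop) (by fun_prop)) (by fun_prop) (by fun_prop) fun q hq => ?_) (fun t y hy => ?_) (fun f y => ?_) fun f y => ?_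
      · have := aL q.2; have := a0 q.2
        rw [r0 q.1.2 _ _ (by linarith), show 2 * L q.2 - 3 * al q.2 = 0 by linarith, min_eq_right (by linarith), mul_zero]
      · have := a0 y; have := aL y
        dsimp only
        split_ifs with g
        · refine rb ⟨e, fun _ _ => rfl⟩ _ _ hy ?_
          rcases bd y hy with h | h
          · rw [min_eq_left (by linarith), h]; ring
          · rw [min_eq_right (by linarith), show 2 * L y - 3 * al y = 0 by linarith, mul_zero]; linarith
        · refine rb _ _ _ hy ?_
          rcases bd y hy with h | h <;> linarith
      · have := a0 y; have := aL y
        change _ = (M (_, f)).1.m y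
        rw [hM]
        dsimp only
        split_ifs with g g' g'
        · rw [min_eq_left (by linarith)]; simp
        · rw [min_eq_right (by linarith)]; simp
        · exfalso; linarith
        · rfl
      · rw [hN]; dsimp only
        split_ifs with g
        · rw [max_eq_right (by linarith), r0 _ _ _ rfl]; simp
        · rw [max_eq_left (by linarith)]

lemma WW_comm (hA : 2 ≤ A.card) (hj : A.card = j) (e : WW j A Z) (a b : FundamentalGroup (WW j A Z) e) : a * b = b * a := by
  subst hj
  have lift : ∀ a : FundamentalGroup (WW A.card A Z) e, ∃ a' : FundamentalGroup (TZ e) ⟨e, fun _ _ => rfl⟩,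
      FundamentalGroup.map (⟨Subtype.val, continuous_subtype_val⟩ : C(TZ e, WW A.card A Z)) ⟨e, fun _ _ => rfl⟩ a' = a := by
    intro a
    obtain ⟨p, rfl⟩ := Path.Homotopic.Quotient.mk_surjective a
    exact ⟨Path.Homotopic.Quotient.mk ⟨⟨fun t => ⟨p t, fun y hy => by
      rw [WW_stat p.continuous t 0 y hy, p.source]⟩, Continuous.subtype_mk p.continuous _⟩, Subtype.ext p.source, Subtype.ext p.target⟩, rfl⟩
  obtain ⟨a, rfl⟩ := lift a
  obtain ⟨b, rfl⟩ := lift b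
  rw [← map_mul, ← map_mul, TZ_comm hA]
end F10

section F11
open Set Filter
open Finsupp (single)
variable {V : Type} [Fintype V] [DecidableEq V] {m n : ℕ}

def rg (f : Fin (m+1) ↪ V) : Finset V := Finset.univ.map f

lemma mem_rg {f : Fin (m+1) ↪ V} {v : V} : v ∈ rg f ↔ ∃ k, f k = v := by simp [rg]
lemma rg_card (f : Fin (m+1) ↪ V) : (rg f).card = m + 1 := by simp [rg]

def pu (f : Fin (m+1) ↪ V) : C(Δ m, ΔF (rg f)) := ⟨fun y => ⟨fun v => ∑ k, y.1 k * (if f k = v then 1 else 0), ⟨fun v => Finset.sum_nonneg fun k _ =>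
    mul_nonneg (y.2.1 k) (by split_ifs <;> norm_num), by rw [Finset.sum_comm]; simp only [← Finset.mul_sum]; simpa using y.2.2⟩, fun v hv => by
    have hv : ∑ k, y.1 k * (if f k = v then (1:ℝ) else 0) ≠ 0 := (mem_sp (y := fun v => ∑ k, y.1 k * (if f k = v then (1:ℝ) else 0))).1 hv
    obtain ⟨k, _, hk⟩ := Finset.exists_ne_zero_of_sum_ne_zero hv
    exact mem_rg.2 ⟨k, by by_contra h; simp [h] at hk⟩⟩, Continuous.subtype_mk (continuous_pi fun v =>
    continuous_finsetSum _ fun k _ => ((continuous_apply k).comp continuous_subtype_val).mul continuous_const) _⟩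

def pb (f : Fin (m+1) ↪ V) : C(ΔF (rg f), Δ m) := ⟨fun y => ⟨fun k => y.1 (f k), fun k => y.2.1.1 _, by
    rw [← y.2.1.2, ← Finset.sum_subset (Finset.subset_univ (rg f)) fun v _ hv => off y.2 hv]
    exact (Finset.sum_map _ _ _).symm⟩,
  Continuous.subtype_mk (continuous_pi fun k => (show Continuous ((fun z : V → ℝ => z (f k)) ∘ (Subtype.val : ΔF (rg f) → V → ℝ)) from (continuous_apply (f k)).comp continuous_subtype_val)) _⟩

lemma pb_pu (f : Fin (m+1) ↪ V) (y : Δ m) : pb f (pu f y) = y := by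
  refine Subtype.ext (funext fun k => ?_)
  change ∑ k', y.1 k' * (if f k' = f k then 1 else 0) = y.1 k
  simp

abbrev fe (f : Fin (m+2) ↪ V) (i : Fin (m+2)) : Fin (m+1) ↪ V := i.succAboveEmb.trans f
lemma rg_fe (f : Fin (m+2) ↪ V) (i : Fin (m+2)) : rg (fe f i) ⊆ rg f := fun v hv => by
  obtain ⟨k, rfl⟩ := mem_rg.1 hv
  exact mem_rg.2 ⟨_, rfl⟩

lemma pu_face (f : Fin (m+2) ↪ V) (i : Fin (m+2)) (y : Δ m) : pu f (face i y) = inc (rg_fe f i) (pu (fe f i) y) :=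
  Subtype.ext (funext fun v => sum_face i y (fun k => if f k = v then 1 else 0))

lemma pb_face (f : Fin (m+2) ↪ V) (i : Fin (m+2)) (y : ΔF (rg (fe f i))) : pb f (inc (rg_fe f i) y) = face i (pb (fe f i) y) := by
  refine Subtype.ext (funext fun k => ?_)
  refine Fin.succAboveCases i ?_ (fun l => ?_) k
  · rw [face_self]
    refine off y.2 fun h => ?_
    obtain ⟨k, hk⟩ := mem_rg.1 h
    exact Fin.succAbove_ne i k (f.injective hk)
  · rw [face_succAbove]; rfl

structure KH (V : Type) [Fintype V] [DecidableEq V] (B : Set X) where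
  H : ∀ A : Finset V, C(ΔF A, X) → C(ΔF A × ℝ, X)
  zero : ∀ A σ y, H A σ (y, 0) = σ y
  nat : ∀ A' A (h : A' ⊆ A) σ y t, H A σ (inc h y, t) = H A' (σ.comp (inc h)) (y, t)
  pres : ∀ A σ, (∀ y, σ y ∈ B) → ∀ p, H A σ p ∈ B

variable {B Y : Set X}
def KH.e (Φ : KH V B) (A : Finset V) (σ : C(ΔF A, X)) : C(ΔF A, X) := (Φ.H A σ).comp ⟨fun y => (y, 1), by fun_prop⟩

lemma KH.e_nat (Φ : KH V B) {A' A : Finset V} (h : A' ⊆ A) (σ : C(ΔF A, X)) : (Φ.e A σ).comp (inc h) = Φ.e A' (σ.comp (inc h)) :=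
  ContinuousMap.ext fun y => Φ.nat A' A h σ y 1

def KH.cst : KH V B := ⟨fun A σ => σ.comp ⟨Prod.fst, continuous_fst⟩, fun _ _ _ => rfl, fun _ _ _ _ _ _ => rfl, fun _ _ h p => h p.1⟩

def KH.cat (Φ Ψ : KH V B) : KH V B where
  H A σ := ⟨fun p => if 2 * p.2 ≤ 1 then Φ.H A σ (p.1, 2 * p.2) else Ψ.H A (Φ.e A σ) (p.1, 2 * p.2 - 1), by
    refine Continuous.if_le (by fun_prop) (by fun_prop) (by fun_prop) (by fun_prop) fun p hp => ?_
    rw [hp, sub_self, Ψ.zero]; rfl⟩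
  zero A σ y := by simp [Φ.zero]
  nat A' A h σ y t := by
    change (if _ then _ else _) = (if _ then _ else _)
    dsimp only
    rw [Φ.nat, Ψ.nat, Φ.e_nat]
  pres A σ h p := by
    change (if _ then _ else _) ∈ B
    split_ifs
    · exact Φ.pres A σ h _
    · exact Ψ.pres A _ (fun y => Φ.pres A σ h _) _

lemma KH.cat_e (Φ Ψ : KH V B) (A : Finset V) (σ : C(ΔF A, X)) : (Φ.cat Ψ).e A σ = Ψ.e A (Φ.e A σ) := by
  ext y
  change (if _ then _ else _) = Ψ.H A (Φ.e A σ) (y, 1)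
  rw [if_neg (by norm_num)]; norm_num

def hS (Φ : KH V B) (f : Fin (m+1) ↪ V) (σ : SSimplex X m) : C(PP m, X) :=
  (Φ.H (rg f) (σ.comp (pb f))).comp ⟨fun p => (pu f p.1, p.2), by fun_prop⟩

lemma hS_zero (Φ : KH V B) (f : Fin (m+1) ↪ V) (σ : SSimplex X m) (y : Δ m) : hS Φ f σ (y, 0) = σ y :=
  (Φ.zero _ _ _).trans (congrArg σ (pb_pu f y))

lemma hS_face (Φ : KH V B) (f : Fin (m+2) ↪ V) (σ : SSimplex X (m+1)) (i : Fin (m+2)) (p : PP m) : hS Φ f σ (fc i p) = hS Φ (fe f i) (faceOf σ i) p := by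
  change Φ.H (rg f) (σ.comp (pb f)) (pu f (face i p.1), p.2) = _
  rw [pu_face, Φ.nat]
  have : (σ.comp (pb f)).comp (inc (rg_fe f i)) = (faceOf σ i).comp (pb (fe f i)) := ContinuousMap.ext fun y => congrArg σ (pb_face f i y)
  rw [this]; rfl

def mD (T : Tup ℝ n m) (h : C(PP m, X)) : Ch ℝ X n := Finsupp.mapDomain (fun w => h.comp (aff w)) T

lemma dd_mD (T : Tup ℝ (n+1) m) (h : C(PP m, X)) : dd (mD T h) = mD (dL T) h :=
  bdF_nat (fun (i : Fin (n+2)) (w : Fin (n+2) → PP m) => w ∘ i.succAbove) (fun i σ => faceOf σ i) _ _ (fun i w => by rw [← aff_face]; rfl) T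

lemma mD_sub (T T' : Tup ℝ n m) (h : C(PP m, X)) : mD (T - T') h = mD T h - mD T' h :=
  map_sub (Finsupp.lmapDomain ℝ ℝ (fun w => h.comp (aff w))) T T'

lemma mD_idt (t : ℝ) (h : C(PP m, X)) : mD (idt ℝ t m) h = single (h.comp ((ContinuousMap.id _).prodMk (.const _ t))) 1 := by
  rw [mD, idt, Finsupp.mapDomain_single]
  congr 1
  ext y; exact congrArg h (aff_vtx t y)

lemma mD_fL (T : Tup ℝ n m) (h : C(PP (m+1), X)) : mD (fL T) h = ∑ i : Fin (m+2), ((-1:ℝ)^(i:ℕ)) • mD T (h.comp ⟨fc i, by unfold fc; fun_prop⟩) := by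
  rw [mD, fL, bdF_apply, Finsupp.mapDomain_finsetSum]
  refine Finset.sum_congr rfl fun i _ => ?_
  rw [Finsupp.mapDomain_smul, ← Finsupp.mapDomain_comp]
  congr 2
  funext w; ext y
  exact congrArg h (aff_fc w i y)

lemma sum_perm {M : Type*} [AddCommMonoid M] (U : (Fin (m+1) ↪ V) → M) (a b : Fin (m+1) ↪ V) : ∑ π : Equiv.Perm V, U (a.trans π.toEmbedding) = ∑ π : Equiv.Perm V, U (b.trans π.toEmbedding) := by
  obtain ⟨ρ, hρ⟩ : ∃ ρ : Equiv.Perm V, ∀ k, ρ (b k) = a k := by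
    let E : {x // x ∈ range b} ≃ {x // x ∈ range a} := (Equiv.ofInjective b b.injective).symm.trans (Equiv.ofInjective a a.injective)
    refine ⟨E.extendSubtype, fun k => (E.extendSubtype_apply_of_mem _ ⟨k, rfl⟩).trans ?_⟩
    change a ((Equiv.ofInjective b b.injective).symm ⟨b k, _⟩) = a k
    rw [Equiv.ofInjective_symm_apply]
  refine Fintype.sum_equiv (Equiv.mulRight ρ) _ _ fun π => ?_
  congr 1; ext k; simp [hρ]

def PB (Φ : KH V B) (m : ℕ) (a : Fin (m+1) ↪ V) : Ch ℝ X m →ₗ[ℝ] Ch ℝ X (m+1) :=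
  Finsupp.linearCombination ℝ fun σ => ∑ π : Equiv.Perm V, mD (TT (idt ℝ 0) (idt ℝ 1) m) (hS Φ (a.trans π.toEmbedding) σ)
def EB (Φ : KH V B) (m : ℕ) (a : Fin (m+1) ↪ V) : Ch ℝ X m →ₗ[ℝ] Ch ℝ X m :=
  Finsupp.linearCombination ℝ fun σ => ∑ π : Equiv.Perm V, single ((Φ.e _ (σ.comp (pb (a.trans π.toEmbedding)))).comp (pu (a.trans π.toEmbedding))) 1

lemma dd_PB (Φ : KH V B) (a : Fin (m+2) ↪ V) (b : Fin (m+1) ↪ V) (c : Ch ℝ X (m+1)) :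
    dd (PB Φ (m+1) a c) = EB Φ (m+1) a c - (Fintype.card (Equiv.Perm V) : ℝ) • c - PB Φ m b (dd c) := by
  refine ch_ext (f := dd ∘ₗ PB Φ (m+1) a) (g := EB Φ (m+1) a - (Fintype.card (Equiv.Perm V) : ℝ) • LinearMap.id - PB Φ m b ∘ₗ dd) (fun σ => ?_) c
  simp only [LinearMap.comp_apply, LinearMap.sub_apply, LinearMap.smul_apply, LinearMap.id_apply]
  have h1 : ∀ f : Fin (m+2) ↪ V, dd (mD (TT (idt ℝ 0) (idt ℝ 1) (m+1)) (hS Φ f σ)) = single ((Φ.e _ (σ.comp (pb f))).comp (pu f)) 1 - single σ 1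
      - ∑ i : Fin (m+2), ((-1:ℝ)^(i:ℕ)) • mD (TT (idt ℝ 0) (idt ℝ 1) m) (hS Φ (fe f i) (faceOf σ i)) := by
    intro f
    rw [dd_mD, (TT_spec (idt ℝ 0) (idt ℝ 1) (nat_idt 0) (nat_idt 1) (by simp [cyc, Finsupp.mapDomain_sub, idt])).2, mD_sub, mD_sub, mD_idt, mD_idt, mD_fL]
    congr 1
    · congr 2
      ext y; exact hS_zero Φ f σ y
    · refine Finset.sum_congr rfl fun i _ => ?_
      congr 2
      ext p; exact hS_face Φ f σ i p
  have h2 : (dd (single σ (1:ℝ)) : Ch ℝ X m) = ∑ i : Fin (m+2), ((-1:ℝ)^(i:ℕ)) • single (faceOf σ i) 1 := by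
    rw [dd, bdF_apply]; simp [Finsupp.mapDomain_single]
  rw [h2, PB, EB, PB, Finsupp.linearCombination_single, Finsupp.linearCombination_single, one_smul, one_smul, map_sum, map_sum]
  simp only [h1, map_smul, Finsupp.linearCombination_single, one_smul, Finset.sum_sub_distrib]
  congr 1
  · congr 1
    rw [Finset.sum_const, Finset.card_univ, ← Nat.cast_smul_eq_nsmul ℝ]
  · rw [Finset.sum_comm]
    refine Finset.sum_congr rfl fun i _ => ?_
    rw [← Finset.smul_sum]
    congr 1
    exact sum_perm (fun f => mD (TT (idt ℝ 0) (idt ℝ 1) m) (hS Φ f (faceOf σ i))) (i.succAboveEmb.trans a) b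

lemma PB_mem (hYB : Y ⊆ B) (hY : ∀ γ : C(ℝ, X), (∀ t, γ t ∈ B) → γ 0 ∈ Y → ∀ t, γ t ∈ Y) (Φ : KH V B) (a : Fin (m+1) ↪ V) (c : Ch ℝ X m) (hc : c ∈ supp ℝ {Y} m) :
    PB Φ m a c ∈ supp ℝ {Y} (m+1) := by
  refine supp_le (P := (supp ℝ {Y} (m+1)).comap (PB Φ m a)) (fun σ ⟨A, hA, hs⟩ => ?_) hc
  rw [Submodule.mem_comap, PB, Finsupp.linearCombination_single, one_smul]
  obtain rfl : A = Y := hA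
  refine Submodule.sum_mem _ fun π _ => ?_
  have hk : ∀ p, hS Φ (a.trans π.toEmbedding) σ p ∈ A := fun p => by
    refine hY ((hS Φ (a.trans π.toEmbedding) σ).comp ⟨fun t => (p.1, t), by fun_prop⟩) (fun t => ?_) ?_ p.2
    · exact Φ.pres _ _ (fun y => hYB (hs ⟨_, rfl⟩)) _
    · change hS Φ (a.trans π.toEmbedding) σ (p.1, 0) ∈ A
      rw [hS_zero]; exact hs ⟨_, rfl⟩
  rw [mD, Finsupp.mapDomain, Finsupp.sum]
  refine Submodule.sum_mem _ fun w _ => ?_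
  refine single_mem_supp (Set.mem_singleton A) ?_ _
  rintro _ ⟨y, rfl⟩
  exact hk _

end F11

section F12
open Set Filter
open Finsupp (single)
variable {n : ℕ} {B Y : Set X}

abbrev Coch (X : Type) [TopologicalSpace X] (n : ℕ) := ∀ f : Fin (n+2) ↪ Fin (n+3), C(ΔF (rg f), X) → ℝ
def a0 (n : ℕ) : Fin (n+2) ↪ Fin (n+3) := (0 : Fin (n+3)).succAboveEmb

structure GG (φ : Ch ℝ X (n+1) →ₗ[ℝ] ℝ) (B Y : Set X) (ψ : Coch X n) : Prop where
  bd : ∀ f σ, |ψ f σ| ≤ 1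
  co : ∀ (π : Fin (n+3) ↪ Fin (n+3)) (τ : C(ΔF (rg π), X)), ∑ i : Fin (n+3), ((-1:ℝ)^(i:ℕ)) * ψ (fe π i) (τ.comp (inc (rg_fe π i))) = 0
  val : ∀ (Φ : KH (Fin (n+3)) B) (z : Ch ℝ X (n+1)), dd z ∈ supp ℝ {Y} n → Finsupp.linearCombination ℝ (fun σ => ∑ π : Equiv.Perm (Fin (n+3)),
    ψ ((a0 n).trans π.toEmbedding) (Φ.e _ (σ.comp (pb ((a0 n).trans π.toEmbedding))))) z = Fintype.card (Equiv.Perm (Fin (n+3))) * φ z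

lemma GG_start (hYB : Y ⊆ B) (hY : ∀ γ : C(ℝ, X), (∀ t, γ t ∈ B) → γ 0 ∈ Y → ∀ t, γ t ∈ Y) (φ : Ch ℝ X (n+1) →ₗ[ℝ] ℝ) (hb : ∀ σ, |φ (single σ 1)| ≤ 1)
    (hd : ∀ c, φ (dd c) = 0) (h0 : ∀ c ∈ supp ℝ {Y} (n+1), φ c = 0) : GG φ B Y (fun f σ => φ (single (σ.comp (pu f)) 1)) where
  bd f σ := hb _
  co π τ := by
    rw [← hd (single (τ.comp (pu π)) 1), dd, bdF_apply, map_sum]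
    refine Finset.sum_congr rfl fun i _ => ?_
    rw [map_smul, smul_eq_mul, Finsupp.mapDomain_single]
    congr 3
    ext y; exact congrArg τ (pu_face π i y).symm
  val Φ z hz := by
    have e1 : Finsupp.linearCombination ℝ (fun σ => ∑ π : Equiv.Perm (Fin (n+3)), φ (single ((Φ.e _ (σ.comp (pb ((a0 n).trans π.toEmbedding)))).comp (pu ((a0 n).trans π.toEmbedding))) 1)) z
        = φ (EB Φ (n+1) (a0 n) z) := by
      refine ch_ext (g := φ ∘ₗ EB Φ (n+1) (a0 n)) (fun σ => ?_) z
      rw [LinearMap.comp_apply, EB, Finsupp.linearCombination_single, Finsupp.linearCombination_single, one_smul, one_smul, map_sum]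
    have e2 := dd_PB Φ (a0 n) (fe (a0 n) 0) z
    have e3 : EB Φ (n+1) (a0 n) z = dd (PB Φ (n+1) (a0 n) z) + PB Φ n (fe (a0 n) 0) (dd z) + (Fintype.card (Equiv.Perm (Fin (n+3))) : ℝ) • z := by
      rw [e2]; abel
    rw [e1, e3, map_add, map_add, hd, h0 _ (PB_mem hYB hY Φ _ _ hz), map_smul, smul_eq_mul, zero_add, zero_add]

lemma GG_step {G : Type} {φ : Ch ℝ X (n+1) →ₗ[ℝ] ℝ} {ψ : Coch X n} (h : GG φ B Y ψ) (Φ : G → KH (Fin (n+3)) B) (m : (G → ℝ) →ₗ[ℝ] ℝ)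
    (hm : ∀ f C, Bd f C → |m f| ≤ C) (h1 : m (fun _ => 1) = 1) : GG φ B Y (fun f σ => m fun g => ψ f ((Φ g).e _ σ)) where
  bd f σ := hm _ _ fun g => h.bd _ _
  co π τ := by
    have : ∑ i : Fin (n+3), ((-1:ℝ)^(i:ℕ)) • (fun g => ψ (fe π i) ((Φ g).e _ (τ.comp (inc (rg_fe π i))))) = 0 := by
      funext g
      rw [Finset.sum_apply, Pi.zero_apply, ← h.co π ((Φ g).e _ τ)]
      refine Finset.sum_congr rfl fun i _ => ?_
      rw [KH.e_nat]; rfl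
    have := congrArg m this
    rw [map_sum, map_zero] at this
    rw [← this]
    exact Finset.sum_congr rfl fun i _ => (by rw [map_smul, smul_eq_mul])
  val Ψ z hz := by
    have e1 : ∀ z : Ch ℝ X (n+1), Finsupp.linearCombination ℝ (fun σ => ∑ π : Equiv.Perm (Fin (n+3)),
        m (fun g => ψ ((a0 n).trans π.toEmbedding) ((Φ g).e _ (Ψ.e _ (σ.comp (pb ((a0 n).trans π.toEmbedding))))))) z = m (fun g => Finsupp.linearCombination ℝ (fun σ => ∑ π : Equiv.Perm (Fin (n+3)),
        ψ ((a0 n).trans π.toEmbedding) ((Φ g).e _ (Ψ.e _ (σ.comp (pb ((a0 n).trans π.toEmbedding)))))) z) := by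
      intro z
      refine ch_ext (g := m ∘ₗ LinearMap.pi fun g => Finsupp.linearCombination ℝ (fun σ => ∑ π : Equiv.Perm (Fin (n+3)),
        ψ ((a0 n).trans π.toEmbedding) ((Φ g).e _ (Ψ.e _ (σ.comp (pb ((a0 n).trans π.toEmbedding))))))) (fun σ => ?_) z
      rw [LinearMap.comp_apply, Finsupp.linearCombination_single, one_smul, ← map_sum]
      congr 1
      funext g
      simp [Finset.sum_apply, LinearMap.pi_apply]
    rw [e1]
    have e2 : (fun g => Finsupp.linearCombination ℝ (fun σ => ∑ π : Equiv.Perm (Fin (n+3)),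
        ψ ((a0 n).trans π.toEmbedding) ((Φ g).e _ (Ψ.e _ (σ.comp (pb ((a0 n).trans π.toEmbedding)))))) z) = (Fintype.card (Equiv.Perm (Fin (n+3))) * φ z) • (fun _ : G => (1:ℝ)) := by
      funext g
      have := h.val (Ψ.cat (Φ g)) z hz
      simp only [KH.cat_e] at this
      rw [this]; simp
    rw [e2, map_smul, h1, smul_eq_mul, mul_one]

section paths
open Path
variable {T : Type} [TopologicalSpace T]

def pth (q : ZerothHomotopy T) (τ : T) (h : Quotient.mk _ τ = q) : Path τ q.out := (Quotient.exact (h.trans q.out_eq.symm) : Joined τ q.out).somePath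

def Dq (q : ZerothHomotopy T) (γ : FundamentalGroup T q.out) (τ : T) (h : Quotient.mk _ τ = q) : Path τ q.out :=
  (pth q τ h).trans (Homotopic.Quotient.mk_surjective (γ⁻¹ : FundamentalGroup T q.out)).choose

def eta (q : ZerothHomotopy T) {τ τ' : T} (H : Path τ τ') (h : Quotient.mk _ τ = q) (h' : Quotient.mk _ τ' = q) : FundamentalGroup T q.out :=
  (show FundamentalGroup T q.out from ((Homotopic.Quotient.mk (pth q τ h)).symm.trans (Homotopic.Quotient.mk H)).trans (Homotopic.Quotient.mk (pth q τ' h')))⁻¹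

lemma Dq_mk (q : ZerothHomotopy T) (γ : FundamentalGroup T q.out) (τ : T) (h : Quotient.mk _ τ = q) :
    Homotopic.Quotient.mk (Dq q γ τ h) = (Homotopic.Quotient.mk (pth q τ h)).trans (γ⁻¹ : FundamentalGroup T q.out) := by
  rw [Dq, Homotopic.Quotient.mk_trans, (Homotopic.Quotient.mk_surjective (γ⁻¹ : FundamentalGroup T q.out)).choose_spec]

lemma Dq_eta (q : ZerothHomotopy T) {τ τ' : T} (H : Path τ τ') (h : Quotient.mk _ τ = q) (h' : Quotient.mk _ τ' = q) (γ : FundamentalGroup T q.out) :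
    Homotopic.Quotient.mk (Dq q (eta q H h h' * γ) τ h) = (Homotopic.Quotient.mk H).trans (Homotopic.Quotient.mk (Dq q γ τ' h')) := by
  rw [Dq_mk, Dq_mk, mul_inv_rev, eta, inv_inv, FundamentalGroup.mul_def]
  simp only [← Homotopic.Quotient.trans_assoc, Homotopic.Quotient.trans_symm, Homotopic.Quotient.refl_trans]

lemma null_of {a b c d x : T} (E1 : Path a c) (H : Path a b) (E2 : Path b d) (D1 : Path a x) (D2 : Path b x) (h1 : ∀ t, E1 t = D1 t) (h2 : ∀ t, E2 t = D2 t)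
    (hn : Homotopic.Quotient.mk D1 = (Homotopic.Quotient.mk H).trans (Homotopic.Quotient.mk D2)) :
    ∃ (x : T) (q : Path x x), (∀ t, q t = (E1.symm.trans (H.trans E2)) t) ∧ q.Homotopic (Path.refl x) := by
  obtain rfl : c = x := by rw [← E1.target, h1, D1.target]
  obtain rfl : d = c := by rw [← E2.target, h2, D2.target]
  obtain rfl : E1 = D1 := Path.ext (funext h1)
  obtain rfl : E2 = D2 := Path.ext (funext h2)
  refine ⟨_, _, fun t => rfl, ?_⟩
  rw [← Homotopic.Quotient.eq, Homotopic.Quotient.mk_trans, Homotopic.Quotient.mk_trans, ← hn, Homotopic.Quotient.mk_symm, Homotopic.Quotient.symm_trans]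
  rfl
end paths

variable {V : Type} [Fintype V] [DecidableEq V] {j : ℕ} {A A' : Finset V}

def vl (σ : C(ΔF A, B)) : C(ΔF A, X) := (⟨Subtype.val, continuous_subtype_val⟩ : C(B, X)).comp σ
def ob (σ : C(ΔF A, X)) (h : ∀ y, σ y ∈ B) : WW j A B := WW.of j ⟨fun y => ⟨σ y, h y⟩, Continuous.subtype_mk σ.continuous _⟩

abbrev Idx (V : Type) [Fintype V] [DecidableEq V] (j : ℕ) (B : Set X) := Σ A : {A : Finset V // A.card = j}, ZerothHomotopy (WW j A.1 B)
abbrev Gp (V : Type) [Fintype V] [DecidableEq V] (j : ℕ) (B : Set X) := ∀ i : Idx V j B, FundamentalGroup (WW j i.1.1 B) (Quotient.out i.2)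

open Classical in
def dat (g : Gp V j B) (A : Finset V) (τ : C(ΔF A, X)) : C(ΔF A × ℝ, X) :=
  if h : A.card = j ∧ ∀ y, τ y ∈ B then (⟨Subtype.val, continuous_subtype_val⟩ : C(B, X)).comp (pH (Dq _ (g ⟨⟨A, h.1⟩, Quotient.mk _ (ob τ h.2)⟩) (ob τ h.2) rfl))
  else τ.comp ⟨Prod.fst, continuous_fst⟩

lemma dat_zero (g : Gp V j B) (A : Finset V) (τ : C(ΔF A, X)) (y) : dat g A τ (y, 0) = τ y := by
  unfold dat; split_ifs with h
  · exact congrArg Subtype.val (pH_zero _ y)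
  · rfl

lemma dat_stat (g : Gp V j B) (A : Finset V) (τ : C(ΔF A, X)) (y t) (hy : (sp y.1).card < j) : dat g A τ (y, t) = τ y := by
  unfold dat; split_ifs with h
  · exact congrArg Subtype.val (pH_stat _ y t hy)
  · rfl

lemma dat_mem (g : Gp V j B) (A : Finset V) (τ : C(ΔF A, X)) (h : ∀ y, τ y ∈ B) (p) : dat g A τ p ∈ B := by
  unfold dat; split_ifs
  · exact Subtype.prop _
  · exact h p.1

lemma dat_eq (g : Gp V j B) (A : Finset V) (τ : WW j A B) (hA : A.card = j) (q) (hq : Quotient.mk _ τ = q) (y) (t : unitInterval) :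
    dat g A (vl τ.m) (y, (t:ℝ)) = ((Dq q (g ⟨⟨A, hA⟩, q⟩) τ hq t).m y).1 := by
  subst hq
  unfold dat
  rw [dif_pos ⟨hA, fun y => (τ.m y).2⟩]
  exact congrArg Subtype.val (pH_mem _ y t)

lemma dat_Dat (g : Gp V j B) (σ : C(ΔF A, X)) : Dat j σ (fun A' h => dat g A' (σ.comp (inc h))) :=
  ⟨fun A' h y _ => dat_zero g A' _ y, fun A' h y t _ hy => dat_stat g A' _ y t hy⟩

def KG (g : Gp V j B) : KH V B where
  H A σ := ⟨extF j σ (fun A' h => dat g A' (σ.comp (inc h))), extF_cont (dat_Dat g σ)⟩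
  zero A σ y := extF_start (dat_Dat g σ) y
  nat A' A h σ y t := rfl
  pres A σ h p := extF_mem (G := fun A' hA => dat g A' (σ.comp (inc hA))) h (fun A' hA p => dat_mem g A' (σ.comp (inc hA)) (fun y => h _) p) p

lemma KG_path (g : Gp V j B) (σ : WW j A B) : ∃ (e : WW j A B) (P : Path σ e), (∀ t y, ((P t).m y).1 = (KG g).H A (vl σ.m) (y, t)) ∧ vl e.m = (KG g).e A (vl σ.m) := by
  have hB : ∀ p, (KG g).H A (vl σ.m) p ∈ B := (KG g).pres A _ fun y => (σ.m y).2
  have hs : ∀ y t, (sp y.1).card < j → (KG g).H A (vl σ.m) (y, t) = vl σ.m y := fun y t hy => extF_stat (dat_Dat g (vl σ.m)) y hy t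
  obtain ⟨K, hK⟩ : ∃ K : C(ΔF A × ℝ, B), ∀ p, (K p).1 = (KG g).H A (vl σ.m) p := ⟨⟨fun p => ⟨_, hB p⟩, Continuous.subtype_mk (ContinuousMap.continuous _) _⟩, fun p => rfl⟩
  refine ⟨WW.of j (K.comp ⟨fun y => (y, 1), by fun_prop⟩), ⟨⟨fun t => WW.of j (K.comp ⟨fun y => (y, (t:ℝ)), by fun_prop⟩), ?_⟩, ?_, rfl⟩, fun t y => hK _, ?_⟩
  · refine WW_cont ?_ fun t => Eventually.of_forall fun t' y hy => Subtype.ext ?_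
    · change Continuous fun p : unitInterval × ΔF A => K (p.2, (p.1:ℝ)); fun_prop
    · exact (hK _).trans ((hs y t' hy).trans ((hs y t hy).symm.trans (hK _).symm))
  · refine WW.ext fun y => Subtype.ext ?_
    change (K (y, 0)).1 = _; rw [hK, (KG g).zero]; rfl
  · ext y; exact hK _

lemma KG_rs (g : Gp V j B) (σ : WW j A B) {e : WW j A B} (P : Path σ e) (hP : ∀ t y, ((P t).m y).1 = (KG g).H A (vl σ.m) (y, t)) (hA : A' ⊆ A) (hc : A'.card = j) (q)
    (hq : Quotient.mk _ (σ.rs hA) = q) (t) : (P t).rs hA = Dq q (g ⟨⟨A', hc⟩, q⟩) (σ.rs hA) hq t := by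
  refine WW.ext fun y => Subtype.ext ?_
  rw [← dat_eq g A' _ hc q hq]
  change ((P t).m (inc hA y)).1 = _
  rw [hP]
  refine (extF_face (dat_Dat g (vl σ.m)) hA hc.le y t).trans ?_
  have : cl (t:ℝ) = t := by unfold cl; rw [min_eq_left t.2.2, max_eq_right t.2.1]
  rw [this]; rfl

open Classical in
lemma KG_joined {σ σ' : WW j A B} (H : Path σ σ') : ∃ h : Gp V j B, ∀ g : Gp V j B, ∃ e e' : WW j A B, vl e.m = (KG (h * g)).e A (vl σ.m) ∧ vl e'.m = (KG g).e A (vl σ'.m) ∧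
    Joined (WW.of (j+1) e.m) (WW.of (j+1) e'.m) := by
  have hcl : ∀ {A' : Finset V} (hA : A' ⊆ A) q, Quotient.mk _ (σ.rs hA) = q → (Quotient.mk _ (σ'.rs hA) : ZerothHomotopy (WW j A' B)) = q := fun hA q hq => by
    rw [← hq]; exact Quotient.sound ⟨(H.map (rs_cont hA)).symm⟩
  refine ⟨fun i => if hi : ∃ hA : i.1.1 ⊆ A, Quotient.mk _ (σ.rs hA) = i.2 then eta i.2 (H.map (rs_cont hi.1)) hi.2 (hcl hi.1 _ hi.2) else 1, fun g => ?_⟩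
  obtain ⟨h, hh⟩ : ∃ h : Gp V j B, h = fun i => if hi : ∃ hA : i.1.1 ⊆ A, Quotient.mk _ (σ.rs hA) = i.2 then eta i.2 (H.map (rs_cont hi.1)) hi.2 (hcl hi.1 _ hi.2) else 1 := ⟨_, rfl⟩
  rw [← hh]
  obtain ⟨e, P, hP, he⟩ := KG_path (h * g) σ
  obtain ⟨e', P', hP', he'⟩ := KG_path g σ'
  refine ⟨e, e', he, he', joined_null (P.symm.trans (H.trans P')) fun A' hA hc => ?_⟩
  obtain ⟨q, hq⟩ : ∃ q : ZerothHomotopy (WW j A' B), Quotient.mk _ (σ.rs hA) = q := ⟨_, rfl⟩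
  obtain ⟨x, r, hr, hr'⟩ := null_of (P.map (rs_cont hA)) (H.map (rs_cont hA)) (P'.map (rs_cont hA)) (Dq q ((h * g) ⟨⟨A', hc⟩, q⟩) (σ.rs hA) hq) (Dq q (g ⟨⟨A', hc⟩, q⟩) (σ'.rs hA) (hcl hA q hq))
    (fun t => KG_rs _ σ P hP hA hc q hq t) (fun t => KG_rs _ σ' P' hP' hA hc q _ t) (by
      have : (h * g) ⟨⟨A', hc⟩, q⟩ = eta q (H.map (rs_cont hA)) hq (hcl hA q hq) * g ⟨⟨A', hc⟩, q⟩ := by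
        have : h ⟨⟨A', hc⟩, q⟩ = eta q (H.map (rs_cont hA)) hq (hcl hA q hq) := by rw [hh]; exact dif_pos ⟨hA, hq⟩
        exact congrArg (· * _) this
      rw [this]
      exact Dq_eta _ _ _ _ _)
  refine ⟨x, r, fun t => ?_, hr'⟩
  rw [hr, Path.map_symm, ← Path.map_trans, ← Path.map_trans]; rfl

def JJ (j : ℕ) (B : Set X) (ψ : Coch X n) : Prop := ∀ f (α β : WW j (rg f) B), Joined α β → ψ f (vl α.m) = ψ f (vl β.m)

lemma JJ_step {φ : Ch ℝ X (n+1) →ₗ[ℝ] ℝ} {ψ : Coch X n} (h : GG φ B Y ψ) (hJ : JJ (j+1) B ψ) (hG : HasMean (Gp (Fin (n+3)) j B)) :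
    ∃ ψ' : Coch X n, GG φ B Y ψ' ∧ JJ j B ψ' := by
  obtain ⟨m, hm, h1, ht⟩ := hG
  refine ⟨_, GG_step h (fun g => KG g) m hm h1, fun f α β ⟨H⟩ => ?_⟩
  obtain ⟨η, hη⟩ := KG_joined H
  rw [← ht η _ 1 (fun g => h.bd _ _)]
  congr 1
  funext g
  obtain ⟨e, e', he, he', hj⟩ := hη g
  change ψ f ((KG (η * g)).e _ (vl α.m)) = ψ f ((KG g).e _ (vl β.m))
  rw [← he, ← he']
  exact hJ f _ _ hj
end F12

section F13
open Set Filter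
open Finsupp (single)

lemma HasMean.of_lift {S T : Type} [TopologicalSpace S] [TopologicalSpace T] (f : C(S, T)) (s : S) (t : T) (hst : f s = t) (hl : ∀ p : Path t t, ∃ q : Path s s, ∀ u, f (q u) = p u)
    (h : HasMean (FundamentalGroup S s)) : HasMean (FundamentalGroup T t) := by
  subst hst
  refine h.map (FundamentalGroup.map f s) fun γ => ?_
  obtain ⟨p, hp⟩ := Path.Homotopic.Quotient.mk_surjective (γ : Path.Homotopic.Quotient (f s) (f s))
  obtain ⟨q, hq⟩ := hl p
  refine ⟨(Path.Homotopic.Quotient.mk q : Path.Homotopic.Quotient s s), ?_⟩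
  change Path.Homotopic.Quotient.mk (q.map f.continuous) = γ
  rw [← hp]
  congr 1
  ext u; exact hq u

section one
variable {V : Type} [Fintype V] [DecidableEq V] {A : Finset V} {Z : Type} [TopologicalSpace Z]

lemma sp_pos (y : ΔF A) : ¬ (sp y.1).card < 1 := by
  intro h
  have h0 : sp y.1 = ∅ := Finset.card_eq_zero.1 (by omega)
  have := y.2.1.2
  rw [Finset.sum_eq_zero fun v _ => by_contra fun hv => by simpa [h0] using mem_sp.2 hv] at this
  norm_num at this

def kW : C(Z, WW 1 A Z) := ⟨fun b => WW.of 1 (.const _ b), WW_cont (by exact continuous_fst) fun t => Eventually.of_forall fun t' y hy => absurd hy (sp_pos y)⟩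

lemma kW_surj (hA : A.card = 1) : ∃ y : ΔF A, ∀ e : WW 1 A Z, kW (e.m y) = e := by
  obtain ⟨v, rfl⟩ := Finset.card_eq_one.1 hA
  have hs : ∀ y : ΔF ({v} : Finset V), y.1 = Pi.single v 1 := fun y => by
    have h1 := y.2.1.2
    rw [Finset.sum_eq_single v (fun w _ hw => off y.2 (by simpa using hw)) (by simp)] at h1
    funext w
    by_cases hw : w = v
    · subst hw; simpa using h1
    · rw [Pi.single_eq_of_ne hw]; exact off y.2 (by simpa using hw)
  refine ⟨⟨Pi.single v 1, single_mem_stdSimplex ℝ v, fun w hw => by_contra fun h => mem_sp.1 hw (Pi.single_eq_of_ne (by simpa using h) _)⟩, fun e => WW.ext fun y => ?_⟩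
  change e.m _ = e.m y
  congr 1; exact Subtype.ext (hs y).symm

lemma hasMean_one (hZ : ∀ b : Z, HasMean (FundamentalGroup Z b)) (hA : A.card = 1) (e : WW 1 A Z) : HasMean (FundamentalGroup (WW 1 A Z) e) := by
  obtain ⟨y, hy⟩ := kW_surj (Z := Z) hA
  have hc : Continuous fun e : WW 1 A Z => e.m y := WW_ev.comp (Continuous.prodMk_left y)
  exact (hZ (e.m y)).of_lift kW _ _ (hy e) fun p => ⟨p.map hc, fun u => hy _⟩

lemma hasMean_Gp {B : Set X} (hf : Finite (ZerothHomotopy B)) (hB : ∀ b : B, HasMean (FundamentalGroup B b)) (j : ℕ) (hj : 1 ≤ j) : HasMean (Gp V j B) := by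
  rcases hj.lt_or_eq with hj | rfl
  · exact hasMean_comm fun a b => funext fun i => WW_comm (by rw [i.1.2]; exact hj) i.1.2 _ _ _
  · have : ∀ A : {A : Finset V // A.card = 1}, Finite (ZerothHomotopy (WW 1 A.1 B)) := fun A => by
      obtain ⟨y, hy⟩ := kW_surj (Z := B) A.2
      refine @Finite.of_surjective (ZerothHomotopy B) (ZerothHomotopy (WW 1 A.1 B)) hf (Quotient.map (kW (A := A.1)) fun a b (h : Joined a b) => (show Joined _ _ from h.elim fun p => ⟨p.map kW.continuous⟩)) fun q => ?_
      obtain ⟨e, rfl⟩ := Quotient.exists_rep q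
      exact ⟨Quotient.mk _ (e.m y), congrArg (Quotient.mk _) (hy e)⟩
    exact HasMean.pi _ fun i => hasMean_one hB i.1.2 _
end one

lemma exists_JJ {n : ℕ} {B Y : Set X} {φ : Ch ℝ X (n+1) →ₗ[ℝ] ℝ} {ψ : Coch X n} (h : GG φ B Y ψ) (hf : Finite (ZerothHomotopy B)) (hB : ∀ b : B, HasMean (FundamentalGroup B b)) :
    ∃ ψ' : Coch X n, GG φ B Y ψ' ∧ JJ 1 B ψ' := by
  have : ∀ k, k ≤ n + 2 → ∃ ψ' : Coch X n, GG φ B Y ψ' ∧ JJ (n + 3 - k) B ψ' := by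
    intro k
    induction k with
    | zero =>
      refine fun _ => ⟨ψ, h, fun f α β ⟨H⟩ => ?_⟩
      congr 1
      ext y
      have := WW_stat H.continuous 0 1 y (((Finset.card_le_card y.2.2).trans (rg_card f).le).trans_lt (by omega))
      rw [H.source, H.target] at this
      exact congrArg Subtype.val this
    | succ k ih =>
      intro hk
      obtain ⟨ψ', h1, h2⟩ := ih (by omega)
      rw [show n + 3 - k = (n + 3 - (k + 1)) + 1 by omega] at h2
      exact JJ_step h1 h2 (hasMean_Gp hf hB _ (by omega))
  have := this (n + 2) le_rfl
  rwa [show n + 3 - (n + 2) = 1 by omega] at this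

section alt
open Equiv
def altt (n : ℕ) : Tup ℝ n n := ((n+1).factorial : ℝ)⁻¹ • ∑ π : Perm (Fin (n+1)), single (vtx n 0 ∘ π) ((Perm.sign π : ℤ) : ℝ)

def pij {n : ℕ} (i : Fin (n+2)) (p : Fin (n+2) × Perm (Fin (n+1))) : Perm (Fin (n+2)) := p.1.cycleRange.symm * (Perm.decomposeFin.symm (0, p.2) * i.cycleRange)

lemma pij_self {n : ℕ} (i : Fin (n+2)) (p) : pij i p i = p.1 := by
  rw [pij, Perm.mul_apply, Perm.mul_apply, Fin.cycleRange_self, Perm.decomposeFin_symm_apply_zero, Fin.cycleRange_symm_zero]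
lemma pij_succ {n : ℕ} (i : Fin (n+2)) (p) (k : Fin (n+1)) : pij i p (i.succAbove k) = p.1.succAbove (p.2 k) := by
  rw [pij, Perm.mul_apply, Perm.mul_apply, Fin.cycleRange_succAbove, Perm.decomposeFin_symm_apply_succ, swap_self, refl_apply, Fin.cycleRange_symm_succ]
lemma pij_bij {n : ℕ} (i : Fin (n+2)) : Function.Bijective (pij i) := by
  refine (Fintype.bijective_iff_injective_and_card _).2 ⟨fun p q h => ?_, ?_⟩
  · have h1 : p.1 = q.1 := by rw [← pij_self i p, h, pij_self]
    refine Prod.ext h1 (Equiv.ext fun k => ?_)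
    have := pij_succ i p k
    rw [h, pij_succ, h1] at this
    exact (Fin.succAbove_right_injective this).symm
  · rw [Fintype.card_prod, Fintype.card_perm, Fintype.card_perm, Fintype.card_fin, Fintype.card_fin, Nat.factorial_succ (n+1)]
lemma pij_sign {n : ℕ} (i : Fin (n+2)) (p) : ((-1:ℝ)^(i:ℕ)) * ((Perm.sign (pij i p) : ℤ) : ℝ) = ((-1:ℝ)^(p.1:ℕ)) * ((Perm.sign p.2 : ℤ) : ℝ) := by
  rw [pij, Perm.sign_mul, Perm.sign_mul, Perm.sign_symm, Fin.sign_cycleRange, Fin.sign_cycleRange, Perm.decomposeFin.symm_sign, if_pos rfl, one_mul]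
  push_cast
  have : ((-1:ℝ)^(i:ℕ)) * ((-1:ℝ)^(i:ℕ)) = 1 := by rw [← mul_pow]; norm_num
  linear_combination ((-1:ℝ)^(p.1:ℕ)) * ((Perm.sign p.2 : ℤ) : ℝ) * this

lemma nat_altt : NatCh altt := by
  intro n
  rw [dL, fL, altt, altt, map_smul, map_smul, bdF_apply, bdF_apply]
  simp_rw [Finsupp.mapDomain_finsetSum, Finsupp.mapDomain_single, Finset.smul_sum, Finsupp.smul_single, smul_eq_mul]
  have e : ∀ i : Fin (n+2), ∑ π : Perm (Fin (n+2)), single ((vtx (n+1) 0 ∘ π) ∘ i.succAbove) (((n+1+1).factorial : ℝ)⁻¹ * (((-1:ℝ)^(i:ℕ)) * ((Perm.sign π : ℤ) : ℝ)))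
      = ∑ p : Fin (n+2) × Perm (Fin (n+1)), single (fc p.1 ∘ vtx n 0 ∘ p.2) (((n+1+1).factorial : ℝ)⁻¹ * (((-1:ℝ)^(p.1:ℕ)) * ((Perm.sign p.2 : ℤ) : ℝ))) := fun i => by
    rw [← (pij_bij i).sum_comp]
    refine Finset.sum_congr rfl fun p _ => ?_
    rw [pij_sign]
    congr 1
    funext k
    change (dv (pij i p (i.succAbove k)), (0:ℝ)) = (face p.1 (dv (p.2 k)), (0:ℝ))
    rw [pij_succ, face_dv]
  rw [Finset.sum_congr rfl fun i _ => e i, Finset.sum_const, Finset.card_univ, Fintype.card_fin, Fintype.sum_prod_type, Finset.smul_sum]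
  refine Finset.sum_congr rfl fun j _ => ?_
  rw [Finset.smul_sum]
  refine Finset.sum_congr rfl fun ρ _ => ?_
  rw [Finsupp.smul_single, nsmul_eq_mul, ← mul_assoc]
  congr 2
  have := Nat.factorial_ne_zero (n+1)
  rw [Nat.factorial_succ (n+1)]; push_cast; field_simp; ring

lemma altt_zero : altt 0 = idt ℝ 0 0 := by
  have : (Finset.univ : Finset (Perm (Fin (0+1)))) = {1} := by decide
  rw [altt, idt, this, Finset.sum_singleton]; simp

lemma sum_sign (n : ℕ) : ∑ π : Perm (Fin (n+2)), ((Perm.sign π : ℤ) : ℝ) = 0 := by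
  have := Matrix.det_zero_of_row_eq (M := Matrix.of fun _ _ : Fin (n+2) => (1:ℝ)) (i := 0) (j := 1) (by simp) rfl
  rw [Matrix.det_apply'] at this
  simpa using this
end alt

def ctr {m : ℕ} (x : Δ m) : C(Δ m × ℝ, Δ m) := ⟨fun p => ⟨(1 - cl p.2) • p.1.1 + cl p.2 • x.1, (convex_stdSimplex ℝ _) p.1.2 x.2 (by linarith [(cl_mem p.2).2]) (cl_mem p.2).1 (by ring)⟩, by
  have := cl_cont
  exact Continuous.subtype_mk (by fun_prop) _⟩

lemma JJ_const {n : ℕ} {B : Set X} {ψ : Coch X n} (h : JJ 1 B ψ) (f) (σ : SSimplex X (n+1)) (hσ : range σ ⊆ B) (x : Δ (n+1)) : ψ f (σ.comp (pb f)) = ψ f (.const _ (σ x)) := by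
  obtain ⟨σ', hs⟩ : ∃ σ' : C(Δ (n+1), B), ∀ y, (σ' y).1 = σ y := ⟨⟨fun y => ⟨σ y, hσ ⟨y, rfl⟩⟩, Continuous.subtype_mk σ.continuous _⟩, fun _ => rfl⟩
  have e1 : σ.comp (pb f) = vl (WW.of 1 (σ'.comp (pb f))).m := ContinuousMap.ext fun y => (hs _).symm
  have e2 : ContinuousMap.const (ΔF (rg f)) (σ x) = vl (WW.of 1 (.const _ (σ' x))).m := ContinuousMap.ext fun y => (hs _).symm
  rw [e1, e2]
  refine h f _ _ (joined_of (σ'.comp ((ctr x).comp ⟨fun p => (pb f p.1, p.2), by fun_prop⟩)) (fun y t hy => absurd hy (sp_pos y)) (fun y => ?_) fun y => ?_)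
  · exact congrArg σ' (Subtype.ext (by change _ = (1 - cl 0) • _ + cl 0 • _; rw [cl_zero]; simp))
  · exact congrArg σ' (Subtype.ext (by change _ = (1 - cl 1) • _ + cl 1 • _; rw [cl_one]; simp))

theorem thmB {n : ℕ} {B Y : Set X} (hYB : Y ⊆ B) (hY : ∀ γ : C(ℝ, X), (∀ t, γ t ∈ B) → γ 0 ∈ Y → ∀ t, γ t ∈ Y) (hf : Finite (ZerothHomotopy B))
    (hB : ∀ b : B, HasMean (FundamentalGroup B b)) (φ : Ch ℝ X (n+1) →ₗ[ℝ] ℝ) (hb : ∀ σ, |φ (single σ 1)| ≤ 1)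
    (hd : ∀ c, φ (dd c) = 0) (h0 : ∀ c ∈ supp ℝ {Y} (n+1), φ c = 0) : ∃ ψ : Ch ℝ X (n+1) →ₗ[ℝ] ℝ, (∀ σ, |ψ (single σ 1)| ≤ 1) ∧ (∀ c, ψ (dd c) = 0) ∧
      (∀ c ∈ supp ℝ {B} (n+1), ψ c = 0) ∧ ∀ z, dd z ∈ supp ℝ {Y} n → ψ z = φ z := by
  obtain ⟨ψ, hψ, hJ⟩ := exists_JJ (GG_start hYB hY φ hb hd h0) hf hB
  have hN : (0:ℝ) < Fintype.card (Equiv.Perm (Fin (n+3))) := by exact_mod_cast Fintype.card_pos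
  obtain ⟨N, hNe⟩ : ∃ N : ℝ, N = Fintype.card (Equiv.Perm (Fin (n+3))) := ⟨_, rfl⟩
  rw [← hNe] at hN
  obtain ⟨S, hS⟩ : ∃ S : SSimplex X (n+1) → ℝ, ∀ σ, S σ = ∑ π : Equiv.Perm (Fin (n+3)), ψ ((a0 n).trans π.toEmbedding) (σ.comp (pb ((a0 n).trans π.toEmbedding))) := ⟨_, fun _ => rfl⟩
  have Sb : ∀ σ, |S σ| ≤ N := fun σ => by
    rw [hS]
    refine (Finset.abs_sum_le_sum_abs _ _).trans ((Finset.sum_le_sum fun π _ => hψ.bd _ _).trans ?_)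
    rw [Finset.sum_const, nsmul_eq_mul, mul_one, Finset.card_univ, hNe]
  have SB : ∀ σ : SSimplex X (n+1), range σ ⊆ B → ∀ x, S σ = S (.const _ (σ x)) := fun σ hσ x => by
    rw [hS, hS]; exact Finset.sum_congr rfl fun π _ => JJ_const hJ _ σ hσ x
  obtain ⟨F, hF⟩ : ∃ F : Ch ℝ X (n+1) →ₗ[ℝ] ℝ, F = N⁻¹ • Finsupp.linearCombination ℝ S := ⟨_, rfl⟩
  have F1 : ∀ σ, F (single σ 1) = N⁻¹ * S σ := fun σ => by simp [hF]
  have Fb : ∀ σ, |F (single σ 1)| ≤ 1 := fun σ => by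
    rw [F1, abs_mul, abs_of_pos (inv_pos.2 hN), inv_mul_le_iff₀ hN, mul_one]; exact Sb σ
  have Fd : ∀ c, F (dd c) = 0 := fun c => by
    refine ch_ext (f := F ∘ₗ dd) (g := 0) (fun σ => ?_) c
    rw [LinearMap.comp_apply, LinearMap.zero_apply, dd, bdF_apply, map_sum]
    simp_rw [map_smul, Finsupp.mapDomain_single, F1, smul_eq_mul]
    have : ∀ i : Fin (n+3), ((-1:ℝ)^(i:ℕ)) * (N⁻¹ * S (faceOf σ i)) = N⁻¹ * ∑ π : Equiv.Perm (Fin (n+3)), ((-1:ℝ)^(i:ℕ)) * ψ (fe π.toEmbedding i) ((σ.comp (pb π.toEmbedding)).comp (inc (rg_fe π.toEmbedding i))) := fun i => by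
      rw [hS, ← Finset.mul_sum, sum_perm (fun f => ψ f ((faceOf σ i).comp (pb f))) (a0 n) i.succAboveEmb, mul_left_comm]
      congr 2
      refine Finset.sum_congr rfl fun π _ => ?_
      congr 1
      ext y; exact congrArg σ (pb_face π.toEmbedding i y).symm
    rw [Finset.sum_congr rfl fun i _ => this i, ← Finset.mul_sum, Finset.sum_comm, Finset.sum_eq_zero fun π _ => hψ.co π.toEmbedding _, mul_zero]
  have Fv : ∀ z, dd z ∈ supp ℝ {Y} n → F z = φ z := fun z hz => by
    have := hψ.val KH.cst z hz
    rw [hF, LinearMap.smul_apply, smul_eq_mul, inv_mul_eq_iff_eq_mul₀ hN.ne', hNe, ← this, show S = _ from funext hS]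
    rfl
  have Fa : ∀ σ, F (op (altt (n+1)) (fstH X) (single σ 1)) = ((n+2).factorial : ℝ)⁻¹ * ∑ π : Equiv.Perm (Fin (n+2)), ((Equiv.Perm.sign π : ℤ) : ℝ) * F (single (opS (fstH X) σ (vtx (n+1) 0 ∘ π)) 1) := fun σ => by
    rw [op_single, one_smul, altt, Finsupp.mapDomain_smul, Finsupp.mapDomain_finsetSum, map_smul, map_sum, smul_eq_mul]
    congr 1
    refine Finset.sum_congr rfl fun π _ => ?_
    rw [Finsupp.mapDomain_single, ← smul_eq_mul, ← map_smul, Finsupp.smul_single, smul_eq_mul, mul_one]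
  refine ⟨F ∘ₗ op (altt (n+1)) (fstH X), fun σ => ?_, fun c => ?_, fun c hc => ?_, fun z hz => ?_⟩
  · have hp : (0:ℝ) < (n+2).factorial := by exact_mod_cast Nat.factorial_pos _
    rw [LinearMap.comp_apply, Fa, abs_mul, abs_of_pos (inv_pos.2 hp), inv_mul_le_iff₀ hp, mul_one]
    refine (Finset.abs_sum_le_sum_abs _ _).trans ((Finset.sum_le_sum (g := fun _ => 1) fun π _ => ?_).trans ?_)
    · rw [abs_mul]
      rcases Int.units_eq_one_or (Equiv.Perm.sign π) with h | h <;> rw [h] <;> simpa using Fb _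
    · simp [Fintype.card_perm]
  · rw [LinearMap.comp_apply, op_dd, ← nat_altt, ← dd_op, Fd]
  · refine supp_le (P := LinearMap.ker (F ∘ₗ op (altt (n+1)) (fstH X))) (fun σ ⟨A, hA, hs⟩ => ?_) hc
    rw [mem_singleton_iff.1 hA] at hs
    rw [LinearMap.mem_ker, LinearMap.comp_apply, Fa]
    have : ∀ π : Equiv.Perm (Fin (n+2)), F (single (opS (fstH X) σ (vtx (n+1) 0 ∘ π)) 1) = F (single σ 1) := fun π => by
      rw [F1, F1, SB σ hs ((aff (vtx (n+1) 0 ∘ π) (dv 0)).1)]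
      exact congrArg (N⁻¹ * ·) (SB (opS (fstH X) σ (vtx (n+1) 0 ∘ π)) (fun x ⟨y, hy⟩ => hs ⟨_, hy⟩) (dv 0))
    simp_rw [this]
    rw [← Finset.sum_mul, sum_sign, zero_mul, mul_zero]
  · obtain ⟨e, r, h1, _, h3⟩ := nat_homotopy altt nat_altt (by rw [altt_zero, sub_self]; exact Finsupp.mapDomain_zero) z
    have h4 := congrArg F h1
    have hr := h3 _ hz
    rw [map_sub, map_add, Fd, Fv r (dd_mem_supp hr), h0 r hr, Fv z hz] at h4
    rw [LinearMap.comp_apply]; linarith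
end F13

section F14
open Set Filter
open Topology (IsOpenEmbedding IsEmbedding)

lemma chart {m : ℕ} {M : Type} [TopologicalSpace M] {B : Set M}
    (h : IsTopMfdWithBdry (m + 1) M B) {x : M} {W : Set M} (hW : IsOpen W) (hx : x ∈ W) :
    ∃ J : Set ℝ, (x ∈ B ∧ J = Ico 0 1 ∨ x ∉ B ∧ J = Ioo 0 1) ∧ ∃ G : C(XX J m, M),
      IsChart B G ∧ range G ⊆ W ∧ x ∈ range G := by
  obtain ⟨U, V, e, hU, hV, hxU, he⟩ := h.2 x
  set κ : V → M := fun v => (e.symm v : M) with hκ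
  have oκ : IsOpenEmbedding κ := hU.isOpenEmbedding_subtypeVal.comp e.symm.isOpenEmbedding
  have oV : IsOpenEmbedding (Subtype.val : V → halfSpace (m + 1)) := hV.isOpenEmbedding_subtypeVal
  have hV' := oV.isOpenMap _ (hW.preimage oκ.continuous)
  obtain ⟨O, hO, hOV⟩ := isOpen_induced_iff.1 hV'
  set a : Fin (m + 1) → ℝ := ((e ⟨x, hxU⟩ : halfSpace (m+1)) : Fin (m+1) → ℝ) with ha
  have haO : a ∈ O := by
    have : (e ⟨x, hxU⟩ : halfSpace (m+1)) ∈ Subtype.val ⁻¹' O := by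
      rw [hOV]; exact ⟨e ⟨x, hxU⟩, by simpa [hκ] using hx, rfl⟩
    exact this
  obtain ⟨ε₀, hε₀, hb⟩ := Metric.isOpen_iff.1 hO a haO
  have a0 : 0 ≤ a 0 := (e ⟨x, hxU⟩ : halfSpace (m+1)).2 0 rfl
  have zz : ∀ y : Fin (m+1) → ℝ, (∀ j : Fin (m+1), (j : ℕ) = 0 → y j = 0) ↔ y 0 = 0 := fun y =>
    ⟨fun h => h 0 rfl, fun h j hj => by rwa [show j = 0 from Fin.ext hj]⟩
  have zg : ∀ y : Fin (m+1) → ℝ, y ∈ halfSpace (m+1) ↔ 0 ≤ y 0 := fun y =>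
    ⟨fun h => h 0 rfl, fun h j hj => by rwa [show j = 0 from Fin.ext hj]⟩
  have hxB : a 0 = 0 ↔ x ∈ B := by rw [← zz]; exact he ⟨x, hxU⟩

  obtain ⟨J, O', c, ε, hJB, hO', hε, hεε, hJ, hc, hcJ, hJ0⟩ : ∃ (J O' : Set ℝ) (c ε : ℝ),
      (x ∈ B ∧ J = Ico 0 1 ∨ x ∉ B ∧ J = Ioo 0 1) ∧ IsOpen O' ∧ 0 < ε ∧ ε ≤ ε₀ ∧
      (∀ r, r ∈ J ↔ r ∈ O' ∧ 0 ≤ a 0 + ε * (r - c)) ∧ (∀ r ∈ J, |r - c| < 1) ∧ c ∈ J ∧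
      ∀ r ∈ J, (a 0 + ε * (r - c) = 0 ↔ r = 0) := by
    rcases a0.eq_or_lt with h0 | h0
    · refine ⟨Ico 0 1, Ioo (-1) 1, 0, ε₀, .inl ⟨hxB.1 h0.symm, rfl⟩, isOpen_Ioo, hε₀, le_rfl,
        fun r => ?_, fun r hr => ?_, by simp, fun r hr => ?_⟩
      · rw [← h0, sub_zero, zero_add, mul_nonneg_iff_of_pos_left hε₀]
        exact ⟨fun h => ⟨⟨by linarith [h.1], h.2⟩, h.1⟩, fun h => ⟨h.2, h.1.2⟩⟩
      · rw [sub_zero, abs_of_nonneg hr.1]; exact hr.2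
      · rw [← h0, sub_zero, zero_add, mul_eq_zero, or_iff_right hε₀.ne']
    · have hm : 0 < min ε₀ (a 0) := lt_min hε₀ h0
      have ml : min ε₀ (a 0) ≤ a 0 := min_le_right _ _
      have pos : ∀ r ∈ Ioo (0:ℝ) 1, 0 < a 0 + min ε₀ (a 0) * (r - 1/2) := fun r hr => by
        nlinarith [mul_pos hm hr.1]
      refine ⟨Ioo 0 1, Ioo 0 1, 1/2, min ε₀ (a 0), .inr ⟨fun h => h0.ne' (hxB.2 h), rfl⟩,
        isOpen_Ioo, hm, min_le_left _ _,
        fun r => ⟨fun h => ⟨h, (pos r h).le⟩, fun h => h.1⟩, fun r hr => ?_, by norm_num,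
        fun r hr => ⟨fun h => absurd h (pos r hr).ne', fun h => absurd h hr.1.ne'⟩⟩
      rw [abs_lt]; constructor <;> linarith [hr.1, hr.2]
  set β : (Fin m → ℝ) → (Fin m → ℝ) := fun v => (Homeomorph.unitBall v : Metric.ball _ _) with hβ
  have oβ : IsOpenEmbedding β :=
    Metric.isOpen_ball.isOpenEmbedding_subtypeVal.comp (Homeomorph.unitBall).isOpenEmbedding
  set b : Fin (m+1) → ℝ := fun i => Fin.cases (a 0 - ε * c) (fun i => a i.succ) i with hbdef
  set Φ : ℝ × (Fin m → ℝ) → (Fin (m+1) → ℝ) := fun p =>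
    b + ε • (Fin.cons p.1 (β p.2) : Fin (m+1) → ℝ) with hΦ
  have oΦ : IsOpenEmbedding Φ := by
    have h1 := (IsOpenEmbedding.id (X := ℝ)).prodMap oβ
    have h2 := (Fin.consEquivL ℝ (fun _ : Fin (m+1) => ℝ)).toHomeomorph.isOpenEmbedding.comp h1
    have h3 := (Homeomorph.smulOfNeZero ε hε.ne' (α := Fin (m+1) → ℝ)).isOpenEmbedding.comp h2
    exact (Homeomorph.addLeft b).isOpenEmbedding.comp h3
  have Φ0 : ∀ p, Φ p 0 = a 0 + ε * (p.1 - c) := fun p => by simp [hΦ, hbdef]; ring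
  have ΦO : ∀ p : ℝ × (Fin m → ℝ), p.1 ∈ J → Φ p ∈ O := fun p hp => hb (by
    rw [Metric.mem_ball, dist_pi_lt_iff hε₀]
    have hv : ‖β p.2‖ < 1 := mem_ball_zero_iff.1 (Homeomorph.unitBall p.2).2
    refine Fin.cases ?_ fun i => ?_
    · rw [Φ0, Real.dist_eq, add_sub_cancel_left, abs_mul, abs_of_pos hε]
      nlinarith [hc _ hp]
    · have hi := (norm_le_pi_norm (β p.2) i).trans_lt hv
      have : Φ p i.succ - a i.succ = ε * β p.2 i := by simp [hΦ, hbdef]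
      rw [Real.dist_eq, this, abs_mul, abs_of_pos hε]
      rw [Real.norm_eq_abs] at hi
      nlinarith)
  set f : XX J m → halfSpace (m+1) := fun p => ⟨Φ (p.1, p.2), (zg _).2 (by
    rw [Φ0]; exact ((hJ _).1 p.1.2).2)⟩ with hf
  have ef : IsEmbedding (Subtype.val ∘ f) :=
    oΦ.isEmbedding.comp (IsEmbedding.subtypeVal.prodMap IsEmbedding.id)
  have fc : Continuous f := Topology.IsInducing.subtypeVal.continuous_iff.2 ef.continuous
  have rf : range f = Subtype.val ⁻¹' (Φ '' (O' ×ˢ univ)) := by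
    ext y; constructor
    · rintro ⟨p, rfl⟩; exact ⟨(p.1, p.2), ⟨((hJ _).1 p.1.2).1, trivial⟩, rfl⟩
    · rintro ⟨p, hp, hpy⟩
      have := (zg _).1 y.2
      rw [← hpy, Φ0] at this
      exact ⟨(⟨p.1, (hJ _).2 ⟨hp.1, this⟩⟩, p.2), Subtype.ext hpy⟩
  have of : IsOpenEmbedding f := ⟨ef.of_comp fc continuous_subtype_val, by
    rw [rf]; exact (oΦ.isOpenMap _ (hO'.prod isOpen_univ)).preimage continuous_subtype_val⟩
  have fV : ∀ p, ∃ v : V, κ v ∈ W ∧ (v : halfSpace (m+1)) = f p := fun p => by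
    have : f p ∈ Subtype.val ⁻¹' O := ΦO (p.1, p.2) p.1.2
    rw [hOV] at this; exact this
  choose g gW gf using fV
  have og : IsOpenEmbedding g := IsOpenEmbedding.of_comp g oV (by
    rwa [show Subtype.val ∘ g = f from funext gf])
  have oG := oκ.comp og
  refine ⟨J, hJB, ⟨_, oG.continuous⟩, ⟨oG, ?_⟩, ?_, ?_⟩
  · ext p
    have := he (e.symm (g p))
    rw [zz, e.apply_symm_apply, gf] at this
    exact this.symm.trans (by rw [show ((f p : halfSpace (m+1)) : Fin (m+1) → ℝ) 0 = _ from Φ0 _]; exact hJ0 _ p.1.2)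
  · rintro _ ⟨p, rfl⟩; exact gW p
  · refine ⟨(⟨c, hcJ⟩, 0), ?_⟩
    have : g (⟨c, hcJ⟩, 0) = e ⟨x, hxU⟩ := by
      apply Subtype.ext; apply Subtype.ext; rw [gf]
      show Φ (c, 0) = a
      ext i; refine Fin.cases ?_ (fun i => ?_) i
      · rw [Φ0]; simp
      · simp [hΦ, hbdef, hβ]
    show (e.symm (g _) : M) = x
    rw [this, e.symm_apply_apply]

end F14

section F15
open Set Filter
open Topology (IsOpenEmbedding IsEmbedding)

section mfd
variable {m : ℕ} {M : Type} [TopologicalSpace M] {B : Set M} (h : IsTopMfdWithBdry (m + 1) M B)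

lemma mfd_closed (h : IsTopMfdWithBdry (m + 1) M B) : IsClosed B := by
  refine ⟨isOpen_iff_mem_nhds.2 fun x hx => ?_⟩
  obtain ⟨J, hJ, G, hG, -, hxG⟩ := chart h isOpen_univ (mem_univ x)
  rcases hJ with ⟨hJ, -⟩ | ⟨-, rfl⟩
  · exact absurd hJ hx
  refine mem_of_superset (hG.1.isOpen_range.mem_nhds hxG) ?_
  rintro _ ⟨p, rfl⟩ hp
  have : p ∈ BX (Ioo 0 1) m := by rw [← hG.2]; exact hp
  exact p.1.2.1.ne' this

lemma mfd_dense (h : IsTopMfdWithBdry (m + 1) M B) : Dense Bᶜ := by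
  refine dense_iff_inter_open.2 fun U hU ⟨x, hx⟩ => ?_
  obtain ⟨J, hJ, G, hG, hGU, -⟩ := chart h hU hx
  have hh : (1/2:ℝ) ∈ J := by rcases hJ with ⟨-, rfl⟩ | ⟨-, rfl⟩ <;> norm_num
  refine ⟨G (⟨1/2, hh⟩, 0), hGU ⟨_, rfl⟩, fun hp => ?_⟩
  have : (⟨1/2, hh⟩, 0) ∈ BX J m := by rw [← hG.2]; exact hp
  exact absurd (show (1/2:ℝ) = 0 from this) (by norm_num)

def z0 : Ico (0:ℝ) 1 := ⟨0, by simp⟩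

lemma slice {G : C(XX (Ico 0 1) m, M)} (hG : IsChart B G) {S : Set M} (hS : S ⊆ B)
    {γ : (Fin m → ℝ) → S} (hγ : ∀ v, (γ v : M) = G (z0, v)) :
    IsOpenEmbedding γ ∧ range γ = Subtype.val ⁻¹' (range G) := by
  have e : IsEmbedding (Subtype.val ∘ γ) := by
    rw [show Subtype.val ∘ γ = G ∘ (fun v => (z0, v)) from funext hγ]
    exact hG.1.isEmbedding.comp (isEmbedding_prodMkRight z0)
  have r : range γ = Subtype.val ⁻¹' (range G) := by
    ext y; constructor
    · rintro ⟨v, rfl⟩; exact ⟨_, (hγ v).symm⟩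
    · rintro ⟨p, hp⟩
      have : p ∈ BX (Ico 0 1) m := by rw [← hG.2]; exact hS (hp ▸ y.2)
      refine ⟨p.2, Subtype.ext ?_⟩
      rw [hγ, ← hp, show p = (z0, p.2) from Prod.ext (Subtype.ext this) rfl]
  exact ⟨⟨e.of_comp (Topology.IsInducing.subtypeVal.continuous_iff.2 e.continuous)
    continuous_subtype_val, r ▸ hG.1.isOpen_range.preimage continuous_subtype_val⟩, r⟩

lemma mfd_pc (h : IsTopMfdWithBdry (m + 1) M B) (t : B) : pathComponent t ∈ nhds t := by
  obtain ⟨J, hJ, G, hG, -, hx⟩ := chart h isOpen_univ (mem_univ t.1)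
  rcases hJ with ⟨-, rfl⟩ | ⟨h, -⟩
  · have hγ : ∀ v, G (z0, v) ∈ B := fun v => by
      have : (z0, v) ∈ G ⁻¹' B := by rw [hG.2]; rfl
      exact this
    obtain ⟨o, r⟩ := slice hG subset_rfl (γ := fun v => ⟨_, hγ v⟩) fun v => rfl
    have ht := r.ge hx
    refine mem_of_superset (o.isOpen_range.mem_nhds ht) ?_
    obtain ⟨v, rfl⟩ := ht
    rintro _ ⟨v', rfl⟩
    exact (PathConnectedSpace.joined v v').map o.continuous
  · exact absurd t.2 h

end mfd

lemma mean_of {ι : Type} [Finite ι] {T : ι → Type} [∀ j, TopologicalSpace (T j)]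
    [∀ j, CompactSpace (T j)] {Z : Type} [TopologicalSpace Z] [T2Space Z] (f : ∀ j, C(T j, Z))
    (hl : ∀ j (t : T j), pathComponent t ∈ nhds t) (hs : ∀ z, ∃ j t, f j t = z)
    (hi : ∀ j (t : T j), InjOn (f j) (connectedComponent t))
    (hc : ∀ j t j' t', f j t = f j' t' → f j '' connectedComponent t ⊆ f j' '' connectedComponent t')
    (hm : ∀ j t, HasMean (FundamentalGroup (connectedComponent (t : T j)) ⟨t, mem_connectedComponent⟩)) :
    Finite (ZerothHomotopy Z) ∧ ∀ b : Z, HasMean (FundamentalGroup Z b) := by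
  constructor
  · choose A hA using fun j => (isCompact_univ (X := T j)).elim_nhds_subcover _ fun t _ => hl j t
    refine Finite.of_surjective (α := Σ j, A j)
      (fun a => ZerothHomotopy.mk (f a.1 a.2)) fun y => ?_
    induction y using ZerothHomotopy.rec with | mk z => ?_
    obtain ⟨j, t, rfl⟩ := hs z
    obtain ⟨a, ha, hat⟩ := mem_iUnion₂.1 ((hA j).2 (mem_univ t))
    exact ⟨⟨j, a, ha⟩, Quotient.sound (Joined.map hat (f j).continuous)⟩
  · intro b
    obtain ⟨j, t, rfl⟩ := hs b
    have : CompactSpace (connectedComponent t) :=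
      isCompact_iff_compactSpace.1 isClosed_connectedComponent.isCompact
    let g : C(connectedComponent t, Z) := (f j).comp ⟨_, continuous_subtype_val⟩
    have hg : Topology.IsClosedEmbedding g := g.continuous.isClosedEmbedding
      fun a b h => Subtype.ext (hi j t a.2 b.2 h)
    have hK : IsClopen (range g) := by
      refine ⟨hg.isClosed_range, ?_⟩
      have : (range g)ᶜ = ⋃ j', f j' '' (f j' ⁻¹' range g)ᶜ := by
        ext z; obtain ⟨j', t', rfl⟩ := hs z; constructor
        · exact fun h => mem_iUnion.2 ⟨j', t', h, rfl⟩
        · intro h; obtain ⟨j'', t'', h, e⟩ := mem_iUnion.1 h; rw [← e]; exact h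
      refine isClosed_compl_iff.1 ?_
      rw [this]
      refine isClosed_iUnion_of_finite fun j' => ((IsClosed.isCompact ?_).image (f j').continuous).isClosed
      refine isClosed_compl_iff.2 (isOpen_iff_mem_nhds.2 fun t' ⟨c, hc'⟩ => ?_)
      refine mem_of_superset (hl j' t') fun s hs => ?_
      have h2 : f j' s ∈ f j '' connectedComponent (c : T j) :=
        hc j' t' j c hc'.symm ⟨s, pathComponent_subset_component _ hs, rfl⟩
      rw [← connectedComponent_eq c.2] at h2
      obtain ⟨y, hy, e⟩ := h2
      exact ⟨⟨y, hy⟩, e⟩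
    refine (hm j t).of_lift g ⟨t, mem_connectedComponent⟩ _ rfl fun p => ?_
    have hp : ∀ u, p u ∈ range g := fun u => by
      have := (hK.preimage p.continuous).eq_univ ⟨0, by
        show p 0 ∈ range g; rw [p.source]; exact ⟨⟨t, mem_connectedComponent⟩, rfl⟩⟩
      exact this.ge (mem_univ u)
    choose r hr using hp
    exact ⟨⟨⟨r, hg.isEmbedding.continuous_iff.2 (by
      rw [show g ∘ r = p from funext hr]; exact p.continuous)⟩,
      hg.injective ((hr 0).trans p.source), hg.injective ((hr 1).trans p.target)⟩, hr⟩

end F15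

section F16
open Set Filter
open Topology (IsOpenEmbedding IsEmbedding)

lemma match_charts {m : ℕ} {N₁ N₂ : Type} [TopologicalSpace N₁] [TopologicalSpace N₂] {B₁ S₁ : Set N₁} {B₂ S₂ : Set N₂}
    (h₁ : S₁ ⊆ B₁) (h₂ : S₂ ⊆ B₂) (g : S₁ ≃ₜ S₂) {G₁ : C(XX (Ico 0 1) m, N₁)} {G₂ : C(XX (Ico 0 1) m, N₂)}
    (c₁ : IsChart B₁ G₁) (c₂ : IsChart B₂ G₂) (r₁ : ∀ v, G₁ (z0, v) ∈ S₁) (r₂ : ∀ v, G₂ (z0, v) ∈ S₂)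
    (s : S₁) (hs₁ : (s : N₁) ∈ range G₁) (hs₂ : (g s : N₂) ∈ range G₂) :
    ∃ T₁ T₂ : (Fin m → ℝ) → (Fin m → ℝ), IsOpenEmbedding T₁ ∧ IsOpenEmbedding T₂ ∧
      (∀ v, (g ⟨G₁ (z0, T₁ v), r₁ _⟩ : N₂) = G₂ (z0, T₂ v)) ∧ ∃ v, G₁ (z0, T₁ v) = s := by
  obtain ⟨o₁, e₁⟩ := slice c₁ h₁ (γ := fun v => ⟨_, r₁ v⟩) fun v => rfl
  obtain ⟨o₂, e₂⟩ := slice c₂ h₂ (γ := fun v => ⟨_, r₂ v⟩) fun v => rfl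
  obtain ⟨v₀, hv₀⟩ := e₁.ge hs₁
  have o₁' := g.isOpenEmbedding.comp o₁
  obtain ⟨δ, hδ, hb⟩ := Metric.isOpen_iff.1 (o₂.isOpen_range.preimage o₁'.continuous) v₀ (by
    exact mem_preimage.2 (e₂.ge (by rw [mem_preimage, Function.comp_apply]; exact (congrArg (fun x => (g x : N₂)) hv₀ : _) ▸ hs₂)))
  have oT : IsOpenEmbedding (fun v : Fin m → ℝ => v₀ + δ • ((Homeomorph.unitBall v : Metric.ball _ _) : Fin m → ℝ)) :=
    (Homeomorph.addLeft v₀).isOpenEmbedding.comp ((Homeomorph.smulOfNeZero δ hδ.ne' (α := Fin m → ℝ)).isOpenEmbedding.comp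
      (Metric.isOpen_ball.isOpenEmbedding_subtypeVal.comp (Homeomorph.unitBall).isOpenEmbedding))
  set T₁ := fun v : Fin m → ℝ => v₀ + δ • ((Homeomorph.unitBall v : Metric.ball _ _) : Fin m → ℝ) with hT
  have : ∀ v, ∃ u, (⟨_, r₂ u⟩ : S₂) = g ⟨G₁ (z0, T₁ v), r₁ _⟩ := fun v => hb (by
    have := mem_ball_zero_iff.1 (Homeomorph.unitBall v).2
    rw [mem_ball_iff_norm, hT, add_sub_cancel_left, norm_smul, Real.norm_of_nonneg hδ.le]
    nlinarith)
  choose T₂ hT₂ using this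
  refine ⟨T₁, T₂, oT, IsOpenEmbedding.of_comp T₂ o₂ ?_, fun v => (congrArg Subtype.val (hT₂ v)).symm, 0, ?_⟩
  · convert o₁'.comp oT using 1; exact funext hT₂
  · rw [← hv₀]; simp [hT]

structure Qd {P M : Type} [TopologicalSpace P] [TopologicalSpace M] (q : C(P, M)) (B : Set P) (sr : P → P → Prop) : Prop where
  qm : Topology.IsQuotientMap q
  eq : ∀ a b, q a = q b ↔ a = b ∨ sr a b
  symm : ∀ {a b}, sr a b → sr b a
  uniq : ∀ {a b c}, sr a b → sr a c → b = c
  sB : ∀ {a b}, sr a b → a ∈ B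

namespace Qd
variable {P M : Type} [TopologicalSpace P] [TopologicalSpace M] {q : C(P, M)} {B : Set P} {sr : P → P → Prop} (h : Qd q B sr)

lemma inj (h : Qd q B sr) {a b : P} (ha : a ∉ B) (e : q a = q b) : a = b := by
  rcases (h.eq _ _).1 e with e | e
  · exact e
  · exact absurd (h.sB e) ha

lemma mem (h : Qd q B sr) {a : P} : q a ∈ q '' B ↔ a ∈ B := by
  refine ⟨fun ⟨b, hb, e⟩ => ?_, fun ha => ⟨a, ha, rfl⟩⟩
  by_contra ha
  exact ha (h.inj ha e.symm ▸ hb)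

lemma oemb (h : Qd q B sr) {Y : Type} [TopologicalSpace Y] {c : Y → P} (hc : IsOpenEmbedding c) (hB : ∀ y, c y ∉ B) :
    IsOpenEmbedding (q ∘ c) := by
  refine IsOpenEmbedding.of_continuous_injective_isOpenMap (q.continuous.comp hc.continuous)
    (fun a b e => hc.injective (h.inj (hB a) e)) fun O hO => ?_
  refine h.qm.isOpen_preimage.1 ?_
  convert hc.isOpenMap O hO using 1
  ext a; constructor
  · rintro ⟨y, hy, e⟩; exact ⟨y, hy, h.inj (hB y) e⟩
  · rintro ⟨y, hy, rfl⟩; exact ⟨y, hy, rfl⟩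

lemma paste (h : Qd q B sr) {m : ℕ} {c₁ c₂ : C(XX (Ico 0 1) m, P)} (h₁ : IsChart B c₁) (h₂ : IsChart B c₂)
    (hd : ∀ p p', c₁ p ≠ c₂ p') (hs : ∀ v, sr (c₁ (z0, v)) (c₂ (z0, v))) :
    ∃ G : C(XX (Ioo (-1) 1) m, M), IsChart (q '' B) G ∧ ∀ v, q (c₁ (z0, v)) ∈ range G := by
  set i₁ : XX (Ico 0 1) m → XX (Ioo (-1) 1) m := fun p => (⟨p.1, by linarith [p.1.2.1], p.1.2.2⟩, p.2) with hi₁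
  set i₂ : XX (Ico 0 1) m → XX (Ioo (-1) 1) m := fun p => (⟨-p.1, by linarith [p.1.2.2], by linarith [p.1.2.1]⟩, p.2) with hi₂
  have ci₁ : Continuous i₁ := by fun_prop
  have ci₂ : Continuous i₂ := by fun_prop
  set ρ : XX (Ioo (-1) 1) m → XX (Ico 0 1) m := fun p => (⟨max p.1 0, le_max_right _ _, max_lt p.1.2.2 one_pos⟩, p.2) with hρ
  set ρ' : XX (Ioo (-1) 1) m → XX (Ico 0 1) m := fun p => (⟨max (-p.1) 0, le_max_right _ _, max_lt (by linarith [p.1.2.1]) one_pos⟩, p.2) with hρ'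
  have cρ : Continuous ρ := by fun_prop
  have cρ' : Continuous ρ' := by fun_prop
  have e0 : ∀ v, q (c₁ (z0, v)) = q (c₂ (z0, v)) := fun v => (h.eq _ _).2 (.inr (hs v))
  obtain ⟨G, G₁, G₂⟩ : ∃ G : C(XX (Ioo (-1) 1) m, M), (∀ p, G (i₁ p) = q (c₁ p)) ∧ ∀ p, G (i₂ p) = q (c₂ p) := by
    refine ⟨⟨fun p => if (p.1 : ℝ) ≤ 0 then q (c₂ (ρ' p)) else q (c₁ (ρ p)), Continuous.if_le (by fun_prop) (by fun_prop)
      (by fun_prop) (by fun_prop) fun p hp => ?_⟩, fun p => ?_, fun p => ?_⟩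
    · have a : ρ' p = (z0, p.2) := Prod.ext (Subtype.ext (by simp [hρ', hp, z0])) rfl
      have b : ρ p = (z0, p.2) := Prod.ext (Subtype.ext (by simp [hρ, hp, z0])) rfl
      rw [a, b, e0]
    · show (if (p.1 : ℝ) ≤ 0 then _ else _) = _
      have b : ρ (i₁ p) = p := Prod.ext (Subtype.ext (by simp [hρ, hi₁, p.1.2.1])) rfl
      split_ifs with hp
      · have p0 : p = (z0, p.2) := Prod.ext (Subtype.ext (le_antisymm hp p.1.2.1)) rfl
        have a : ρ' (i₁ p) = (z0, p.2) := Prod.ext (Subtype.ext (by simp [hρ', hi₁, p.1.2.1, z0])) rfl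
        rw [a, ← e0, ← p0]
      · rw [b]
    · show (if -(p.1 : ℝ) ≤ 0 then _ else _) = _
      have b : ρ' (i₂ p) = p := Prod.ext (Subtype.ext (by simp [hρ', hi₂, p.1.2.1])) rfl
      rw [if_pos (by linarith [p.1.2.1]), b]
  have cov : ∀ p, (∃ p', p = i₁ p') ∨ ∃ p', p = i₂ p' := fun p => by
    rcases le_total 0 (p.1 : ℝ) with h | h
    · exact .inl ⟨(⟨p.1, h, p.1.2.2⟩, p.2), rfl⟩
    · exact .inr ⟨(⟨-p.1, by linarith, by linarith [p.1.2.1]⟩, p.2), Prod.ext (Subtype.ext (by simp [hi₂])) rfl⟩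
  have i0 : ∀ v, i₁ (z0, v) = i₂ (z0, v) := fun v => Prod.ext (Subtype.ext (by simp [hi₁, hi₂, z0])) rfl
  have z₁ : ∀ p, c₁ p ∈ B → p = (z0, p.2) := fun p hp => by
    have : p ∈ BX (Ico 0 1) m := by rw [← h₁.2]; exact hp
    exact Prod.ext (Subtype.ext this) rfl
  have z₂ : ∀ p, c₂ p ∈ B → p = (z0, p.2) := fun p hp => by
    have : p ∈ BX (Ico 0 1) m := by rw [← h₂.2]; exact hp
    exact Prod.ext (Subtype.ext this) rfl

  have k₁ : ∀ a p, q a = q (c₁ p) → a = c₁ p ∨ ∃ v, p = (z0, v) ∧ a = c₂ (z0, v) := fun a p e => by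
    rcases (h.eq _ _).1 e with e | e
    · exact .inl e
    · have e' := h.symm e
      have hp := z₁ p (h.sB e')
      rw [hp] at e'
      exact .inr ⟨_, hp, h.uniq e' (hs _)⟩
  have k₂ : ∀ a p, q a = q (c₂ p) → a = c₂ p ∨ ∃ v, p = (z0, v) ∧ a = c₁ (z0, v) := fun a p e => by
    rcases (h.eq _ _).1 e with e | e
    · exact .inl e
    · have e' := h.symm e
      have hp := z₂ p (h.sB e')
      rw [hp] at e'
      exact .inr ⟨_, hp, h.uniq e' (h.symm (hs _))⟩
  have inj12 : ∀ p p', q (c₁ p) = q (c₂ p') → i₁ p = i₂ p' := fun p p' e => by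
    rcases k₂ _ _ e with e | ⟨v, rfl, f⟩
    · exact absurd e (hd _ _)
    · rw [h₁.1.injective f, i0]
  refine ⟨G, ⟨IsOpenEmbedding.of_continuous_injective_isOpenMap G.continuous ?_ fun O hO => ?_, ?_⟩, fun v => ⟨_, G₁ _⟩⟩
  · intro p p' e
    rcases cov p with ⟨p, rfl⟩ | ⟨p, rfl⟩ <;> rcases cov p' with ⟨p', rfl⟩ | ⟨p', rfl⟩ <;> simp only [G₁, G₂] at e
    · rcases k₁ _ _ e with e | ⟨v, rfl, f⟩
      · rw [h₁.1.injective e]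
      · exact absurd f (hd _ _)
    · exact inj12 _ _ e
    · exact (inj12 _ _ e.symm).symm
    · rcases k₂ _ _ e with e | ⟨v, rfl, f⟩
      · rw [h₂.1.injective e]
      · exact absurd f.symm (hd _ _)
  · refine h.qm.isOpen_preimage.1 ?_
    convert (h₁.1.isOpenMap _ (hO.preimage ci₁)).union (h₂.1.isOpenMap _ (hO.preimage ci₂)) using 1
    ext a; constructor
    · rintro ⟨p, hp, e⟩
      rcases cov p with ⟨p, rfl⟩ | ⟨p, rfl⟩ <;> simp only [G₁, G₂] at e
      · rcases k₁ _ _ e.symm with rfl | ⟨v, rfl, rfl⟩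
        · exact .inl ⟨p, hp, rfl⟩
        · exact .inr ⟨_, (i0 v ▸ hp : i₂ (z0, v) ∈ O), rfl⟩
      · rcases k₂ _ _ e.symm with rfl | ⟨v, rfl, rfl⟩
        · exact .inr ⟨p, hp, rfl⟩
        · exact .inl ⟨_, ((i0 v).symm ▸ hp : i₁ (z0, v) ∈ O), rfl⟩
    · rintro (⟨p, hp, rfl⟩ | ⟨p, hp, rfl⟩)
      · exact ⟨_, hp, G₁ p⟩
      · exact ⟨_, hp, G₂ p⟩
  · ext p
    rcases cov p with ⟨p, rfl⟩ | ⟨p, rfl⟩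
    · rw [mem_preimage, G₁, h.mem]; exact (Set.ext_iff.1 h₁.2 p)
    · rw [mem_preimage, G₂, h.mem]; exact (Set.ext_iff.1 h₂.2 p).trans (neg_eq_zero (a := (p.1 : ℝ))).symm

end Qd
end F16

section F17
open Set Filter
open Topology (IsOpenEmbedding IsEmbedding)
variable {k : ℕ} (D : GluingData k)

def gq : C(Σ j, D.piece j, D.Glued) := ⟨Quot.mk D.rel, continuous_quot_mk⟩
def gB : Set (Σ j, D.piece j) := {a | a.2 ∈ D.bdry a.1}
def gsr (a b : Σ j, D.piece j) : Prop := D.rel a b ∨ D.rel b a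
def gF (a : Σ j, D.piece j) : Σ j, Set (D.piece j) := ⟨a.1, connectedComponentIn (D.bdry a.1) a.2⟩

variable {D}
lemma gS1 (e : D.E) {s} (hs : s ∈ D.S₁ e) : connectedComponentIn (D.bdry (D.j₁ e)) s = D.S₁ e := by
  obtain ⟨y, hy, h⟩ := D.comp₁ e
  rw [h] at hs ⊢
  exact (connectedComponentIn_eq hs).symm
lemma gF1 (e : D.E) (s : D.S₁ e) : gF D ⟨D.j₁ e, s⟩ = ⟨D.j₁ e, D.S₁ e⟩ := by
  rw [gF, gS1 e s.2]
lemma gS2 (e : D.E) {s} (hs : s ∈ D.S₂ e) : connectedComponentIn (D.bdry (D.j₂ e)) s = D.S₂ e := by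
  obtain ⟨y, hy, h⟩ := D.comp₂ e
  rw [h] at hs ⊢
  exact (connectedComponentIn_eq hs).symm
lemma gF2 (e : D.E) (s : D.S₂ e) : gF D ⟨D.j₂ e, s⟩ = ⟨D.j₂ e, D.S₂ e⟩ := by
  rw [gF, gS2 e s.2]
lemma gFne {a b : Σ j, D.piece j} (h : D.rel a b) : gF D a ≠ gF D b := by
  obtain ⟨e, s, rfl, rfl⟩ := h
  rw [gF1, gF2]
  intro h
  exact Sum.inl_ne_inr (D.used_inj (a₁ := Sum.inl e) (a₂ := Sum.inr e) h)

lemma rel1 {a b c : Σ j, D.piece j} (h : D.rel a b) (h' : D.rel a c) : b = c := by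
  obtain ⟨e, s, rfl, rfl⟩ := h
  obtain ⟨e', s', h, rfl⟩ := h'
  have h2 := congrArg (gF D) h
  rw [gF1, gF1] at h2
  cases Sum.inl_injective (D.used_inj (a₁ := Sum.inl e) (a₂ := Sum.inl e') h2)
  rw [Subtype.ext (sigma_mk_injective h)]
lemma rel2 {a b c : Σ j, D.piece j} (h : D.rel b a) (h' : D.rel c a) : b = c := by
  obtain ⟨e, s, rfl, rfl⟩ := h
  obtain ⟨e', s', rfl, h⟩ := h'
  have h2 := congrArg (gF D) h
  rw [gF2, gF2] at h2
  cases Sum.inr_injective (D.used_inj (a₁ := Sum.inr e) (a₂ := Sum.inr e') h2)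
  rw [(D.glue e).injective (Subtype.ext (sigma_mk_injective h))]
lemma rel3 {a b c : Σ j, D.piece j} (h : D.rel a b) (h' : D.rel b c) : False := by
  obtain ⟨e, s, rfl, rfl⟩ := h
  obtain ⟨e', s', h, rfl⟩ := h'
  have h2 := congrArg (gF D) h
  rw [gF1, gF2] at h2
  exact Sum.inr_ne_inl (D.used_inj (a₁ := Sum.inr e) (a₂ := Sum.inl e') h2)

lemma gqd : Qd (gq D) (gB D) (gsr D) where
  qm := isQuotientMap_quot_mk
  eq a b := by
    refine ⟨fun h => ?_, ?_⟩
    · obtain h : Relation.EqvGen D.rel a b := Quot.eq.1 h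
      clear * - h
      induction h with
      | rel _ _ h => exact .inr (.inl h)
      | refl => exact .inl rfl
      | symm _ _ _ h => exact h.imp Eq.symm Or.symm
      | trans a b c _ _ h h' =>
        rcases h with rfl | h | h
        · exact h'
        all_goals rcases h' with rfl | h' | h'
        · exact .inr (.inl h)
        · exact (rel3 h h').elim
        · exact .inl (rel2 h h')
        · exact .inr (.inr h)
        · exact .inl (rel1 h h')
        · exact (rel3 h' h).elim
    · rintro (rfl | h | h)
      · rfl
      · exact Quot.sound h
      · exact (Quot.sound h).symm
  symm h := h.symm
  uniq h h' := by
    rcases h with h | h <;> rcases h' with h' | h'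
    · exact rel1 h h'
    · exact (rel3 h' h).elim
    · exact (rel3 h h').elim
    · exact rel2 h h'
  sB h := by
    rcases h with ⟨e, s, rfl, -⟩ | ⟨e, s, -, rfl⟩
    · exact D.sub₁ e s.2
    · exact D.sub₂ e (D.glue e s).2

lemma gBB : D.gluedBdry ∪ D.gluedSet = gq D '' gB D := by
  ext x; constructor
  · rintro (⟨h, -⟩ | h)
    · obtain ⟨j, y, hy, rfl⟩ := mem_iUnion.1 h; exact ⟨⟨j, y⟩, hy, rfl⟩
    · obtain ⟨e, y, hy, rfl⟩ := mem_iUnion.1 h; exact ⟨⟨_, y⟩, D.sub₁ e hy, rfl⟩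
  · rintro ⟨⟨j, y⟩, hy, rfl⟩; exact D.emb_mapsTo_bdry j hy

variable [∀ j, CompactSpace (D.piece j)] {m : ℕ} (hm : ∀ j, IsTopMfdWithBdry (m + 1) (D.piece j) (D.bdry j))
  [T2Space D.Glued]

lemma gclosed (hm : ∀ j, IsTopMfdWithBdry (m + 1) (D.piece j) (D.bdry j)) : IsClosed D.gluedSet := by
  have := D.finE
  refine isClosed_iUnion_of_finite fun e => (IsCompact.image (IsClosed.isCompact ?_) (D.emb _).continuous).isClosed
  obtain ⟨y, hy, h⟩ := D.comp₁ e
  rw [h, connectedComponentIn_eq_image hy]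
  exact (mfd_closed (hm _)).isClosedEmbedding_subtypeVal.isClosedMap _ isClosed_connectedComponent

lemma comp_chart {j : Fin k} {G : C(XX (Ico 0 1) m, D.piece j)} (hG : IsChart (D.bdry j) G) {S : Set (D.piece j)}
    (hS : ∃ y ∈ D.bdry j, S = connectedComponentIn (D.bdry j) y) (hSB : S ⊆ D.bdry j) {s : D.piece j} (hs : s ∈ S) (hr : s ∈ range G) (v : Fin m → ℝ) : G (z0, v) ∈ S := by
  obtain ⟨y, hy, rfl⟩ := hS
  obtain ⟨p, rfl⟩ := hr
  have hb : ∀ v, G (z0, v) ∈ D.bdry j := fun v => by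
    have : (z0, v) ∈ G ⁻¹' D.bdry j := by rw [hG.2]; rfl
    exact this
  have hp : p ∈ BX (Ico 0 1) m := by rw [← hG.2]; exact hSB hs
  have hp : p = (z0, p.2) := Prod.ext (Subtype.ext hp) rfl
  rw [connectedComponentIn_eq hs]
  refine (isPreconnected_range (f := fun v => G (z0, v)) (by fun_prop)).subset_connectedComponentIn ?_ ?_ ⟨v, rfl⟩
  · exact ⟨p.2, congrArg G hp.symm⟩
  · rintro _ ⟨v, rfl⟩; exact hb v

lemma chart_sig {J : Set ℝ} {j : Fin k} {G : C(XX J m, D.piece j)} (hG : IsChart (D.bdry j) G) {T : (Fin m → ℝ) → (Fin m → ℝ)}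
    (hT : IsOpenEmbedding T) : ∃ c : C(XX J m, Σ j, D.piece j), IsChart (gB D) c ∧ ∀ r v, c (r, v) = ⟨j, G (r, T v)⟩ := by
  have o := IsOpenEmbedding.sigmaMk (σ := D.piece) (i := j) |>.comp (hG.1.comp (IsOpenEmbedding.id.prodMap hT))
  refine ⟨⟨_, o.continuous⟩, ⟨o, ?_⟩, fun r v => rfl⟩
  ext p
  exact Set.ext_iff.1 hG.2 (p.1, T p.2)

lemma gcharts (hm : ∀ j, IsTopMfdWithBdry (m + 1) (D.piece j) (D.bdry j)) (hg : IsTopMfdWithBdry (m + 1) D.Glued D.gluedBdry)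
    (x : D.Glued) : ∃ J, JT J ∧ ∃ G : C(XX J m, D.Glued), IsChart (D.gluedBdry ∪ D.gluedSet) G ∧ x ∈ range G := by
  by_cases hx : x ∈ D.gluedSet
  · obtain ⟨e, s, hs, rfl⟩ := mem_iUnion.1 hx
    have := fun j => (hm j).1
    have hr : D.rel ⟨_, s⟩ ⟨D.j₂ e, D.glue e ⟨s, hs⟩⟩ := ⟨e, ⟨s, hs⟩, rfl, rfl⟩
    obtain ⟨W₁, W₂, o₁, o₂, w₁, w₂, dW⟩ := t2_separation fun h : (⟨_, s⟩ : Σ j, D.piece j) = ⟨D.j₂ e, D.glue e ⟨s, hs⟩⟩ => gFne hr (congrArg _ h)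
    obtain ⟨J₁, hJ₁, G₁, c₁, r₁, m₁⟩ := chart (hm _) (o₁.preimage continuous_sigmaMk) w₁
    obtain ⟨J₂, hJ₂, G₂, c₂, r₂, m₂⟩ := chart (hm _) (o₂.preimage continuous_sigmaMk) w₂
    obtain rfl : J₁ = Ico 0 1 := by
      rcases hJ₁ with h | h
      · exact h.2
      · exact absurd (D.sub₁ e hs) h.1
    obtain rfl : J₂ = Ico 0 1 := by
      rcases hJ₂ with h | h
      · exact h.2
      · exact absurd (D.sub₂ e (D.glue e ⟨s, hs⟩).2) h.1
    have q₁ := comp_chart c₁ (D.comp₁ e) (D.sub₁ e) hs m₁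
    have q₂ := comp_chart c₂ (D.comp₂ e) (D.sub₂ e) (D.glue e ⟨s, hs⟩).2 m₂
    obtain ⟨T₁, T₂, t₁, t₂, ht, v, hv⟩ := match_charts (D.sub₁ e) (D.sub₂ e) (D.glue e) c₁ c₂ q₁ q₂ ⟨s, hs⟩ m₁ m₂
    obtain ⟨C₁, d₁, f₁⟩ := chart_sig c₁ t₁
    obtain ⟨C₂, d₂, f₂⟩ := chart_sig c₂ t₂
    obtain ⟨G, hG, hx⟩ := gqd.paste d₁ d₂ (fun p p' h => dW.ne_of_mem (r₁ ⟨(p.1, T₁ p.2), rfl⟩) (r₂ ⟨(p'.1, T₂ p'.2), rfl⟩) (by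
      rw [← f₁, ← f₂]; exact h)) fun v => by
        rw [f₁, f₂]; exact .inl ⟨e, ⟨_, q₁ _⟩, rfl, by rw [ht]⟩
    rw [gBB]
    refine ⟨_, .inr (.inr rfl), G, hG, ?_⟩
    have := hx v
    rw [f₁, hv] at this
    exact this
  · obtain ⟨J, hJ, G, hG, hW, hx⟩ := chart hg (gclosed hm).isOpen_compl hx
    refine ⟨J, ?_, G, ⟨hG.1, ?_⟩, hx⟩
    · rcases hJ with ⟨-, h⟩ | ⟨-, h⟩
      · exact .inr (.inl h)
      · exact .inl h
    · rw [preimage_union, hG.2, union_eq_left]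
      exact fun p hp => absurd hp (hW ⟨p, rfl⟩)

lemma gmean (hm : ∀ j, IsTopMfdWithBdry (m + 1) (D.piece j) (D.bdry j)) (ha : ∀ j, AmenableComponents ↥(D.bdry j)) :
    Finite (ZerothHomotopy ↥(D.gluedBdry ∪ D.gluedSet)) ∧
      ∀ b : ↥(D.gluedBdry ∪ D.gluedSet), HasMean (FundamentalGroup ↥(D.gluedBdry ∪ D.gluedSet) b) := by
  have cB : ∀ j, CompactSpace ↥(D.bdry j) := fun j => isCompact_iff_compactSpace.1 (mfd_closed (hm j)).isCompact
  let f : ∀ j, C(D.bdry j, ↥(D.gluedBdry ∪ D.gluedSet)) := fun j =>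
    ⟨fun t => ⟨D.emb j t, D.emb_mapsTo_bdry j t.2⟩, by fun_prop⟩
  have fe : ∀ j (t : D.bdry j) j' (t' : D.bdry j'), f j t = f j' t' → (⟨j, t⟩ : Σ j, D.piece j) = ⟨j', t'⟩ ∨ gsr D ⟨j, t⟩ ⟨j', t'⟩ :=
    fun j t j' t' h => (gqd.eq _ _).1 (congrArg Subtype.val h)
  have cc : ∀ j (t : D.bdry j), Subtype.val '' connectedComponent t = connectedComponentIn (D.bdry j) t := fun j t =>
    (connectedComponentIn_eq_image t.2).symm
  refine mean_of f (fun j t => mfd_pc (hm j) t) (fun z => ?_) (fun j t a ha b hb h => ?_) (fun j t j' t' h => ?_)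
    fun j t => (ha j t).hasMean
  · obtain ⟨⟨j, t⟩, ht, h⟩ := gBB.le z.2
    exact ⟨j, ⟨t, ht⟩, Subtype.ext h⟩
  · have hF : gF D ⟨j, a⟩ = gF D ⟨j, b⟩ := by
      rw [gF, gF, ← cc, ← cc, ← connectedComponent_eq ha, ← connectedComponent_eq hb]
    rcases fe _ _ _ _ h with h | h | h
    · exact Subtype.ext (sigma_mk_injective h)
    · exact absurd hF (gFne h)
    · exact absurd hF.symm (gFne h)
  · have key : ∀ j (t : D.bdry j) j' (t' : D.bdry j'), (∀ s ∈ connectedComponentIn (D.bdry j) t, ∃ s' ∈ connectedComponentIn (D.bdry j') t', D.emb j s = D.emb j' s') → f j '' connectedComponent t ⊆ f j' '' connectedComponent t' := by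
      rintro j t j' t' h _ ⟨s, hs, rfl⟩
      obtain ⟨s', hs', e⟩ := h s ((cc j t).le ⟨s, hs, rfl⟩)
      obtain ⟨u, hu, rfl⟩ := (cc j' t').ge hs'
      exact ⟨u, hu, Subtype.ext e.symm⟩
    have h1 : ∀ j (t : D.bdry j) j' (t' : D.bdry j'), D.rel ⟨j, t⟩ ⟨j', t'⟩ → (∀ s ∈ connectedComponentIn (D.bdry j) t, ∃ s' ∈ connectedComponentIn (D.bdry j') t', D.emb j s = D.emb j' s') ∧
        (∀ s ∈ connectedComponentIn (D.bdry j') t', ∃ s' ∈ connectedComponentIn (D.bdry j) t, D.emb j' s = D.emb j s') := by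
      rintro j ⟨t, ht⟩ j' ⟨t', ht'⟩ ⟨e, s, h, h'⟩
      cases h; cases h'
      rw [gS1 e s.2, gS2 e (D.glue e s).2]
      exact ⟨fun u hu => ⟨D.glue e ⟨u, hu⟩, (D.glue e ⟨u, hu⟩).2, Quot.sound ⟨e, ⟨u, hu⟩, rfl, rfl⟩⟩,
        fun u hu => ⟨(D.glue e).symm ⟨u, hu⟩, ((D.glue e).symm ⟨u, hu⟩).2, (Quot.sound ⟨e, (D.glue e).symm ⟨u, hu⟩, rfl, by simp⟩).symm⟩⟩
    rcases fe _ _ _ _ h with h | h | h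
    · obtain ⟨t, ht⟩ := t; obtain ⟨t', ht'⟩ := t'
      cases h; exact subset_rfl
    · exact key _ _ _ _ (h1 _ _ _ _ h).1
    · exact key _ _ _ _ (h1 _ _ _ _ h).2

end F17

section F18
open Set Filter
open Finsupp (single)
open Topology (IsOpenEmbedding IsEmbedding)
variable {K : Type} [CommRing K]

lemma mem_cI {Y : Set X} {n : ℕ} {c : Ch K X n} : (c : SChain K X n) ∈ chainsIn K X Y n ↔ c ∈ supp K {Y} n := by
  have : {σ : SSimplex X n | range σ ⊆ Y} = {σ : SSimplex X n | ∃ A ∈ ({Y} : Set (Set X)), range σ ⊆ A} := by ext; simp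
  rw [supp, ← this]
  constructor
  · rintro ⟨d, hd, rfl⟩; exact hd
  · exact fun h => ⟨c, h, rfl⟩

lemma mem_rC {Y : Set X} {n : ℕ} {c : Ch K X (n+1)} : (c : SChain K X (n+1)) ∈ relCycles K X Y n ↔ dd c ∈ supp K {Y} n := by
  rw [← mem_cI, dd_eq_bdry]; rfl

lemma mem_rB {Y : Set X} {n : ℕ} {c : Ch K X (n+1)} : (c : SChain K X (n+1)) ∈ relBdries K X Y n ↔ c ∈ bd K {Y} (n+1) := by
  rw [mem_bd]
  refine (Submodule.mem_sup (p := LinearMap.range (bdry K X (n+1))) (p' := chainsIn K X Y (n+1))).trans ?_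
  constructor
  · rintro ⟨_, ⟨b, rfl⟩, s, hs, rfl⟩
    exact ⟨b, s, mem_cI.1 hs, congrArg (fun t : Ch K X (n+1) => t + (id s : Ch K X (n+1))) (dd_eq_bdry (b : Ch K X (n+2))).symm⟩
  · rintro ⟨b, s, hs, rfl⟩
    exact ⟨_, ⟨b, rfl⟩, s, mem_cI.2 hs, congrArg (fun t : Ch K X (n+1) => t + s) (dd_eq_bdry b).symm⟩

lemma class_eq {Y : Set X} {n : ℕ} {c c' : Ch K X (n+1)} (h : (c : SChain K X (n+1)) ∈ relCycles K X Y n) (h' : (c' : SChain K X (n+1)) ∈ relCycles K X Y n) :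
    relHomClass ⟨c, h⟩ = relHomClass ⟨c', h'⟩ ↔ c - c' ∈ bd K {Y} (n+1) :=
  (Submodule.Quotient.eq _).trans (Submodule.mem_comap.trans mem_rB)

lemma psh_mem_bd {Y : Type} [TopologicalSpace Y] {F : Set (Set X)} {G : Set (Set Y)} (f : C(X,Y)) (h : ∀ A ∈ F, ∃ B ∈ G, Set.MapsTo f A B) {n : ℕ}
    {c : Ch K X n} (hc : c ∈ bd K F n) : psh f c ∈ bd K G n := by
  obtain ⟨b, s, hs, rfl⟩ := mem_bd.1 hc
  exact mem_bd.2 ⟨psh f b, _, psh_mem_supp f h hs, by rw [map_add, dd_psh]⟩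

def ic {n : ℕ} : Ch ℤ X n →+ Ch ℝ X n := Finsupp.mapRange.addMonoidHom (Int.castAddHom ℝ)
lemma ic_single {n : ℕ} (σ : SSimplex X n) (r : ℤ) : ic (single σ r) = single σ (r : ℝ) :=
  Finsupp.mapRange_single (hf := map_zero (Int.castAddHom ℝ))

lemma ic_ext {n : ℕ} {A : Type} [AddCommGroup A] {f g : Ch ℤ X n →+ A} (h : ∀ σ, f (single σ 1) = g (single σ 1)) (c : Ch ℤ X n) : f c = g c :=
  ch_ext (K := ℤ) (f := f.toIntLinearMap) (g := g.toIntLinearMap) h c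

lemma ic_dd {n : ℕ} (c : Ch ℤ X (n+1)) : ic (dd c) = dd (ic c) := by
  refine ic_ext (f := ic.comp dd.toAddMonoidHom) (g := (dd (K := ℝ)).toAddMonoidHom.comp ic) (fun σ => ?_) c
  simp [ic_single, dd, bdF]

lemma ic_psh {Y : Type} [TopologicalSpace Y] (f : C(X, Y)) {n : ℕ} (c : Ch ℤ X n) : ic (psh f c) = psh f (ic c) := by
  refine ic_ext (f := ic.comp (psh f).toAddMonoidHom) (g := (psh (K := ℝ) f).toAddMonoidHom.comp ic) (fun σ => ?_) c
  simp [ic_single, psh_single]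

lemma ic_supp {F : Set (Set X)} {n : ℕ} {c : Ch ℤ X n} (h : c ∈ supp ℤ F n) : ic c ∈ supp ℝ F n :=
  (Finset.coe_subset.2 (Finsupp.support_mapRange (hf := map_zero (Int.castAddHom ℝ)))).trans h

lemma ic_bd {F : Set (Set X)} {n : ℕ} {c : Ch ℤ X n} (h : c ∈ bd ℤ F n) : ic c ∈ bd ℝ F n := by
  obtain ⟨b, s, hs, rfl⟩ := mem_bd.1 h
  exact mem_bd.2 ⟨ic b, _, ic_supp hs, by rw [map_add, ic_dd]⟩

lemma fund {B : Set X} {n : ℕ} {μ : relHomology ℝ X B n} (h : IsFundClass X B n μ) : ∃ z : Ch ℤ X (n+1), dd z ∈ supp ℤ {B} n ∧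
    (∃ hz : (ic z : SChain ℝ X (n+1)) ∈ relCycles ℝ X B n, relHomClass ⟨ic z, hz⟩ = μ) ∧
    ∀ x ∉ B, ∀ v : Ch ℤ X (n+1), dd v ∈ supp ℤ {{x}ᶜ} n → ∃ k : ℤ, v - k • z ∈ bd ℤ {{x}ᶜ} (n+1) := by
  obtain ⟨z, hz, h1, h2⟩ := h
  refine ⟨z, mem_rC.1 hz, h1, fun x hx v hv => ?_⟩
  obtain ⟨hl, h3⟩ := h2 x hx
  obtain ⟨k, hk⟩ := h3 (relHomClass ⟨v, mem_rC.2 hv⟩)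
  exact ⟨k, (class_eq (c := v) (c' := (k • z : Ch ℤ X (n+1))) (mem_rC.2 hv) (Submodule.smul_mem _ k hl)).1 hk⟩

lemma l1_nonneg {n : ℕ} (c : Ch ℝ X n) : 0 ≤ l1 (c : SChain ℝ X n) := Finset.sum_nonneg fun _ _ => abs_nonneg _
lemma l1_eq {n : ℕ} (c : Ch ℝ X n) {s : Finset (SSimplex X n)} (h : c.support ⊆ s) : l1 (c : SChain ℝ X n) = ∑ σ ∈ s, |c σ| :=
  Finsupp.sum_of_support_subset c h _ (by simp)
lemma l1_add {n : ℕ} (c d : Ch ℝ X n) : l1 (c + d : Ch ℝ X n) ≤ l1 (c : SChain ℝ X n) + l1 (d : SChain ℝ X n) := by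
  classical
  rw [l1_eq (c + d) Finsupp.support_add, l1_eq c Finset.subset_union_left, l1_eq d Finset.subset_union_right, ← Finset.sum_add_distrib]
  exact Finset.sum_le_sum fun σ _ => abs_add_le _ _
lemma l1_smul {n : ℕ} (t : ℝ) (c : Ch ℝ X n) : l1 (t • c : Ch ℝ X n) = |t| * l1 (c : SChain ℝ X n) := by
  rw [l1_eq (t • c) Finsupp.support_smul, l1_eq c subset_rfl, Finset.mul_sum]
  exact Finset.sum_congr rfl fun σ _ => by simp [abs_mul]
lemma l1_single {n : ℕ} (σ : SSimplex X n) : l1 (single σ 1 : Ch ℝ X n) = 1 := by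
  rw [l1_eq _ Finsupp.support_single_subset]; simp
lemma le_l1 {n : ℕ} {φ : Ch ℝ X n →ₗ[ℝ] ℝ} (h : ∀ σ, |φ (single σ 1)| ≤ 1) (c : Ch ℝ X n) : |φ c| ≤ l1 (c : SChain ℝ X n) := by
  rw [l1_eq c subset_rfl]
  have : c = ∑ σ ∈ c.support, c σ • single σ (1:ℝ) := by
    conv_lhs => rw [← Finsupp.sum_single c]
    simp [Finsupp.sum]
  conv_lhs => rw [this, map_sum]
  refine (Finset.abs_sum_le_sum_abs _ _).trans (Finset.sum_le_sum fun σ _ => ?_)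
  rw [map_smul, smul_eq_mul, abs_mul]
  exact mul_le_of_le_one_right (abs_nonneg _) (h σ)

lemma hb_ex {Y : Set X} {n : ℕ} {z : Ch ℝ X (n+1)} (hz : (z : SChain ℝ X (n+1)) ∈ relCycles ℝ X Y n) :
    ∃ φ : Ch ℝ X (n+1) →ₗ[ℝ] ℝ, (∀ σ, |φ (single σ 1)| ≤ 1) ∧ (∀ c ∈ bd ℝ {Y} (n+1), φ c = 0) ∧ l1HomNorm (relHomClass ⟨z, hz⟩) ≤ φ z := by
  let S := bd ℝ ({Y} : Set (Set X)) (n+1)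
  let N : Ch ℝ X (n+1) → ℝ := fun c => ⨅ b : S, l1 (c + b : Ch ℝ X (n+1))
  have bb : ∀ c, BddBelow (range fun b : S => l1 (c + b : Ch ℝ X (n+1))) := fun c => ⟨0, by rintro _ ⟨b, rfl⟩; exact l1_nonneg _⟩
  have Nle : ∀ c (b : S), N c ≤ l1 (c + b : Ch ℝ X (n+1)) := fun c b => ciInf_le (bb c) b
  have N0 : ∀ c, 0 ≤ N c := fun c => le_ciInf fun b => l1_nonneg _
  have Nl : ∀ c, N c ≤ l1 (c : SChain ℝ X (n+1)) := fun c => by simpa using Nle c 0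
  have Nh' : ∀ t : ℝ, 0 < t → ∀ c, N (t • c) ≤ t * N c := fun t ht c => by
    rw [Real.mul_iInf_of_nonneg ht.le]
    refine le_ciInf fun b => (Nle _ (t • b)).trans_eq ?_
    have := l1_smul t (c + (b : Ch ℝ X (n+1)))
    rw [abs_of_pos ht, smul_add] at this
    exact this
  have Nh : ∀ t : ℝ, 0 < t → ∀ c, N (t • c) = t * N c := fun t ht c => by
    refine (Nh' t ht c).antisymm ?_
    have := Nh' t⁻¹ (inv_pos.2 ht) (t • c)
    rw [smul_smul, inv_mul_cancel₀ ht.ne', one_smul] at this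
    calc t * N c ≤ t * (t⁻¹ * N (t • c)) := by gcongr
      _ = _ := by field_simp
  have Na : ∀ c d, N (c + d) ≤ N c + N d := fun c d => le_ciInf_add_ciInf fun b b' => by
    refine (Nle _ (b + b')).trans (le_trans (le_of_eq ?_) (l1_add _ _))
    rw [Submodule.coe_add, add_add_add_comm]
  have Nz : l1HomNorm (relHomClass ⟨z, hz⟩) ≤ N z := le_ciInf fun b => by
    have hc : ((z + b : Ch ℝ X (n+1)) : SChain ℝ X (n+1)) ∈ relCycles ℝ X Y n := mem_rC.2 (by
      rw [map_add]; exact add_mem (mem_rC.1 hz) (dd_bd b.2))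
    exact csInf_le ⟨0, by rintro _ ⟨c, -, rfl⟩; exact l1_nonneg _⟩
      ⟨⟨_, hc⟩, (class_eq hc hz).2 (by rw [add_sub_cancel_left]; exact b.2), rfl⟩
  suffices ∃ φ : Ch ℝ X (n+1) →ₗ[ℝ] ℝ, φ z = N z ∧ ∀ c, φ c ≤ N c by
    obtain ⟨φ, h1, h2⟩ := this
    have h3 : ∀ c, |φ c| ≤ l1 (c : SChain ℝ X (n+1)) := fun c => abs_le.2 ⟨by
      have := (h2 (-c)).trans (Nl _)
      have e := l1_smul (-1) c
      rw [neg_one_smul] at e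
      rw [map_neg, e] at this; simp at this; linarith, (h2 c).trans (Nl c)⟩
    have h4 : ∀ c ∈ S, φ c ≤ 0 := fun c hc => ((h2 c).trans (Nle c ⟨-c, neg_mem hc⟩)).trans_eq (by
      show l1 (c + -c : Ch ℝ X (n+1)) = 0
      rw [add_neg_cancel, l1_eq (0 : Ch ℝ X (n+1)) (s := ∅) (by simp)]; simp)
    exact ⟨φ, fun σ => (h3 _).trans_eq (l1_single σ), fun c hc => (h4 c hc).antisymm (by
      have := h4 _ (neg_mem hc); rw [map_neg] at this; linarith), h1 ▸ Nz⟩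
  by_cases hN : N z = 0
  · exact ⟨0, by simp [hN], fun c => by simpa using N0 c⟩
  have hz0 : z ≠ 0 := fun h => hN (le_antisymm (by
    have := Nh' 2⁻¹ (by norm_num) (0 : Ch ℝ X (n+1))
    have h2 := Nh 2 two_pos (0 : Ch ℝ X (n+1))
    rw [smul_zero] at h2; rw [h]; linarith) (N0 z))
  obtain ⟨φ, h1, h2⟩ := exists_extension_of_le_sublinear (LinearPMap.mkSpanSingleton z (N z) hz0) N Nh Na (by
    rintro ⟨x, hx⟩
    obtain ⟨t, rfl⟩ := Submodule.mem_span_singleton.1 hx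
    refine (LinearPMap.mkSpanSingleton'_apply z (N z) _ t hx).trans_le ?_
    show t * N z ≤ N (t • z)
    rcases le_or_gt t 0 with ht | ht
    · exact (mul_nonpos_of_nonpos_of_nonneg ht (N0 z)).trans (N0 _)
    · exact (Nh t ht z).ge)
  refine ⟨φ, ?_, h2⟩
  have := h1 ⟨z, Submodule.mem_span_singleton_self z⟩
  exact this.trans (LinearPMap.mkSpanSingleton'_apply_self _ _ _ _)

end F18

section F19
open Set Filter
open Finsupp (single)
open Topology (IsOpenEmbedding IsEmbedding)
variable {k m : ℕ} {D : GluingData k}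

lemma gx {j : Fin k} {y : D.piece j} (hy : y ∉ D.bdry j) : D.emb j y ∉ D.gluedBdry ∪ D.gluedSet := by
  rw [gBB]; exact fun h => hy ((gqd (D := D)).mem.1 (h : gq D ⟨j, y⟩ ∈ gq D '' gB D))

lemma ginj {i j : Fin k} {a : D.piece i} {b : D.piece j} (ha : a ∉ D.bdry i) (e : D.emb i a = D.emb j b) : (⟨i, a⟩ : Σ j, D.piece j) = ⟨j, b⟩ :=
  (gqd (D := D)).inj (a := ⟨i, a⟩) (b := ⟨j, b⟩) ha e

lemma goemb {j : Fin k} {c : C(XX (Ioo 0 1) m, D.piece j)} (hc : IsOpenEmbedding c) (hB : ∀ t, c t ∉ D.bdry j) : IsOpenEmbedding ((D.emb j).comp c) :=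
  (gqd (D := D)).oemb (c := fun t => (⟨j, c t⟩ : Σ j, D.piece j)) ((IsOpenEmbedding.sigmaMk (σ := D.piece) (i := j)).comp hc) hB

lemma gmaps {j : Fin k} {y : D.piece j} (hy : y ∉ D.bdry j) : ∀ A ∈ ({{y}ᶜ} : Set (Set (D.piece j))), ∃ B ∈ ({{D.emb j y}ᶜ} : Set (Set D.Glued)), MapsTo (D.emb j) A B := by
  rintro _ rfl
  exact ⟨_, rfl, fun t ht e => ht (sigma_mk_injective (ginj hy (mem_singleton_iff.1 e).symm)).symm⟩

lemma gbm {j : Fin k} {S : Set D.Glued} (h : D.gluedBdry ∪ D.gluedSet ⊆ S) : ∀ A ∈ ({D.bdry j} : Set (Set (D.piece j))), ∃ B ∈ ({S} : Set (Set D.Glued)), MapsTo (D.emb j) A B := by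
  rintro _ rfl
  exact ⟨_, rfl, fun t ht => h (D.emb_mapsTo_bdry j ht)⟩

lemma smono {M : Type} {S T : Set M} (h : S ⊆ T) : ∀ A ∈ ({S} : Set (Set M)), ∃ B ∈ ({T} : Set (Set M)), A ⊆ B := by
  rintro _ rfl; exact ⟨_, rfl, h⟩

lemma deg [T2Space D.Glued] {j : Fin k} (hj : IsTopMfdWithBdry (m + 1) (D.piece j) (D.bdry j)) {z : Ch ℤ D.Glued (m+1)} (hz : dd z ∈ supp ℤ {D.gluedBdry} m)
    (gz : ∀ x ∉ D.gluedBdry, ∀ v : Ch ℤ D.Glued (m+1), dd v ∈ supp ℤ {{x}ᶜ} m → ∃ l : ℤ, v - l • z ∈ bd ℤ {{x}ᶜ} (m+1))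
    {a : Ch ℤ (D.piece j) (m+1)} (ha : dd a ∈ supp ℤ {D.bdry j} m)
    (ga : ∀ x ∉ D.bdry j, ∀ v : Ch ℤ (D.piece j) (m+1), dd v ∈ supp ℤ {{x}ᶜ} m → ∃ l : ℤ, v - l • a ∈ bd ℤ {{x}ᶜ} (m+1))
    {y : D.piece j} (hy : y ∉ D.bdry j) : ∃ ε : ℝ, |ε| ≤ 1 ∧ ic z - ε • psh (D.emb j) (ic a) ∈ bd ℝ {{D.emb j y}ᶜ} (m+1) := by
  have hx := gx hy
  have hs : D.gluedBdry ∪ D.gluedSet ⊆ {D.emb j y}ᶜ := fun t ht e => hx ((mem_singleton_iff.1 e) ▸ ht)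
  obtain ⟨l, hl⟩ := gz _ (fun h => hx (Or.inl h)) (psh (D.emb j) a) (by rw [dd_psh]; exact psh_mem_supp _ (gbm hs) ha)
  have hk : ∃ k : ℤ, z - k • psh (D.emb j) a ∈ bd ℤ {{D.emb j y}ᶜ} (m+1) := by
    obtain ⟨J, hJ, G, hG, -, hyG⟩ := chart hj isOpen_univ (mem_univ y)
    rcases hJ with ⟨h, -⟩ | ⟨-, rfl⟩
    · exact absurd h hy
    have hGB : ∀ t, G t ∉ D.bdry j := fun t ht => by
      have : t ∈ G ⁻¹' D.bdry j := ht
      rw [hG.2] at this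
      exact absurd this t.1.2.1.ne'
    have ho := goemb hG.1 hGB
    have hz' : dd z ∈ supp ℤ {{D.emb j y}ᶜ, {D.emb j y}ᶜ} m := by
      rw [pair_eq_singleton]; exact supp_mono (smono (subset_union_left.trans hs)) m hz
    obtain ⟨v, h1, h2, -⟩ := exc1 ho isOpen_compl_singleton (by
      rw [compl_compl, singleton_subset_iff]; obtain ⟨t, rfl⟩ := hyG; exact ⟨t, rfl⟩) hz'
    rw [pair_eq_singleton] at h1 h2
    obtain ⟨k, hk⟩ := ga y hy (psh G v) (by
      rw [dd_psh]
      refine psh_mem_supp G ?_ h1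
      rintro _ rfl
      exact ⟨_, rfl, fun t ht e => ht (congrArg (D.emb j) (mem_singleton_iff.1 e))⟩)
    have := psh_mem_bd (D.emb j) (gmaps hy) hk
    rw [map_sub, map_smul, psh_psh] at this
    exact ⟨k, by simpa using add_mem h2 this⟩
  obtain ⟨k, hk⟩ := hk
  have h0 : (1 - k * l) • z ∈ bd ℤ {{D.emb j y}ᶜ} (m+1) := by
    convert add_mem hk (Submodule.smul_mem _ k hl) using 1
    module
  by_cases hkl : k * l = 1
  · refine ⟨k, ?_, ?_⟩
    · rcases Int.isUnit_iff.1 (IsUnit.of_mul_eq_one _ hkl) with rfl | rfl <;> simp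
    · have := ic_bd hk
      rw [map_sub, map_zsmul, ic_psh] at this
      simpa [Int.cast_smul_eq_zsmul] using this
  · refine ⟨0, by simp, ?_⟩
    have := ic_bd h0
    rw [map_zsmul, ← Int.cast_smul_eq_zsmul ℝ] at this
    have hne : ((1 - k * l : ℤ) : ℝ) ≠ 0 := by
      rw [Int.cast_ne_zero]; omega
    rw [zero_smul, sub_zero]
    exact (Submodule.smul_mem_iff _ hne).1 this

lemma spread [T2Space D.Glued] {j : Fin k} [ConnectedSpace (D.piece j)] (hj : IsTopMfdWithBdry (m + 1) (D.piece j) (D.bdry j)) {w : Ch ℝ D.Glued (m+1)}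
    (hw : dd w ∈ supp ℝ {D.gluedBdry ∪ D.gluedSet} m) {y0 : D.piece j} (h0 : y0 ∉ D.bdry j) (hV : w ∈ bd ℝ {D.gluedBdry ∪ D.gluedSet, {D.emb j y0}ᶜ} (m+1))
    {y : D.piece j} (hy : y ∉ D.bdry j) : w ∈ bd ℝ {D.gluedBdry ∪ D.gluedSet, {D.emb j y}ᶜ} (m+1) := by
  refine conn_prop (mfd_dense hj) (fun y => w ∈ bd ℝ {D.gluedBdry ∪ D.gluedSet, {D.emb j y}ᶜ} (m+1)) (fun p => ?_) h0 hV y hy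
  obtain ⟨J, hJ, G, hG, -, hp⟩ := chart hj isOpen_univ (mem_univ p)
  refine ⟨range G, hG.1.isOpen_range.mem_nhds hp, ?_⟩
  have hJ' : J = Ico 0 1 ∨ J = Ioo 0 1 := hJ.imp And.right And.right
  have hsub : Ioo (0:ℝ) 1 ⊆ J := by rcases hJ' with rfl | rfl; exacts [Ioo_subset_Ico_self, subset_rfl]
  let r : C(XX (Ioo 0 1) m, XX J m) := ⟨Prod.map (inclusion hsub) id, (continuous_inclusion hsub).prodMap continuous_id⟩
  have hr : IsOpenEmbedding r := by
    refine IsOpenEmbedding.prodMap ⟨IsEmbedding.inclusion hsub, ?_⟩ IsOpenEmbedding.id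
    rw [range_inclusion]
    exact isOpen_Ioo.preimage continuous_subtype_val
  have hc : IsOpenEmbedding (G.comp r) := hG.1.comp hr
  have hB : ∀ t, (G.comp r) t ∉ D.bdry j := fun t ht => by
    have : r t ∈ G ⁻¹' D.bdry j := ht
    rw [hG.2] at this
    exact absurd this t.1.2.1.ne'
  have hq : ∀ y ∈ range G, y ∉ D.bdry j → D.emb j y ∈ range ((D.emb j).comp (G.comp r)) := by
    rintro _ ⟨t, rfl⟩ ht
    have h1 : (t.1:ℝ) ≠ 0 := fun e => ht (by
      have : t ∈ G ⁻¹' D.bdry j := by rw [hG.2]; exact e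
      exact this)
    have h2 : (t.1:ℝ) ∈ Ioo (0:ℝ) 1 := by
      have := t.1.2
      rcases hJ' with h | h
      · have h3 : (t.1:ℝ) ∈ Ico (0:ℝ) 1 := h.subset this
        exact ⟨h3.1.lt_of_ne' h1, h3.2⟩
      · exact h.subset this
    exact ⟨(⟨t.1, h2⟩, t.2), rfl⟩
  intro y hy hyI y' hy' hyI' h
  refine van_loc (goemb hc hB) ?_ hw (hq y hy hyI) (hq y' hy' hyI') h
  rw [← disjoint_iff_inter_eq_empty, disjoint_left]
  rintro _ ⟨t, rfl⟩ h
  exact gx (hB t) h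

end F19

section F20
open Set Filter
open Finsupp (single)
open Topology (IsOpenEmbedding IsEmbedding)

lemma closed_path {Y S : Set X} (hY : IsClosed Y) (hS : IsClosed S) (hd : Disjoint Y S) (γ : C(ℝ, X)) (h : ∀ t, γ t ∈ Y ∪ S) (h0 : γ 0 ∈ Y) (t : ℝ) : γ t ∈ Y := by
  have e : γ ⁻¹' Y = (γ ⁻¹' S)ᶜ := by
    ext t
    exact ⟨fun hy hs => disjoint_left.1 hd hy hs, fun hs => (h t).resolve_right hs⟩
  have : IsClopen (γ ⁻¹' Y) := ⟨hY.preimage γ.continuous, by rw [e]; exact (hS.preimage γ.continuous).isOpen_compl⟩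
  exact (this.eq_univ ⟨0, h0⟩).superset (mem_univ t)

lemma main_proof
    (d k : ℕ) (D : GluingData k)
    (hcomp : ∀ j, CompactSpace (D.piece j))
    (hconn : ∀ j, ConnectedSpace (D.piece j))
    (hmfd : ∀ j, IsTopMfdWithBdry (d + 2) (D.piece j) (D.bdry j))
    (hamen : ∀ j, AmenableComponents ↥(D.bdry j))
    (hgmfd : IsTopMfdWithBdry (d + 2) D.Glued D.gluedBdry)
    (μ : relHomology ℝ D.Glued D.gluedBdry (d + 1))
    (hμ : IsFundClass D.Glued D.gluedBdry (d + 1) μ)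
    (μp : ∀ j, relHomology ℝ (D.piece j) (D.bdry j) (d + 1))
    (hμp : ∀ j, IsFundClass (D.piece j) (D.bdry j) (d + 1) (μp j)) :
    l1HomNorm μ ≤ ∑ j, l1HomNorm (μp j) := by
  haveI : T2Space D.Glued := hgmfd.1
  haveI : CompactSpace D.Glued := by unfold GluingData.Glued; infer_instance
  obtain ⟨z, hz, ⟨hzr, rfl⟩, gz⟩ := fund hμ
  choose a ha hac ga using fun j => fund (hμp j)
  have hy : ∀ j, ∃ y, y ∉ D.bdry j := fun j => (mfd_dense (hmfd j)).nonempty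
  choose y hy using hy
  choose ε hε hεb using fun j => deg (hmfd j) hz gz (ha j) (ga j) (hy j)
  have hzb : dd (ic z) ∈ supp ℝ {D.gluedBdry ∪ D.gluedSet} (d+1) := by
    rw [← ic_dd]; exact ic_supp (supp_mono (smono subset_union_left) _ hz)
  have hab : ∀ j, dd (psh (D.emb j) (ic (a j))) ∈ supp ℝ {D.gluedBdry ∪ D.gluedSet} (d+1) := fun j => by
    rw [dd_psh, ← ic_dd]; exact psh_mem_supp _ (gbm subset_rfl) (ic_supp (ha j))
  obtain ⟨w, hw⟩ : ∃ w, w = ic z - ∑ j, ε j • psh (D.emb j) (ic (a j)) := ⟨_, rfl⟩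
  have hwd : dd w ∈ supp ℝ {D.gluedBdry ∪ D.gluedSet} (d+1) := by
    rw [hw, map_sub, map_sum]
    refine sub_mem hzb (sum_mem fun j _ => ?_)
    rw [map_smul]; exact Submodule.smul_mem _ _ (hab j)
  have hwy : ∀ j, w ∈ bd ℝ {D.gluedBdry ∪ D.gluedSet, {D.emb j (y j)}ᶜ} (d+1+1) := fun j => by
    refine bd_mono (F := {{D.emb j (y j)}ᶜ}) (by rintro _ rfl; exact ⟨_, by simp, subset_rfl⟩) _ ?_
    rw [hw, ← Finset.add_sum_erase _ _ (Finset.mem_univ j), ← sub_sub]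
    refine sub_mem (hεb j) (sum_mem fun i hi => Submodule.smul_mem _ _ (supp_le_bd _ _ ?_))
    refine psh_mem_supp (F := {univ}) _ ?_ (supp_univ _ _)
    rintro _ rfl
    exact ⟨_, rfl, fun t _ e => Finset.ne_of_mem_erase hi (congrArg Sigma.fst (ginj (hy j) (mem_singleton_iff.1 e).symm)).symm⟩
  have hwb : w ∈ bd ℝ {D.gluedBdry ∪ D.gluedSet} (d+1+1) := by
    refine glob (gcharts hmfd hgmfd) hwd fun x hx => ?_
    obtain ⟨⟨j, t⟩, rfl⟩ := (gqd (D := D)).qm.surjective x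
    have ht : t ∉ D.bdry j := fun h => hx (D.emb_mapsTo_bdry j h)
    exact spread (hmfd j) hwd (hy j) (hwy j) ht
  obtain ⟨φ, f1, f2, f3⟩ := hb_ex hzr
  obtain ⟨hfin, hmean⟩ := gmean hmfd hamen
  obtain ⟨ψ, p1, p2, p3, p4⟩ := thmB (B := D.gluedBdry ∪ D.gluedSet) (Y := D.gluedBdry) subset_union_left
    (closed_path (mfd_closed hgmfd) (gclosed hmfd) disjoint_sdiff_left) hfin hmean φ f1
    (fun c => f2 _ (dd_mem_bd c)) (fun c hc => f2 _ (supp_le_bd _ _ hc))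
  have pb : ∀ c ∈ bd ℝ {D.gluedBdry ∪ D.gluedSet} (d+1+1), ψ c = 0 := fun c hc => by
    obtain ⟨b, s, hs, rfl⟩ := mem_bd.1 hc
    rw [map_add, p2, p3 s hs, add_zero]
  refine f3.trans ?_
  rw [← p4 (ic z) (mem_rC.1 hzr)]
  have e := pb w hwb
  rw [hw, map_sub, map_sum, sub_eq_zero] at e
  rw [e]
  refine Finset.sum_le_sum fun j _ => ?_
  obtain ⟨hr, hc⟩ := hac j
  rw [map_smul, smul_eq_mul]
  refine (le_abs_self _).trans ?_
  rw [abs_mul]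
  refine (mul_le_of_le_one_left (abs_nonneg _) (hε j)).trans ?_
  refine le_csInf ⟨_, ⟨_, hr⟩, hc, rfl⟩ ?_
  rintro _ ⟨⟨c', hc1⟩, hc2, rfl⟩
  obtain ⟨c, rfl⟩ : ∃ c : Ch ℝ (D.piece j) (d+1+1), c = c' := ⟨c', rfl⟩
  have h1 := (class_eq hr hc1).1 (hc.trans hc2.symm)
  have h2 := pb _ (psh_mem_bd (D.emb j) (gbm subset_rfl) h1)
  rw [map_sub, map_sub, sub_eq_zero] at h2
  rw [h2]
  exact le_l1 (φ := ψ ∘ₗ psh (D.emb j)) (fun σ => by rw [LinearMap.comp_apply, psh_single]; exact p1 _) c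

end F20

open GluingData in
/-- **Gromov Additivity Theorem (subadditivity).**
Let `M₁, …, M_k` be compact connected oriented `n`-dimensional manifolds, `n = d + 2 ≥ 2`,
such that the fundamental group of every boundary component of every `M_j` is amenable,
and let `M` be the (connected, oriented) manifold obtained by gluing the `M_j` along some
of their boundary components (the manifold `M` is realized as the quotient `D.Glued` of
the disjoint union of the pieces; its orientability, guaranteed by the fact that the
gluing homeomorphisms are orientation-reversing, enters through the hypothesis that
`(M, ∂M)` admits a fundamental class, and the simplicial volumes do not depend on the
choices of the fundamental classes). Then
`‖M, ∂M‖ ≤ ‖M₁, ∂M₁‖ + … + ‖M_k, ∂M_k‖`. -/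
theorem gromov_additivity_le
    (d k : ℕ) (D : GluingData k)
    (hcomp : ∀ j, CompactSpace (D.piece j))
    (hconn : ∀ j, ConnectedSpace (D.piece j))
    (hmfd : ∀ j, IsTopMfdWithBdry (d + 2) (D.piece j) (D.bdry j))
    (hamen : ∀ j, AmenableComponents ↥(D.bdry j))
    (hgconn : ConnectedSpace D.Glued)
    (hgmfd : IsTopMfdWithBdry (d + 2) D.Glued D.gluedBdry)
    (μ : relHomology ℝ D.Glued D.gluedBdry (d + 1))
    (hμ : IsFundClass D.Glued D.gluedBdry (d + 1) μ)
    (μp : ∀ j, relHomology ℝ (D.piece j) (D.bdry j) (d + 1))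
    (hμp : ∀ j, IsFundClass (D.piece j) (D.bdry j) (d + 1) (μp j)) :
    l1HomNorm μ ≤ ∑ j, l1HomNorm (μp j) := by
  exact main_proof d k D hcomp hconn hmfd hamen hgmfd μ hμ μp hμp

end BddCoh
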